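/- Card(M_BB(4)) = 24: there are exactly 24 Turing machines with at most 4 states (in the model without a separate halting state) that halt on the all-zero tape with a computed word containing exactly BB(4) = 12 ones. -/

import Mathlib

/-- Head movement directions. -/
inductive Dir : Type
  | left | stay | right

/-- Displacement of the head for each direction. -/
def Dir.move : Dir → ℤ
  | .left => -1
  | .stay => 0
  | .right => 1

/-- A configuration of a Turing machine with state type `Q`: current state,
head position and the two-way infinite binary tape. -/
structure Cfg (Q : Type) where
  state : Q
  head : ℤ
  tape : ℤ → Bool

/-- One step of the machine with partial transition function `f`
(`none` if the machine halts, i.e. `f` is undefined on the current pair). -/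
def stepTM {Q : Type} (f : Q × Bool → Option (Q × Bool × Dir)) (c : Cfg Q) :
    Option (Cfg Q) :=
  (f (c.state, c.tape c.head)).map fun qbd =>
    ⟨qbd.1, c.head + qbd.2.2.move, Function.update c.tape c.head qbd.2.1⟩

/-- Running `t` steps (returns `none` if the machine halts strictly before `t` steps). -/
def stepsTM {Q : Type} (f : Q × Bool → Option (Q × Bool × Dir)) :
    ℕ → Cfg Q → Option (Cfg Q)
  | 0, c => some c
  | t + 1, c => (stepTM f c).bind (stepsTM f t)

/-- Initial configuration: initial state `q0`, head at `0`, all-zero tape. -/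
def initCfg {Q : Type} (q0 : Q) : Cfg Q := ⟨q0, 0, fun _ => false⟩

/-- The machine is halted in configuration `c`: the transition function is
undefined on the current (state, symbol) pair. -/
def Halted {Q : Type} (f : Q × Bool → Option (Q × Bool × Dir)) (c : Cfg Q) : Prop :=
  f (c.state, c.tape c.head) = none

/-- `w` is the tape contents from the leftmost 1 to the rightmost 1
(the empty word if the tape contains no 1). -/
def TapeWord (tape : ℤ → Bool) (w : List Bool) : Prop :=
  ∃ i : ℤ,
    (∀ k : ℕ, k < w.length → w.getD k false = tape (i + k)) ∧
    (∀ j : ℤ, tape j = true → i ≤ j ∧ j < i + w.length) ∧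
    (w ≠ [] → w.getD 0 false = true ∧ w.getLastD false = true)

/-- The machine with transition function `f` and initial state `q0`, started on
the all-zero tape, halts after exactly `t` steps computing the word `w`. -/
def Computes {Q : Type} (f : Q × Bool → Option (Q × Bool × Dir)) (q0 : Q)
    (w : List Bool) (t : ℕ) : Prop :=
  ∃ c : Cfg Q, stepsTM f t (initCfg q0) = some c ∧ Halted f c ∧ TapeWord c.tape w

namespace BB4

/-! ## Bit-sliced machines -/

/-- Bit planes of one transition table entry (one lane per machine). -/
structure Ent where
  s0 : ℕ
  s1 : ℕ
  w : ℕ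
  r : ℕ
  l : ℕ

/-- Bit planes of a whole transition table. -/
structure Mach where
  a0 : Ent
  a1 : Ent
  b0 : Ent
  b1 : Ent
  c0 : Ent
  c1 : Ent
  d0 : Ent
  d1 : Ent

/-- Eight planes, one per table entry. -/
structure Oct where
  a0 : ℕ
  a1 : ℕ
  b0 : ℕ
  b1 : ℕ
  c0 : ℕ
  c1 : ℕ
  d0 : ℕ
  d1 : ℕ

noncomputable section

def mux3 (R L Z a b c : ℕ) : ℕ := Nat.lor (Nat.lor (Nat.land R a) (Nat.land L b)) (Nat.land Z c)

def hd (l : List ℕ) : ℕ := List.rec 0 (fun x _ _ => x) l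

def shiftPl (R L Z : ℕ) (l : List ℕ) : ℕ → List ℕ :=
  List.rec (fun _ => []) (fun x xs ih prev => mux3 R L Z prev (hd xs) x :: ih x) l

def lastPl (l : List ℕ) : ℕ → ℕ := List.rec (fun p => p) (fun x _ ih _ => ih x) l

def Mach.oct (p : Ent → ℕ) (m : Mach) : Oct :=
  ⟨p m.a0, p m.a1, p m.b0, p m.b1, p m.c0, p m.c1, p m.d0, p m.d1⟩

def Oct.sum (o : Oct) : ℕ :=
  Nat.lor (Nat.lor (Nat.lor o.a0 o.a1) (Nat.lor o.b0 o.b1))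
    (Nat.lor (Nat.lor o.c0 o.c1) (Nat.lor o.d0 o.d1))

def Oct.and (o u : Oct) : Oct :=
  ⟨Nat.land o.a0 u.a0, Nat.land o.a1 u.a1, Nat.land o.b0 u.b0, Nat.land o.b1 u.b1,
   Nat.land o.c0 u.c0, Nat.land o.c1 u.c1, Nat.land o.d0 u.d0, Nat.land o.d1 u.d1⟩

def Oct.mask (o : Oct) (x : ℕ) : Oct :=
  ⟨Nat.land o.a0 x, Nat.land o.a1 x, Nat.land o.b0 x, Nat.land o.b1 x,
   Nat.land o.c0 x, Nat.land o.c1 x, Nat.land o.d0 x, Nat.land o.d1 x⟩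

/-- One-hot selection planes from the state bits and the scanned symbol. -/
def sel (full s0 s1 a : ℕ) : Oct :=
  (fun t0 t1 z =>
    (fun qa qb qc qd =>
      ⟨Nat.land qa z, Nat.land qa a, Nat.land qb z, Nat.land qb a,
       Nat.land qc z, Nat.land qc a, Nat.land qd z, Nat.land qd a⟩)
      (Nat.land t1 t0) (Nat.land t1 s0) (Nat.land s1 t0) (Nat.land s1 s0))
    (Nat.xor full s0) (Nat.xor full s1) (Nat.xor full a)

def dot (p : Ent → ℕ) (m : Mach) (e : Oct) : ℕ := Oct.sum (Oct.and e (m.oct p))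

/-- Bit-sliced tape, relative to the head: scanned cell, left cells, right cells and the lanes
for which a `1` has left the window. -/
structure Tp where
  a : ℕ
  l : List ℕ
  r : List ℕ
  lost : ℕ

/-- Bit-sliced configuration. -/
structure PCfg where
  s0 : ℕ
  s1 : ℕ
  t : Tp

def Tp.shift (c : Tp) (R L Z w : ℕ) : Tp :=
  ⟨mux3 R L Z (hd c.r) (hd c.l) w, shiftPl R L Z c.l w, shiftPl L R Z c.r w,
    Nat.lor c.lost (Nat.lor (Nat.land R (lastPl c.l 0)) (Nat.land L (lastPl c.r 0)))⟩

def keep (mv Z x y : ℕ) : ℕ := Nat.lor (Nat.land mv x) (Nat.land Z y)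

def pstep1 (m : Mach) (c : PCfg) (e : Oct) (R L mv Z : ℕ) : PCfg :=
  ⟨keep mv Z (dot Ent.s0 m e) c.s0, keep mv Z (dot Ent.s1 m e) c.s1,
    c.t.shift R L Z (keep mv Z (dot Ent.w m e) c.t.a)⟩

def PCfg.sel (full : ℕ) (c : PCfg) : Oct := BB4.sel full c.s0 c.s1 c.t.a

def pstep (full : ℕ) (m : Mach) (c : PCfg) : PCfg :=
  (fun e => (fun R L => (fun mv => pstep1 m c e R L mv (Nat.xor full mv)) (Nat.lor R L))
    (dot Ent.r m e) (dot Ent.l m e)) (c.sel full)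

/-- Force the evaluation of `x` before continuing. -/
def force {r : Type} (x : ℕ) (k : r) : r := Bool.rec k k (Nat.ble 0 x)

def forceL {r : Type} (l : List ℕ) (k : r) : r := List.rec k (fun x _ ih => force x ih) l

def Tp.force {r : Type} (c : Tp) (k : Tp → r) : r :=
  (fun a l r lost =>
    BB4.force a (BB4.force lost (forceL l (forceL r (k ⟨a, l, r, lost⟩)))))
    c.a c.l c.r c.lost

def PCfg.force {r : Type} (c : PCfg) (k : PCfg → r) : r :=
  (fun s0 s1 => BB4.force s0 (BB4.force s1 (c.t.force fun t => k ⟨s0, s1, t⟩))) c.s0 c.s1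

def psteps (full : ℕ) (m : Mach) (T : ℕ) : PCfg → PCfg :=
  Nat.rec (fun c => c) (fun _ ih c => PCfg.force (pstep full m c) ih) T

def zeros (n : ℕ) : List ℕ := Nat.rec [] (fun _ ih => 0 :: ih) n

def pinit (W : ℕ) : PCfg := ⟨0, 0, ⟨0, zeros W, zeros W, 0⟩⟩

/-- unary counter -/
def addU (x : ℕ) (u : List ℕ) : ℕ → List ℕ :=
  List.rec (fun _ => []) (fun y _ ih prev => Nat.lor y (Nat.land prev x) :: ih y) u

def cntU (full : ℕ) (xs : List ℕ) : List ℕ → List ℕ :=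
  List.rec (fun u => u) (fun x _ ih u => ih (addU x u full)) xs

/-- Lanes where at least eleven of the cells other than the scanned one carry a `1`. -/
def big (full : ℕ) (c : Tp) : ℕ := lastPl (cntU full c.r (cntU full c.l (zeros 11))) 0

/-- Halting planes: the lane is halted at the given entry, without loss and with few ones. -/
def hits (full : ℕ) (m : Mach) (c : PCfg) : Oct :=
  (fun e => Oct.mask e (Nat.xor full (Nat.lor (Nat.lor (dot Ent.r m e) (dot Ent.l m e))
     (Nat.lor c.t.lost (big full c.t)))))
    (c.sel full)

def runHits (full : ℕ) (m : Mach) (T W : ℕ) : Oct := hits full m (psteps full m T (pinit W))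

/-! ### Translated cycles -/

structure Cyc where
  c : PCfg
  k : Tp
  eL : List ℕ
  eR : List ℕ
  ok : ℕ

def orL (l : List ℕ) : ℕ := List.rec 0 (fun x _ ih => Nat.lor x ih) l

def orZ (l : List ℕ) : List ℕ → List ℕ :=
  List.rec (fun _ => []) (fun x _ ih us => List.rec [] (fun u us _ => Nat.lor x u :: ih us) us) l

/-- Lanes where the two lists differ. -/
def xorL (l : List ℕ) : List ℕ → ℕ :=
  List.rec (fun _ => 0) (fun x _ ih us => List.rec 0 (fun u us _ => Nat.lor (Nat.xor x u) (ih us)) us) l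

def suf (l : List ℕ) : List ℕ :=
  List.rec [] (fun x _ ih => (fun t => Nat.lor x (hd t) :: t) ih) l

/-- Lanes where the two lists differ in a position selected by the mask. -/
def xorM (s : List ℕ) : List ℕ → List ℕ → ℕ :=
  List.rec (fun _ _ => 0) (fun e _ ih l us => List.rec 0 (fun x l _ =>
    List.rec 0 (fun u us _ => Nat.lor (Nat.land e (Nat.xor x u)) (ih l us)) us) l) s

def moving (full : ℕ) (m : Mach) (c : PCfg) : ℕ :=
  (fun e => Nat.lor (dot Ent.r m e) (dot Ent.l m e)) (c.sel full)

def cycChk (full : ℕ) (m : Mach) (c0 : PCfg) (x : Cyc) : ℕ :=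
  Nat.land (Nat.land (moving full m x.c)
      (Nat.xor full (Nat.lor (Nat.lor x.c.t.lost x.k.lost)
        (Nat.lor (Nat.xor x.c.t.a c0.t.a) (Nat.lor (Nat.xor x.c.s0 c0.s0) (Nat.xor x.c.s1 c0.s1))))))
    (Nat.lor
      (Nat.xor full (Nat.lor (orL x.k.r) (Nat.lor (xorL x.c.t.r c0.t.r) (xorM (suf x.eL) x.c.t.l c0.t.l))))
      (Nat.xor full (Nat.lor (orL x.k.l) (Nat.lor (xorL x.c.t.l c0.t.l) (xorM (suf x.eR) x.c.t.r c0.t.r)))))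

def cycStep1 (x : Cyc) (k : Tp) (c : PCfg) : Cyc :=
  ⟨c, k, orZ x.eL k.r, orZ x.eR k.l, x.ok⟩

def cycStep (full : ℕ) (m : Mach) (x : Cyc) : Cyc :=
  (fun e => (fun R L => cycStep1 x (x.k.shift R L (Nat.xor full (Nat.lor R L)) x.k.a) (pstep full m x.c))
    (dot Ent.r m e) (dot Ent.l m e)) (x.c.sel full)

def cycAdd (full : ℕ) (m : Mach) (c0 : PCfg) (x : Cyc) : Cyc :=
  ⟨x.c, x.k, x.eL, x.eR, Nat.lor x.ok (cycChk full m c0 x)⟩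

def Cyc.force {r : Type} (x : Cyc) (f : Cyc → r) : r :=
  (fun eL eR ok => x.c.force fun c => x.k.force fun k => forceL eL (forceL eR (BB4.force ok
    (f ⟨c, k, eL, eR, ok⟩)))) x.eL x.eR x.ok

def cycLoop (full : ℕ) (m : Mach) (c0 : PCfg) (T : ℕ) : Cyc → ℕ :=
  Nat.rec (fun x => x.ok)
    (fun _ ih x => Cyc.force (cycAdd full m c0 (cycStep full m x)) ih) T

/-- Lanes that provably run forever because of a translated cycle that starts at time `p`. -/
def cycOk (full : ℕ) (m : Mach) (p T W : ℕ) : ℕ :=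
  (psteps full m p (pinit W)).force fun c0 =>
    cycLoop full m c0 T ⟨c0, ⟨full, zeros W, zeros W, 0⟩, zeros W, zeros W, 0⟩

/-! ### Loading and compaction -/

def lowMask (k : ℕ) : ℕ := Nat.sub (Nat.shiftLeft 1 k) 1

/-- Concatenate forty bit codes. -/
def horner (cs : List ℕ) : ℕ :=
  List.rec 0 (fun c _ ih => Nat.lor (Nat.land c (lowMask 40)) (Nat.shiftLeft ih 40)) cs

/-- One bit for every code, with stride forty. -/
def mask (cs : List ℕ) : ℕ := List.rec 0 (fun _ _ ih => Nat.lor 1 (Nat.shiftLeft ih 40)) cs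

def mkEnt (f : ℕ → ℕ) (b : ℕ) : Ent :=
  ⟨f b, f (Nat.add b 1), f (Nat.add b 2), f (Nat.add b 3), f (Nat.add b 4)⟩

def mkMach (f : ℕ → ℕ) : Mach :=
  ⟨mkEnt f 0, mkEnt f 5, mkEnt f 10, mkEnt f 15, mkEnt f 20, mkEnt f 25, mkEnt f 30, mkEnt f 35⟩

/-- Lane `40 * i` holds the machine with code number `i`. -/
def loadM (mk B : ℕ) : Mach := mkMach fun b => Nat.land (Nat.shiftRight B b) mk

def Ent.bmap (f : ℕ → ℕ) (e : Ent) : Ent := ⟨f e.s0, f e.s1, f e.w, f e.r, f e.l⟩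

def Mach.emap (f : Ent → Ent) (m : Mach) : Mach :=
  ⟨f m.a0, f m.a1, f m.b0, f m.b1, f m.c0, f m.c1, f m.d0, f m.d1⟩

def Mach.bmap (f : ℕ → ℕ) (m : Mach) : Mach := m.emap (Ent.bmap f)

def Ent.zip (f : ℕ → ℕ → ℕ) (e u : Ent) : Ent :=
  ⟨f e.s0 u.s0, f e.s1 u.s1, f e.w u.w, f e.r u.r, f e.l u.l⟩

def Mach.zip (f : ℕ → ℕ → ℕ) (m u : Mach) : Mach :=
  ⟨m.a0.zip f u.a0, m.a1.zip f u.a1, m.b0.zip f u.b0, m.b1.zip f u.b1,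
   m.c0.zip f u.c0, m.c1.zip f u.c1, m.d0.zip f u.d0, m.d1.zip f u.d1⟩

def Ent.force {r : Type} (e : Ent) (k : Ent → r) : r :=
  (fun s0 s1 w r l => BB4.force s0 (BB4.force s1 (BB4.force w (BB4.force r (BB4.force l
    (k ⟨s0, s1, w, r, l⟩)))))) e.s0 e.s1 e.w e.r e.l

def Mach.force {r : Type} (m : Mach) (k : Mach → r) : r :=
  m.a0.force fun a0 => m.a1.force fun a1 => m.b0.force fun b0 => m.b1.force fun b1 =>
  m.c0.force fun c0 => m.c1.force fun c1 => m.d0.force fun d0 => m.d1.force fun d1 =>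
  k ⟨a0, a1, b0, b1, c0, c1, d0, d1⟩

def prefX (full : ℕ) (ps : List ℕ) : ℕ → ℕ :=
  List.rec (fun x => x) (fun p _ ih x => ih (Nat.land full (Nat.xor x (Nat.shiftLeft x p)))) ps

/-- Move the lanes selected by `mv` down by `p`. -/
def moveDown (p keep mv x : ℕ) : ℕ := Nat.lor (Nat.land x keep) (Nat.shiftRight (Nat.land x mv) p)

def compact1 (p keep mv tgt : ℕ) (m : Mach) (k : Mach → ℕ → Bool) : Bool :=
  Bool.rec false (Bool.rec false
    (Mach.force (m.bmap (moveDown p keep mv)) fun m => k m (Nat.lor keep tgt))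
    (Nat.beq (Nat.land mv (lowMask p)) 0)) (Nat.beq (Nat.land keep tgt) 0)

/-- Move all live lanes to the lowest positions. -/
def compact (full : ℕ) (qs ps : List ℕ) (k : Mach → ℕ → Bool) : Mach → ℕ → ℕ → Bool :=
  List.rec (fun m A _ => k m A) (fun p _ ih m A mk =>
    (fun mp => (fun mv => compact1 p (Nat.xor A mv) mv (Nat.shiftRight mv p) m
        fun m' A' => ih m' A' (Nat.land mk (Nat.xor full mp)))
      (Nat.land mp A)) (prefX full qs mk)) ps

/-- The powers of two below `2 ^ d`, starting from `x`. -/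
def pows (d : ℕ) : ℕ → List ℕ := Nat.rec (fun _ => []) (fun _ ih x => x :: ih (Nat.mul 2 x)) d

/-- Compact `2 ^ d` lanes into `N` lanes. -/
def pack (d N : ℕ) (m : Mach) (A : ℕ) (k : Mach → ℕ → Bool) : Bool :=
  (fun full ps => compact full ps ps
    (fun m A => Bool.rec false (k m A) (Nat.ble A (lowMask N)))
    m A (Nat.land full (Nat.shiftLeft (Nat.xor full A) 1))) (lowMask (Nat.pow 2 d)) (pows d 1)

/-! ### Filling in an undefined transition in all sixteen ways -/

def cat (N full : ℕ) (xs : List ℕ) : ℕ :=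
  List.rec 0 (fun x _ ih => Nat.lor (Nat.land full x) (Nat.shiftLeft ih N)) xs

def rep (N full x : ℕ) : ℕ := cat N full [x, x, x, x, x, x, x, x, x, x, x, x, x, x, x, x]

/-- Fill the marked entries (both direction bits set). -/
def Ent.fill (e : Ent) (C0 C1 C2 C3 : ℕ) (rp : ℕ → ℕ) : Ent :=
  (fun s0 s1 w r l => (fun h => ⟨Nat.xor s0 (Nat.land h (Nat.xor s0 C0)),
    Nat.xor s1 (Nat.land h (Nat.xor s1 C1)), Nat.xor w (Nat.land h (Nat.xor w C2)),
    Nat.xor r (Nat.land h (Nat.xor r C3)), Nat.xor l (Nat.land h C3)⟩) (Nat.land r l))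
    (rp e.s0) (rp e.s1) (rp e.w) (rp e.r) (rp e.l)

def Mach.fill (N full : ℕ) (m : Mach) : Mach :=
  (fun C0 C1 C2 C3 => m.emap fun e => e.fill C0 C1 C2 C3 (rep N full))
      (cat N full [0, full, 0, full, 0, full, 0, full, 0, full, 0, full, 0, full, 0, full])
      (cat N full [0, 0, full, full, 0, 0, full, full, 0, 0, full, full, 0, 0, full, full])
      (cat N full [0, 0, 0, 0, full, full, full, full, 0, 0, 0, 0, full, full, full, full])
      (cat N full [0, 0, 0, 0, 0, 0, 0, 0, full, full, full, full, full, full, full, full])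

/-- Mark an entry. -/
def Ent.mark (e : Ent) (h : ℕ) : Ent := ⟨e.s0, e.s1, e.w, Nat.lor e.r h, Nat.lor e.l h⟩

def Mach.mark (m : Mach) (h : Oct) : Mach :=
  ⟨m.a0.mark h.a0, m.a1.mark h.a1, m.b0.mark h.b0, m.b1.mark h.b1,
   m.c0.mark h.c0, m.c1.mark h.c1, m.d0.mark h.d0, m.d1.mark h.d1⟩



def Mach.undef (m : Mach) (full : ℕ) : Oct :=
  m.oct fun e => Nat.xor full (Nat.lor e.r e.l)

/-! ### n-gram closed position sets -/

/-- Binary trees of planes. -/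
inductive PT where
  | leaf (x : ℕ)
  | node (a b : PT)

def PT.map (f : ℕ → ℕ) (t : PT) : PT := PT.rec (fun x => .leaf (f x)) (fun _ _ a b => .node a b) t

def PT.or (t : PT) : PT → PT :=
  PT.rec (fun x u => PT.rec (fun y => .leaf (Nat.lor x y)) (fun _ _ a b => .node a b) u)
    (fun a b iha ihb u => PT.rec (fun y => .node (a.map (Nat.lor y)) (b.map (Nat.lor y)))
      (fun c d _ _ => .node (iha c) (ihb d)) u) t

def PT.any (t : PT) : ℕ := PT.rec (fun x => x) (fun _ _ a b => Nat.lor a b) t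

def PT.c0 (t : PT) : PT := PT.rec (fun x => .leaf x) (fun a _ _ _ => a) t

def PT.c1 (t : PT) : PT := PT.rec (fun x => .leaf x) (fun _ b _ _ => b) t

/-- Merge the two branches at depth `d`. -/
def PT.drop (d : ℕ) : PT → PT :=
  Nat.rec (fun t => t.c0.or t.c1) (fun _ ih t => .node (ih t.c0) (ih t.c1)) d

/-- Insert a branching at depth `d`. -/
def PT.ins (d : ℕ) : PT → PT → PT :=
  Nat.rec (fun t u => .node t u) (fun _ ih t u => .node (ih t.c0 u.c0) (ih t.c1 u.c1)) d

/-- Exchange the first `d` levels with the following `n` levels. -/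
def PT.tr (n d : ℕ) : PT → PT :=
  Nat.rec (fun t => t) (fun _ ih t => PT.ins n (ih t.c0) (ih t.c1)) d

/-- Project on the first `d` levels. -/
def PT.projL (d : ℕ) : PT → PT :=
  Nat.rec (fun t => .leaf t.any) (fun _ ih t => .node (ih t.c0) (ih t.c1)) d

/-- `ext u p`: path `q ++ [x]` gets `u q` and `p (q ++ [x])`. -/
def PT.extend (u : PT) : PT → PT :=
  PT.rec (fun v p => p.map (Nat.land v)) (fun _ _ iha ihb p =>
    PT.rec (fun y => .leaf y) (fun c d _ _ => .node (iha c) (ihb d)) p) u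

/-- At depth `d`, follow branch `b` and extend by `p`. -/
def PT.next (b : Bool) (p : PT) (d : ℕ) : PT → PT :=
  Nat.rec (fun t => (Bool.rec t.c0 t.c1 b : PT).extend p)
    (fun _ ih t => .node (ih t.c0) (ih t.c1)) d

def psum (es : List ℕ) : List PT → PT → PT :=
  List.rec (fun _ z => z) (fun e _ ih ts z => List.rec z (fun t us _ => (t.map (Nat.land e)).or (ih us z)) ts) es

def PT.zero (d : ℕ) : PT := Nat.rec (.leaf 0) (fun _ ih => .node ih ih) d

def PT.single (x : ℕ) (d : ℕ) : PT :=
  Nat.rec (.leaf x) (fun d ih => .node ih (PT.zero d)) d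

def PT.viol (t : PT) (full : ℕ) : PT → ℕ :=
  PT.rec (fun x u => PT.rec (fun y => Nat.xor (Nat.lor x y) y) (fun _ _ _ _ => full) u)
    (fun _ _ iha ihb u => PT.rec (fun _ => full) (fun c d _ _ => Nat.lor (iha c) (ihb d)) u) t

def tmap (f : PT → PT) (l : List PT) : List PT := List.rec [] (fun t _ ih => f t :: ih) l

def tzip (l : List PT) : List PT → List PT :=
  List.rec (fun _ => []) (fun t _ ih us => List.rec [] (fun u us _ => t.or u :: ih us) us) l

/-- Transition selection planes for one target: lists over the eight entries. -/
structure Tgt where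
  w0 : List ℕ
  w1 : List ℕ

/-- The selection planes for one direction: the direction planes and the four targets. -/
structure Sel where
  d : List ℕ
  ta : Tgt
  tb : Tgt
  tc : Tgt
  td : Tgt

def Oct.list (o : Oct) : List ℕ := [o.a0, o.a1, o.b0, o.b1, o.c0, o.c1, o.d0, o.d1]

def mkTgt (full : ℕ) (m : Mach) (g : Ent → ℕ) : Tgt :=
  ⟨(m.oct fun e => Nat.land (g e) (Nat.xor full e.w)).list, (m.oct fun e => Nat.land (g e) e.w).list⟩

def mkSel (full : ℕ) (m : Mach) (dir : Ent → ℕ) : Sel :=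
  ⟨(m.oct dir).list,
   mkTgt full m fun e => Nat.land (dir e) (Nat.land (Nat.xor full e.s1) (Nat.xor full e.s0)),
   mkTgt full m fun e => Nat.land (dir e) (Nat.land (Nat.xor full e.s1) e.s0),
   mkTgt full m fun e => Nat.land (dir e) (Nat.land e.s1 (Nat.xor full e.s0)),
   mkTgt full m fun e => Nat.land (dir e) (Nat.land e.s1 e.s0)⟩

def tgtNew (n : ℕ) (other : PT) (cs : List PT) (t : Tgt) (rest : List PT) : List PT :=
  (fun t0 t1 => .node (PT.next false other n t0) (PT.next false other n t1) ::
      .node (PT.next true other n t0) (PT.next true other n t1) :: rest)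
    (psum t.w0 cs (PT.zero 0)) (psum t.w1 cs (PT.zero 0))

/-- New positions reached by moving in the given direction; `n + 1` is the gram length. -/
def newMid (n : ℕ) (S : Sel) (other : PT) (M : List PT) : List PT :=
  (fun cs => tgtNew n other cs S.ta <| tgtNew n other cs S.tb <| tgtNew n other cs S.tc <|
    tgtNew n other cs S.td []) (tmap (PT.drop n) M)

def newOwn (n : ℕ) (S : Sel) (M : List PT) : PT := PT.projL (Nat.succ n) (psum S.d M (PT.zero 0))

structure XS where
  L : PT
  R : PT
  M : List PT

def PT.force {r : Type} (t : PT) (k : r) : r := BB4.force t.any k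

def forceT {r : Type} (l : List PT) (k : r) : r := List.rec k (fun t _ ih => t.force ih) l

def XS.force {r : Type} (X : XS) (k : XS → r) : r :=
  (fun L R M => PT.force L (PT.force R (forceT M (k ⟨L, R, M⟩)))) X.L X.R X.M

def phaseR (n : ℕ) (SR : Sel) (X : XS) : XS :=
  ⟨X.L.or (newOwn n SR X.M), X.R, tzip X.M (newMid n SR X.R X.M)⟩

def XS.flip (n : ℕ) (X : XS) : XS := ⟨X.R, X.L, tmap (PT.tr (Nat.succ n) (Nat.succ n)) X.M⟩

def xiter (n : ℕ) (SR SL : Sel) (k : ℕ) : XS → XS :=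
  Nat.rec (fun X => X) (fun _ ih X =>
    XS.force (phaseR n SR X) fun Y => XS.force (XS.flip n (phaseR n SL (XS.flip n Y))) ih) k

def violL (full : ℕ) (l : List PT) : List PT → ℕ :=
  List.rec (fun _ => 0) (fun t _ ih us => List.rec full (fun u us _ => Nat.lor (t.viol full u) (ih us)) us) l

def openR (full n : ℕ) (SR : Sel) (X : XS) : ℕ :=
  Nat.lor ((newOwn n SR X.M).viol full X.L) (violL full (newMid n SR X.R X.M) X.M)

def anyHalt (us : List ℕ) : List PT → ℕ :=
  List.rec (fun _ => 0) (fun u _ ih ts => List.rec u (fun t ts _ => Nat.lor (Nat.land u t.any) (ih ts)) ts) us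

def xinit (full n : ℕ) : XS :=
  ⟨PT.single full (Nat.succ n), PT.single full (Nat.succ n),
   [PT.single full (Nat.mul 2 (Nat.succ n)), PT.zero (Nat.mul 2 (Nat.succ n)), PT.zero (Nat.mul 2 (Nat.succ n)),
    PT.zero (Nat.mul 2 (Nat.succ n)), PT.zero (Nat.mul 2 (Nat.succ n)), PT.zero (Nat.mul 2 (Nat.succ n)),
    PT.zero (Nat.mul 2 (Nat.succ n)), PT.zero (Nat.mul 2 (Nat.succ n))]⟩

def notInit (full n : ℕ) (X : XS) : ℕ :=
  (fun I => Nat.lor (I.L.viol full X.L) (Nat.lor (I.R.viol full X.R) (violL full I.M X.M))) (xinit full n)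

/-- Lanes for which the position set `X` is not a proof of non-halting. -/
def cpsBad (full n : ℕ) (m : Mach) (SR SL : Sel) (X : XS) : ℕ :=
  Nat.lor (Nat.lor (openR full n SR X) (openR full n SL (XS.flip n X)))
    (Nat.lor (notInit full n X) (anyHalt (m.undef full).list X.M))

def cps (full n k : ℕ) (m : Mach) : ℕ :=
  (fun SR SL => cpsBad full n m SR SL (xiter n SR SL k (xinit full n)))
    (mkSel full m Ent.r) (mkSel full m Ent.l)

/-! ### Drivers -/

/-- Continue only if the condition holds. -/
def andB (a b : Bool) : Bool := Bool.rec false b a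

/-- Load a list of codes into `2 ^ d` lanes; the continuation gets `N` lanes. -/
def withCodes (d N : ℕ) (cs : List ℕ) (k : Mach → ℕ → Bool) : Bool :=
  (fun mk => pack d N (loadM mk (horner cs)) mk k) (mask cs)

/-- Append the second batch after lane `N`. -/
def append (N : ℕ) (m : Mach) (A : ℕ) (m' : Mach) (A' : ℕ) (k : Mach → ℕ → Bool) : Bool :=
  (fun f => k (m.zip f m') (f A A'))
    (fun x y => Nat.lor (Nat.land x (lowMask N)) (Nat.shiftLeft y N))

/-- Sizes for one level: `N` lanes to fill, run for `T` steps in a window of width `W`,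
`2 ^ d ≥ 16 * N`, with `H` resulting lanes to fill and `P` undecided lanes. -/
structure Lv where
  N : ℕ
  T : ℕ
  W : ℕ
  d : ℕ
  H : ℕ
  P : ℕ

def levelOut (v : Lv) (full : ℕ) (m : Mach) (alive : ℕ) (k : Mach → ℕ → Mach → ℕ → Bool)
    (h : Oct) : Bool :=
  (fun hit mm =>
    pack v.d v.H mm (Nat.land (Nat.land alive hit) (mm.undef full).sum) fun mh ah =>
    pack v.d v.P m (Nat.xor alive (Nat.land alive hit)) fun mp ap => k mh ah mp ap)
    h.sum (m.mark h)

/-- Fill the marked entries in all ways and run the resulting machines. -/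
def level (v : Lv) (m0 : Mach) (alive0 : ℕ) (k : Mach → ℕ → Mach → ℕ → Bool) : Bool :=
  (fun full => Bool.rec false
    ((fun full' alive => Mach.force (m0.fill v.N full) fun m =>
        levelOut v full' m alive k (runHits full' m v.T v.W))
      (lowMask (Nat.mul 16 v.N)) (rep v.N full alive0)) (Nat.ble alive0 full)) (lowMask v.N)

def levels (vs : List Lv) (k : Mach → ℕ → Mach → ℕ → Bool) : Mach → ℕ → Mach → ℕ → Bool :=
  List.rec k (fun v _ ih m A mp ap => level v m A fun mh ah mq aq =>
    append v.P mq aq mp ap fun mp ap => Mach.force mp fun mp => ih mh ah mp ap) vs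

def cpsStage (d N N' g K : ℕ) (m : Mach) (A : ℕ) (k : Mach → ℕ → Bool) : Bool :=
  (fun full => Bool.rec false (pack d N' m (Nat.land A (cps full g K m)) k) (Nat.ble A full)) (lowMask N)

def cycStage (d N N' p T W : ℕ) (m : Mach) (A : ℕ) (k : Mach → ℕ → Bool) : Bool :=
  (fun full => Bool.rec false (pack d N' m (Nat.land A (Nat.xor full (cycOk full m p T W))) k)
    (Nat.ble A full)) (lowMask N)

def Ent.eqB (e u : Ent) (k : Bool) : Bool :=
  Bool.rec false (Bool.rec false (Bool.rec false (Bool.rec false (Bool.rec false k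
    (Nat.beq e.l u.l)) (Nat.beq e.r u.r)) (Nat.beq e.w u.w)) (Nat.beq e.s1 u.s1)) (Nat.beq e.s0 u.s0)

def Mach.eqB (m u : Mach) : Bool :=
  m.a0.eqB u.a0 <| m.a1.eqB u.a1 <| m.b0.eqB u.b0 <| m.b1.eqB u.b1 <|
  m.c0.eqB u.c0 <| m.c1.eqB u.c1 <| m.d0.eqB u.d0 <| m.d1.eqB u.d1 true

/-- The live lanes hold exactly the given codes. -/
def isCodes (d N : ℕ) (cs : List ℕ) (m : Mach) (A : ℕ) : Bool :=
  withCodes d N cs fun m' A' => Bool.rec false (m.eqB m') (Nat.beq A A')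

def zeroM : Mach := mkMach fun _ => 0

/-- Sizes for one chunk. -/
structure Ck where
  d0 : ℕ
  N0 : ℕ
  vs : List Lv
  d1 : ℕ
  N1 : ℕ
  d2 : ℕ
  N2 : ℕ
  d3 : ℕ
  N3 : ℕ

/-- The nodes below the codes `cs`: the nodes `out1` remain to be filled, the nodes `out`
remain undecided. -/
def chunk (v : Ck) (cs out : List ℕ) (k : Mach → ℕ → Bool) : Bool :=
  withCodes v.d0 v.N0 cs fun m A =>
  levels v.vs (fun mh ah mp ap => andB (k mh ah)
    (cpsStage v.d1 v.N1 v.N2 1 20 mp ap fun m A =>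
     cycStage v.d2 v.N2 v.N3 30 60 30 m A fun m A => isCodes v.d3 v.N3 out m A))
    m A zeroM 0

def allL (p : ℕ → Bool) (l : List ℕ) : Bool := List.rec true (fun x _ ih => Bool.rec false ih (p x)) l

def memB (x : ℕ) (l : List ℕ) : Bool := List.rec false (fun y _ ih => Bool.rec ih true (Nat.beq x y)) l

/-! ### Finite automata reduction -/

/-- `f (n-1) (… (f 0 x))`-style loop with forced accumulator. -/
def loopN (f : ℕ → ℕ → ℕ) (n : ℕ) : ℕ → ℕ :=
  Nat.rec (fun acc => acc) (fun i ih acc => (fun x => force x (ih x)) (f i acc)) n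

def allN (p : ℕ → Bool) (n : ℕ) : Bool := Nat.rec true (fun i ih => Bool.rec false ih (p i)) n

def bitB (x i : ℕ) : Bool := Nat.beq (Nat.land (Nat.shiftRight x i) 1) 1

/-- Automaton data: state bound `k`, stride `s`, row mask, transition digits. -/
structure FD where
  k : ℕ
  s : ℕ
  m : ℕ
  d : ℕ

def FD.delta (D : FD) (i b : ℕ) : ℕ := Nat.land (Nat.shiftRight D.d (Nat.mul 4 (Nat.add (Nat.mul 2 i) b))) 15

def FD.row (D : FD) (T X : ℕ) : ℕ := Nat.land (Nat.shiftRight T (Nat.mul X D.s)) D.m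

def FD.ix (D : FD) (q i : ℕ) : ℕ := Nat.add (Nat.mul q D.k) i

/-- One decoded table entry. -/
structure SE where
  q : ℕ
  w : ℕ
  r : Bool
  l : Bool

def mkSE (x : ℕ) : SE := ⟨Nat.land x 3, Nat.land (Nat.shiftRight x 2) 1, bitB x 3, bitB x 4⟩

def SE.at (c q a : ℕ) : SE :=
  (fun x => force x (mkSE x)) (Nat.land (Nat.shiftRight c (Nat.mul 5 (Nat.add (Nat.mul 2 q) a))) 31)

def FD.base (D : FD) (c a : ℕ) : ℕ :=
  loopN (fun q acc => (fun e : SE => Bool.rec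
      (Bool.rec (loopN (fun i acc => Nat.lor acc (Nat.shiftLeft 1 (Nat.add (Nat.mul (D.ix q i) D.s) (Nat.mul 4 D.k)))) D.k acc) acc e.l)
      (loopN (fun i acc => Nat.lor acc (Nat.shiftLeft 1 (Nat.add (Nat.mul (D.ix q i) D.s) (D.ix e.q (D.delta i e.w))))) D.k acc) e.r)
    (SE.at c q a)) 4 (Nat.shiftLeft 1 (Nat.add (Nat.mul (Nat.mul 4 D.k) D.s) (Nat.mul 4 D.k)))

/-- Boolean matrix product. -/
def FD.mul (D : FD) (L T U : ℕ) : ℕ :=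
  loopN (fun Y acc => Nat.lor acc (Nat.mul (Nat.land (Nat.shiftRight T Y) L) (D.row U Y))) D.s 0

def FD.pull (D : FD) (q s P b acc : ℕ) : ℕ :=
  loopN (fun i acc => Nat.lor acc (Nat.shiftLeft (D.row P (D.ix s i)) (Nat.mul (D.ix q (D.delta i b)) D.s))) D.k acc

def FD.next (D : FD) (c a T P00 P01 P10 P11 : ℕ) : ℕ :=
  loopN (fun q acc => (fun e : SE => Bool.rec acc (Bool.rec
      (D.pull q e.q P10 1 (D.pull q e.q P00 0 acc)) (D.pull q e.q P11 1 (D.pull q e.q P01 0 acc)) (Nat.beq e.w 1)) e.l)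
    (SE.at c q a)) 4 T

def FD.iter (D : FD) (c L : ℕ) (fuel : ℕ) : ℕ → ℕ → (ℕ → ℕ → Bool) → Bool :=
  Nat.rec (fun _ _ _ => false) (fun _ ih T U k =>
    (fun P00 P01 P10 P11 => force P00 <| force P01 <| force P10 <| force P11 <|
      (fun T' U' => Bool.rec (ih T' U' k) (Bool.rec (ih T' U' k) (k T U) (Nat.beq U U')) (Nat.beq T T'))
        (D.next c 0 T P00 P01 P10 P11) (D.next c 1 U P00 P01 P10 P11))
      (D.mul L T T) (D.mul L T U) (D.mul L U T) (D.mul L U U)) fuel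

def FD.reach (D : FD) (T : ℕ) (fuel : ℕ) : ℕ → (ℕ → Bool) → Bool :=
  Nat.rec (fun _ _ => false) (fun _ ih S k =>
    (fun S' => Bool.rec (ih S' k) (k S) (Nat.beq S S'))
      (loopN (fun Y acc => Bool.rec acc (Nat.lor acc (D.row T Y)) (bitB S Y)) D.s S)) fuel

def subB (x y : ℕ) : Bool := Nat.beq (Nat.lor x y) y

/-- The final check: all conditions hold for the transition matrices `T`, `U` and the set `S`. -/
def FD.okL (D : FD) (T U V g b s : ℕ) (q : ℕ) : Bool :=
  allN (fun i => (fun y g => force y <| force g <| allN (fun Y => Bool.rec true (subB (D.row V Y) g) (bitB y Y)) D.s)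
    (D.row (Bool.rec T U (Nat.beq b 1)) (D.ix s i)) (D.row g (D.ix q (D.delta i b)))) D.k

def FD.okE (D : FD) (T U g q : ℕ) (e : SE) : Bool :=
  Bool.rec
    (Bool.rec (allN (fun i => bitB g (Nat.add (Nat.mul (D.ix q i) D.s) (Nat.mul 4 D.k))) D.k)
      ((fun V => andB (D.okL T U V g 0 e.q q) (D.okL T U V g 1 e.q q)) (Bool.rec T U (Nat.beq e.w 1))) e.l)
    (Bool.rec (allN (fun i => bitB g (Nat.add (Nat.mul (D.ix q i) D.s) (D.ix e.q (D.delta i e.w)))) D.k)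
      true e.l) e.r

def FD.ok (D : FD) (c T U S : ℕ) : Bool :=
  andB (bitB S 0) <| andB (Bool.rec true false (bitB S (Nat.mul 4 D.k))) <|
  andB (Nat.beq (D.delta 0 0) 0) <|
  andB (bitB T (Nat.add (Nat.mul (Nat.mul 4 D.k) D.s) (Nat.mul 4 D.k))) <|
  andB (bitB U (Nat.add (Nat.mul (Nat.mul 4 D.k) D.s) (Nat.mul 4 D.k))) <|
  andB (allN (fun i => andB (Nat.ble (Nat.succ (D.delta i 0)) D.k) (Nat.ble (Nat.succ (D.delta i 1)) D.k)) D.k) <|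
  andB (allN (fun Y => Bool.rec true (subB (D.row T Y) S) (bitB S Y)) D.s) <|
  andB (allN (fun q => D.okE T U T q (SE.at c q 0)) 4) (allN (fun q => D.okE T U U q (SE.at c q 1)) 4)

def FD.run (D : FD) (c : ℕ) : Bool :=
  (fun T U => D.iter c (Nat.div (lowMask (Nat.mul D.s D.s)) D.m) 100 T U fun T U =>
    D.reach T 100 1 fun S => D.ok c T U S) (D.base c 0) (D.base c 1)

/-- Exchange left and right in a code. -/
def mirC (c : ℕ) : ℕ :=
  (fun a b z => Nat.lor z (Nat.lor (Nat.shiftLeft a 1) (Nat.shiftRight b 1)))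
    (Nat.land c 283744936200) (Nat.land c 567489872400) (Nat.land c 248276819175)

/-- Code in the low 40 bits, then orientation, `k` (five bits), and the digits. -/
def farOk (x : ℕ) : Bool :=
  (fun k d c => force k <| force d <| force c <|
    (fun s => FD.run ⟨k, s, lowMask s, d⟩ c) (Nat.succ (Nat.mul 4 k)))
    (Nat.land (Nat.shiftRight x 41) 31) (Nat.shiftRight x 46)
    (Bool.rec (Nat.land x (lowMask 40)) (mirC (Nat.land x (lowMask 40))) (bitB x 40))

/-- Every code is decided by its certificate or belongs to the given list. -/
def decided (spec : List ℕ) (l : List ℕ) : Bool :=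
  allL (fun x => Bool.rec (farOk x) (memB x spec) (Nat.beq (Nat.shiftRight x 40) 0)) l

end

end BB4

namespace BB4

/-! ## Semantics -/

abbrev TM := Fin 4 × Bool → Option (Fin 4 × Bool × Dir)
abbrev Cf := Cfg (Fin 4)

/-- The table entry used by a configuration. -/
def ent (c : Cf) : Fin 4 × Bool := (c.state, c.tape c.head)

/-- Effect of one transition. -/
def app (x : Fin 4 × Bool × Dir) (c : Cf) : Cf :=
  ⟨x.1, c.head + x.2.2.move, Function.update c.tape c.head x.2.1⟩

/-- Total step: halted configurations are fixed. -/
def stepT (f : TM) (c : Cf) : Cf := (stepTM f c).getD c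

def run (f : TM) (t : ℕ) (c : Cf) : Cf := (stepT f)^[t] c

/-- Cells that are scanned or carry a `1`. -/
def Kset (c : Cf) : Set ℤ := {j | c.tape j = true ∨ j = c.head}

def HaltsK (f : TM) (q : Fin 4) : Prop :=
  ∃ t, f (ent (run f t (initCfg q))) = none ∧ 12 ≤ (Kset (run f t (initCfg q))).ncard

def NoStay (f : TM) : Prop := ∀ e q w, f e ≠ some (q, w, Dir.stay)

def OneNone (f : TM) : Prop := ∃ e0, ∀ e, f e = none ↔ e = e0

theorem stepT_none {f : TM} {c : Cf} (h : f (ent c) = none) : stepT f c = c := by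
  have h' : f (c.state, c.tape c.head) = none := h
  simp [stepT, stepTM, h']

theorem stepT_some {f : TM} {c : Cf} {x} (h : f (ent c) = some x) : stepT f c = app x c := by
  have h' : f (c.state, c.tape c.head) = some x := h
  simp [stepT, stepTM, h', app]

@[simp] theorem run_zero (f : TM) (c : Cf) : run f 0 c = c := rfl

theorem run_succ (f : TM) (t : ℕ) (c : Cf) : run f (t + 1) c = run f t (stepT f c) := rfl

theorem run_succ' (f : TM) (t : ℕ) (c : Cf) : run f (t + 1) c = stepT f (run f t c) :=
  Function.iterate_succ_apply' _ _ _

theorem run_add (f : TM) (s t : ℕ) (c : Cf) : run f (s + t) c = run f s (run f t c) :=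
  Function.iterate_add_apply _ _ _ _

theorem run_none {f : TM} {c : Cf} (h : f (ent c) = none) (t : ℕ) : run f t c = c := by
  induction t with
  | zero => rfl
  | succ t ih => rw [run_succ, stepT_none h, ih]

theorem steps_run {f : TM} {t : ℕ} : ∀ {c d : Cf}, stepsTM f t c = some d → run f t c = d := by
  induction t with
  | zero => intro c d h; simpa [stepsTM] using h
  | succ t ih =>
    intro c d h
    rw [stepsTM] at h
    rcases hs : stepTM f c with _ | c'
    · simp [hs] at h
    · simp only [hs, Option.bind_some] at h
      rw [run_succ]
      have : stepT f c = c' := by simp [stepT, hs]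
      rw [this]; exact ih h

theorem run_steps {f : TM} {t : ℕ} : ∀ {c : Cf},
    ∃ t', stepsTM f t' c = some (run f t c) := by
  induction t with
  | zero => intro c; exact ⟨0, rfl⟩
  | succ t ih =>
    intro c
    rw [run_succ]
    rcases hs : f (ent c) with _ | x
    · rw [stepT_none hs]; exact ih
    · obtain ⟨t', h⟩ := ih (c := stepT f c)
      refine ⟨t' + 1, ?_⟩
      rw [stepsTM]
      have : stepTM f c = some (stepT f c) := by
        have h' : f (c.state, c.tape c.head) = some x := hs
        simp [stepT, stepTM, h']
      rw [this]; exact h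

/-- Two halting configurations of the same run agree. -/
theorem run_halt_unique {f : TM} {s t : ℕ} {c : Cf} (hs : f (ent (run f s c)) = none)
    (ht : f (ent (run f t c)) = none) : run f s c = run f t c := by
  rcases le_total s t with h | h
  · obtain ⟨k, rfl⟩ := Nat.exists_eq_add_of_le h
    rw [add_comm, run_add, run_none hs]
  · obtain ⟨k, rfl⟩ := Nat.exists_eq_add_of_le h
    rw [add_comm, run_add, run_none ht]

/-! ### Renaming states, mirroring, translating -/

def mirD : Bool → Dir → Dir
  | true, .left => .right
  | true, .right => .left
  | _, d => d

def sgn (m : Bool) : ℤ := if m then -1 else 1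

theorem sgn_sgn (m : Bool) : sgn m * sgn m = 1 := by cases m <;> rfl

theorem mirD_move (m : Bool) (d : Dir) : (mirD m d).move = sgn m * d.move := by
  cases m <;> cases d <;> rfl

theorem mirD_mirD (m : Bool) (d : Dir) : mirD m (mirD m d) = d := by
  cases m <;> cases d <;> rfl

def relX (σ : Equiv.Perm (Fin 4)) (m : Bool) (x : Fin 4 × Bool × Dir) : Fin 4 × Bool × Dir :=
  (σ x.1, x.2.1, mirD m x.2.2)

def rel (σ : Equiv.Perm (Fin 4)) (m : Bool) (f : TM) : TM :=
  fun e => (f (σ.symm e.1, e.2)).map (relX σ m)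

def relC (σ : Equiv.Perm (Fin 4)) (m : Bool) (o : ℤ) (c : Cf) : Cf :=
  ⟨σ c.state, sgn m * c.head + o, fun j => c.tape (sgn m * (j - o))⟩

theorem ent_relC (σ m o c) : ent (relC σ m o c) = (σ (ent c).1, (ent c).2) := by
  have : sgn m * (sgn m * c.head) = c.head := by rw [← mul_assoc, sgn_sgn, one_mul]
  simp [ent, relC, this]

theorem rel_ent (σ m o f c) : rel σ m f (ent (relC σ m o c)) = (f (ent c)).map (relX σ m) := by
  rw [ent_relC]; simp [rel]

theorem app_relC (σ m o x c) : app (relX σ m x) (relC σ m o c) = relC σ m o (app x c) := by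
  simp only [app, relC, relX, mirD_move, Cfg.mk.injEq, true_and]
  refine ⟨by ring, ?_⟩
  funext j
  simp only [Function.update_apply]
  have : (j = sgn m * c.head + o) ↔ (sgn m * (j - o) = c.head) := by
    cases m <;> simp [sgn] <;> constructor <;> intro h <;> omega
  simp [this]

theorem stepT_relC (σ m o f c) : stepT (rel σ m f) (relC σ m o c) = relC σ m o (stepT f c) := by
  have h := rel_ent σ m o f c
  rcases hf : f (ent c) with _ | x
  · rw [hf] at h; rw [stepT_none hf, stepT_none h]
  · rw [hf] at h; rw [stepT_some hf, stepT_some h, app_relC]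

theorem run_relC (σ m o f t c) : run (rel σ m f) t (relC σ m o c) = relC σ m o (run f t c) := by
  induction t generalizing c with
  | zero => rfl
  | succ t ih => rw [run_succ, run_succ, stepT_relC, ih]

theorem sgn_inj (m : Bool) (o : ℤ) : Function.Injective (fun j : ℤ => sgn m * j + o) := by
  intro a b h
  cases m <;> simp [sgn] at h <;> omega

theorem image_relC (P : ℤ → Prop) (m o) :
    {j : ℤ | P (sgn m * (j - o))} = (fun j : ℤ => sgn m * j + o) '' {j | P j} := by
  ext j
  constructor
  · intro h
    refine ⟨sgn m * (j - o), h, ?_⟩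
    show sgn m * (sgn m * (j - o)) + o = j
    rw [← mul_assoc, sgn_sgn]; ring
  · rintro ⟨k, hk, rfl⟩
    show P (sgn m * (sgn m * k + o - o))
    rw [add_sub_cancel_right, ← mul_assoc, sgn_sgn, one_mul]; exact hk

theorem ncard_relC (P : ℤ → Prop) (m o) : {j : ℤ | P (sgn m * (j - o))}.ncard = {j | P j}.ncard := by
  rw [image_relC]; exact Set.ncard_image_of_injective _ (sgn_inj m o)

theorem Kset_relC (σ m o c) : (Kset (relC σ m o c)).ncard = (Kset c).ncard := by
  rw [show Kset c = {j | c.tape j = true ∨ j = c.head} from rfl,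
    ← ncard_relC (fun j => c.tape j = true ∨ j = c.head) m o]
  congr 1
  ext j
  have : (j = sgn m * c.head + o) ↔ (sgn m * (j - o) = c.head) := by
    cases m <;> simp [sgn] <;> constructor <;> intro h <;> omega
  simp [Kset, relC, this]

theorem init_relC (σ m q) : relC σ m 0 (initCfg q) = initCfg (σ q) := by
  simp [relC, initCfg]

theorem HaltsK_rel {σ m f q} (h : HaltsK f q) : HaltsK (rel σ m f) (σ q) := by
  obtain ⟨t, h1, h2⟩ := h
  refine ⟨t, ?_, ?_⟩
  · rw [← init_relC σ m, run_relC, rel_ent, h1]; rfl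
  · rw [← init_relC σ m, run_relC, Kset_relC]; exact h2

theorem NoStay_rel {σ m f} (h : NoStay f) : NoStay (rel σ m f) := by
  intro e q w he
  rcases hf : f (σ.symm e.1, e.2) with _ | ⟨a, b, d⟩
  · simp [rel, hf] at he
  · simp only [rel, hf, Option.map_some, relX, Option.some.injEq, Prod.mk.injEq] at he
    have : d = Dir.stay := by
      have := he.2.2
      cases m <;> cases d <;> simp_all [mirD]
    exact h _ a b (this ▸ hf)

theorem OneNone_rel {σ m f} (h : OneNone f) : OneNone (rel σ m f) := by
  obtain ⟨e0, h⟩ := h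
  refine ⟨(σ e0.1, e0.2), fun e => ?_⟩
  simp only [rel, Option.map_eq_none_iff, h]
  constructor
  · intro h; rw [← h]; simp
  · intro h; rw [h]; simp

theorem relX_inj (σ m) : Function.Injective (relX σ m) := by
  rintro ⟨a, b, d⟩ ⟨a', b', d'⟩ h
  simp only [relX, Prod.mk.injEq, EmbeddingLike.apply_eq_iff_eq] at h
  obtain ⟨h1, h2, h3⟩ := h
  have := congrArg (mirD m) h3
  rw [mirD_mirD, mirD_mirD] at this
  simp [h1, h2, this]

theorem relX_relX (σ m x) : relX σ⁻¹ m (relX σ m x) = x := by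
  simp [relX, mirD_mirD]

theorem rel_rel (σ m f) : rel σ⁻¹ m (rel σ m f) = f := by
  funext e
  simp only [rel, Option.map_map]
  have : relX σ⁻¹ m ∘ relX σ m = id := by funext x; exact relX_relX σ m x
  rw [this]
  have : (σ.symm ((Equiv.symm σ⁻¹) e.1), e.2) = e := by
    have : Equiv.symm σ⁻¹ = σ := rfl
    rw [this]; simp
  simp [this]

theorem rel_injective {σ m f} (h : Function.Injective (rel σ m f)) : Function.Injective f := by
  intro e e' he
  have : (σ e.1, e.2) = (σ e'.1, e'.2) := h (by simp [rel, he])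
  simp only [Prod.mk.injEq, EmbeddingLike.apply_eq_iff_eq] at this
  exact Prod.ext this.1 this.2

/-! ### Elimination of stationary moves -/

def chase (f : TM) : ℕ → TM
  | 0, _ => none
  | n + 1, e => match f e with
    | none => none
    | some (q, w, .stay) => chase f n (q, w)
    | some (q, w, .left) => some (q, w, .left)
    | some (q, w, .right) => some (q, w, .right)

theorem chase_run (f : TM) (r : ℕ) : ∀ (n : ℕ) (c : Cf), r < n → f (ent (run f r c)) = none →
    (chase f n (ent c) = none ∧ Kset c = Kset (run f r c)) ∨
    ∃ s x, 1 ≤ s ∧ s ≤ r ∧ chase f n (ent c) = some x ∧ run f s c = app x c := by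
  induction r with
  | zero =>
    intro n c hn h
    obtain ⟨n, rfl⟩ := Nat.exists_eq_add_of_lt hn
    left
    rw [run_zero] at h
    simp [chase, h]
  | succ r ih =>
    intro n c hn h
    obtain ⟨n, rfl⟩ : ∃ k, n = k + 1 := ⟨n - 1, by omega⟩
    rcases hf : f (ent c) with _ | ⟨q, w, d⟩
    · left; rw [run_none hf]; simp [chase, hf]
    · rcases d
      · right; exact ⟨1, (q, w, .left), le_rfl, by omega, by simp [chase, hf], by
          rw [run_succ, run_zero, stepT_some hf]⟩
      · rw [run_succ] at h
        have hs := stepT_some hf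
        have he : ent (stepT f c) = (q, w) := by
          rw [hs]; simp [ent, app, Dir.move]
        have hK : Kset (stepT f c) = Kset c := by
          rw [hs]; ext j
          simp only [Kset, app, Dir.move, Set.mem_ofPred_eq, Function.update_apply, add_zero]
          by_cases hj : j = c.head <;> simp [hj]
        have hc : chase f (n + 1) (ent c) = chase f n (ent (stepT f c)) := by
          rw [he]; simp [chase, hf]
        rcases ih n (stepT f c) (by omega) h with ⟨h1, h2⟩ | ⟨s, x, h1, h2, h3, h4⟩
        · left
          refine ⟨by rw [hc, h1], by rw [← hK, h2]; rfl⟩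
        · right
          refine ⟨s + 1, x, by omega, by omega, by rw [hc, h3], ?_⟩
          rw [run_succ, h4, hs]
          simp [app, Dir.move]
      · right; exact ⟨1, (q, w, .right), le_rfl, by omega, by simp [chase, hf], by
          rw [run_succ, run_zero, stepT_some hf]⟩

theorem chase_sim (f : TM) (N : ℕ) (r : ℕ) : ∀ (c : Cf), r < N → f (ent (run f r c)) = none →
    ∃ t, chase f N (ent (run (chase f N) t c)) = none ∧
      Kset (run (chase f N) t c) = Kset (run f r c) := by
  induction r using Nat.strong_induction_on with
  | _ r ih =>
    intro c hr h
    rcases chase_run f r N c hr h with ⟨h1, h2⟩ | ⟨s, x, h1, h2, h3, h4⟩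
    · exact ⟨0, h1, h2⟩
    · obtain ⟨k, rfl⟩ := Nat.exists_eq_add_of_le h2
      rw [add_comm, run_add, h4] at h
      obtain ⟨t, ht⟩ := ih k (by omega) (app x c) (by omega) h
      refine ⟨t + 1, ?_⟩
      rw [run_succ, stepT_some h3, add_comm s k, run_add, h4]
      exact ht

theorem chase_noStay (f : TM) (n : ℕ) : NoStay (chase f n) := by
  induction n with
  | zero => intro e q w h; simp [chase] at h
  | succ n ih =>
    intro e q w h
    rcases hf : f e with _ | ⟨q', w', d⟩
    · simp [chase, hf] at h
    · rcases d <;> simp [chase, hf] at h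
      exact ih _ _ _ h

theorem chase_mono (f : TM) (n : ℕ) : ∀ e x, chase f n e = some x → chase f (n + 1) e = some x := by
  induction n with
  | zero => intro e x h; simp [chase] at h
  | succ n ih =>
    intro e x h
    rw [chase] at h ⊢
    rcases hf : f e with _ | ⟨q', w', d⟩
    · simp [hf] at h
    · rcases d
      · simpa [hf] using h
      · simp only [hf] at h ⊢; exact ih _ _ h
      · simpa [hf] using h

theorem chase_loop (f : TM) (q a) (h : f (q, a) = some (q, a, .stay)) (n : ℕ) :
    chase f n (q, a) = none := by
  induction n with
  | zero => rfl
  | succ n ih => simp [chase, h, ih]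

theorem Kset_init (q) : (Kset (initCfg q)).ncard = 1 := by
  have : Kset (initCfg q) = {0} := by ext j; simp [Kset, initCfg]
  rw [this]; simp

theorem run_agree {g G : TM} {d : Cf} (hd : G (ent d) = none) (hg : ∀ e x, g e = some x → G e = some x)
    (t : ℕ) : ∀ c, run g t c = d → g (ent d) = none → run G t c = d := by
  induction t with
  | zero => intro c h _; exact h
  | succ t ih =>
    intro c h h'
    rcases hc : g (ent c) with _ | x
    · rw [run_none hc] at h; rw [h]; exact run_none hd _
    · rw [run_succ, stepT_some hc] at h
      rw [run_succ, stepT_some (hg _ _ hc)]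
      exact ih _ h h'

end BB4

namespace BB4

/-! ## Partial machines -/

structure EB where
  s0 : Bool
  s1 : Bool
  w : Bool
  r : Bool
  l : Bool

abbrev Code := Fin 4 → Bool → EB

def stOf : Bool → Bool → Fin 4
  | false, false => 0
  | true, false => 1
  | false, true => 2
  | true, true => 3

/-- A pattern for a table entry: undefined (anything), a move, or a mark (nothing). -/
def EMatch (e : EB) (x : Option (Fin 4 × Bool × Dir)) : Prop :=
  match e.r, e.l with
  | false, false => True
  | true, false => x = some (stOf e.s0 e.s1, e.w, .right)
  | false, true => x = some (stOf e.s0 e.s1, e.w, .left)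
  | true, true => False

def Match (v : Code) (G : TM) : Prop := ∀ q a, EMatch (v q a) (G (q, a))

def fillE (e : EB) (c : ℕ) : EB :=
  bif e.r && e.l then ⟨c.testBit 0, c.testBit 1, c.testBit 2, c.testBit 3, !c.testBit 3⟩ else e

def MatchM (v : Code) (G : TM) : Prop := ∃ c < 16, Match (fun q a => fillE (v q a) c) G

def codeOf (c : ℕ) : Code := fun q a =>
  (fun k => ⟨c.testBit k, c.testBit (k + 1), c.testBit (k + 2), c.testBit (k + 3), c.testBit (k + 4)⟩)
    (5 * (2 * q.val + a.toNat))

def swp : Equiv.Perm (Fin 4) := Equiv.swap 2 3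

/-- The exceptional machines. -/
def fins : List ℕ := [291756397229, 609315344717, 344281569965, 344315156845, 275403946509, 756198003373]

def Final (G : TM) : Prop :=
  ∃ c ∈ fins, Match (codeOf c) G ∨ Match (codeOf c) (rel swp false G)

def Good (v : Code) : Prop :=
  ∀ G, Match v G → OneNone G → NoStay G → HaltsK G 0 → Final G

def GoodM (v : Code) : Prop :=
  ∀ G, MatchM v G → OneNone G → NoStay G → HaltsK G 0 → Final G

theorem rel_swp_swp (G : TM) : rel swp false (rel swp false G) = G := rel_rel swp false G

theorem Final_swp {G : TM} (h : Final (rel swp false G)) : Final G := by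
  obtain ⟨c, hc, h⟩ := h
  refine ⟨c, hc, ?_⟩
  rw [rel_swp_swp] at h
  exact h.symm

def swapE (e : EB) : EB := ⟨xor e.s0 e.s1, e.s1, e.w, e.r, e.l⟩

def swapC (v : Code) : Code := fun q a => swapE (v (swp q) a)

theorem stOf_swap (a b : Bool) : stOf (xor a b) b = swp (stOf a b) := by
  revert a b; decide

theorem EMatch_swap {e x} (h : EMatch e x) : EMatch (swapE e) (x.map (relX swp false)) := by
  obtain ⟨s0, s1, w, r, l⟩ := e
  cases r <;> cases l <;> simp only [EMatch, swapE] at h ⊢ <;> rw [h] <;>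
    simp [relX, stOf_swap, mirD]

theorem Match_swap {v G} (h : Match v G) : Match (swapC v) (rel swp false G) := by
  intro q a
  have := EMatch_swap (h (swp q) a)
  have hs : swp.symm = swp := rfl
  simpa [rel, swapC, hs] using this

theorem MatchM_swap {v G} (h : MatchM v G) : MatchM (swapC v) (rel swp false G) := by
  obtain ⟨c, hc, h⟩ := h
  have key : ∀ c < 16, ∃ c' < 16, Nat.testBit c' 0 = xor (Nat.testBit c 0) (Nat.testBit c 1) ∧
      Nat.testBit c' 1 = Nat.testBit c 1 ∧
      Nat.testBit c' 2 = Nat.testBit c 2 ∧ Nat.testBit c' 3 = Nat.testBit c 3 := by decide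
  obtain ⟨c', hc', h0, h1, h2, h3⟩ := key c hc
  refine ⟨c', hc', ?_⟩
  have := Match_swap h
  convert this using 1
  funext q a
  simp only [swapC, fillE]
  generalize v (swp q) a = e
  obtain ⟨s0, s1, w, r, l⟩ := e
  cases r <;> cases l <;> simp [swapE, h0, h1, h2, h3]

theorem GoodM_swap {v} (h : GoodM (swapC v)) : GoodM v := by
  intro G hG h1 h2 h3
  exact Final_swp (h _ (MatchM_swap hG) (OneNone_rel h1) (NoStay_rel h2) (HaltsK_rel (σ := swp) h3))

def decE (e : EB) : Option (Fin 4 × Bool × Dir) :=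
  bif e.r then (bif e.l then none else some (stOf e.s0 e.s1, e.w, .right))
  else (bif e.l then some (stOf e.s0 e.s1, e.w, .left) else none)

/-- The machine described by a code. -/
def dec (v : Code) : TM := fun e => decE (v e.1 e.2)

theorem Match_dec {v G} (h : Match v G) : ∀ e x, dec v e = some x → G e = some x := by
  rintro ⟨q, a⟩ x he
  have := h q a
  simp only [dec, decE, EMatch] at he this
  rcases hr : (v q a).r <;> rcases hl : (v q a).l <;> simp_all

/-- The machine never halts. -/
def NH (f : TM) : Prop := ∀ t, f (ent (run f t (initCfg 0))) ≠ none

theorem run_ext {f G : TM} (hG : ∀ e x, f e = some x → G e = some x) (t : ℕ) :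
    ∀ c, (∀ s < t, f (ent (run f s c)) ≠ none) → run G t c = run f t c := by
  induction t with
  | zero => intro c _; rfl
  | succ t ih =>
    intro c h
    obtain ⟨x, hx⟩ := Option.ne_none_iff_exists'.1 (h 0 (by omega))
    rw [run_zero] at hx
    have h1 := stepT_some hx
    rw [run_succ, run_succ, stepT_some (hG _ _ hx), h1]
    apply ih
    intro s hs
    have := h (s + 1) (by omega)
    rwa [run_succ, h1] at this

theorem NH_ext {f G : TM} (hG : ∀ e x, f e = some x → G e = some x) (h : NH f) : ¬ HaltsK G 0 := by
  rintro ⟨t, ht, -⟩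
  rw [run_ext hG t _ (fun s _ => h s)] at ht
  obtain ⟨x, hx⟩ := Option.ne_none_iff_exists'.1 (h t)
  rw [hG _ _ hx] at ht; cases ht

theorem Good_of_NH {v} (h : NH (dec v)) : Good v :=
  fun _ hG _ _ hK => absurd hK (NH_ext (Match_dec hG) h)

theorem NH_rel {σ m f} (h0 : σ 0 = 0) (h : NH (rel σ m f)) : NH f := by
  intro t ht
  apply h t
  rw [← h0, ← init_relC σ m 0, run_relC, rel_ent, ht]; rfl

theorem not_haltsK {f : TM} {t} (h : f (ent (run f t (initCfg 0))) = none)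
    (h2 : (Kset (run f t (initCfg 0))).ncard < 12) : ¬ HaltsK f 0 := by
  rintro ⟨s, h3, h4⟩
  rw [run_halt_unique h3 h] at h4
  omega

/-! ### Normalisation -/

theorem first_one {G : TM} (t : ℕ) : ∀ q,
    G (ent (run G t (initCfg q))) = none → 12 ≤ (Kset (run G t (initCfg q))).ncard →
    ∃ q0 q1 d, HaltsK G q0 ∧ G (q0, false) = some (q1, true, d) ∧
      (q0 = q ∨ ∃ q' d', G (q, false) = some (q', false, d')) := by
  induction t with
  | zero => intro q _ h; rw [run_zero, Kset_init] at h; omega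
  | succ t ih =>
    intro q h1 h2
    have hq : ent (initCfg q) = (q, false) := rfl
    rcases hx : G (q, false) with _ | ⟨q', w, d⟩
    · rw [run_none (by rw [hq]; exact hx), Kset_init] at h2; omega
    · cases w
      · have hstep : stepT G (initCfg q) = relC 1 false d.move (initCfg q') := by
          rw [stepT_some (hq ▸ hx)]
          simp [app, relC, initCfg]
        have hrun : run G (t + 1) (initCfg q) = relC 1 false d.move (run G t (initCfg q')) := by
          rw [run_succ, hstep]
          have := run_relC 1 false d.move G t (initCfg q')
          rw [← this]
          congr 1
          funext e
          simp only [rel]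
          have : relX 1 false = id := by funext x; simp [relX, mirD]
          have h1 : Equiv.symm (1 : Equiv.Perm (Fin 4)) = 1 := rfl
          rw [this, h1]; simp
        have hent : ent (run G (t + 1) (initCfg q)) = ent (run G t (initCfg q')) := by
          rw [hrun, ent_relC]; simp
        rw [hent] at h1
        rw [hrun, Kset_relC] at h2
        obtain ⟨q0, q1, d1, a1, a2, a3⟩ := ih q' h1 h2
        exact ⟨q0, q1, d1, a1, a2, Or.inr ⟨_, _, rfl⟩⟩
      · exact ⟨q, q', d, ⟨t + 1, h1, h2⟩, hx, Or.inl rfl⟩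

theorem not_self {G : TM} {q d} (hd : d ≠ Dir.stay) (h : G (q, false) = some (q, true, d)) :
    ¬ HaltsK G q := by
  have inv : ∀ t, (run G t (initCfg q)).state = q ∧
      ∀ k : ℕ, (run G t (initCfg q)).tape ((run G t (initCfg q)).head + k * d.move) = false := by
    intro t
    induction t with
    | zero => simp [initCfg]
    | succ t ih =>
      obtain ⟨h1, h2⟩ := ih
      have he : ent (run G t (initCfg q)) = (q, false) := by
        have := h2 0
        simp at this
        simp [ent, h1, this]
      rw [run_succ', stepT_some (by rw [he]; exact h)]
      refine ⟨rfl, fun k => ?_⟩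
      have := h2 (k + 1)
      simp only [app, Function.update_apply]
      rw [if_neg]
      · rw [← this]; congr 1; push_cast; ring
      · cases d <;> simp [Dir.move] at hd ⊢ <;> omega
  rintro ⟨t, ht, -⟩
  obtain ⟨h1, h2⟩ := inv t
  have := h2 0
  simp at this
  simp [ent, h1, this, h] at ht

def isR : Dir → Bool
  | .right => true
  | _ => false

def rootC : ℕ := 13 + (24 <<< 10)

theorem normalise {G : TM} (h2 : NoStay G) (h3 : HaltsK G 0) :
    ∃ σ m, MatchM (codeOf rootC) (rel σ m G) ∧ HaltsK (rel σ m G) 0 ∧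
      (σ 0 = 0 ∨ ∃ q d, rel σ m G (σ 0, false) = some (q, false, d)) := by
  obtain ⟨t, h4, h5⟩ := h3
  obtain ⟨q0, q1, d, a1, a2, a3⟩ := first_one t 0 h4 h5
  have hd : d ≠ Dir.stay := by rintro rfl; exact h2 _ _ _ a2
  have hq : q0 ≠ q1 := by rintro rfl; exact not_self hd a2 a1
  have hσ : ∀ q0 q1 : Fin 4, q0 ≠ q1 → ∃ σ : Equiv.Perm (Fin 4), σ q0 = 0 ∧ σ q1 = 1 := by decide
  obtain ⟨σ, s0, s1⟩ := hσ q0 q1 hq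
  have hm : ∃ m, mirD m d = Dir.right := by
    cases d
    · exact ⟨true, rfl⟩
    · exact absurd rfl hd
    · exact ⟨false, rfl⟩
  obtain ⟨m, hm⟩ := hm
  have hK : HaltsK (rel σ m G) 0 := s0 ▸ HaltsK_rel (σ := σ) (m := m) a1
  have hA : rel σ m G (0, false) = some (1, true, .right) := by
    have : σ.symm 0 = q0 := by rw [← s0]; simp
    simp [rel, this, a2, relX, s1, hm]
  refine ⟨σ, m, ?_, hK, ?_⟩
  · have hN := NoStay_rel (σ := σ) (m := m) h2
    generalize rel σ m G = F at *
    rcases hB : F (1, false) with _ | ⟨q, w, d⟩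
    · exfalso
      have hr : run F 1 (initCfg 0) = app (1, true, .right) (initCfg 0) := by
        rw [run_succ, run_zero, stepT_some (c := initCfg 0) hA]
      refine not_haltsK (t := 1) ?_ ?_ hK
      · rw [hr]; exact hB
      · rw [hr]
        have : Kset (app (1, true, .right) (initCfg 0)) ⊆ {0, 1} := by
          intro j hj
          simp only [Kset, app, initCfg, Dir.move, Function.update_apply, Set.mem_ofPred_eq] at hj
          simp
          by_cases h : j = 0 <;> simp_all
        calc _ ≤ ({0, 1} : Set ℤ).ncard := Set.ncard_le_ncard this
          _ < 12 := by rw [Set.ncard_pair (by norm_num)]; norm_num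
    · have key : ∀ (q : Fin 4) (w b : Bool), ∃ c < 16, stOf (Nat.testBit c 0) (Nat.testBit c 1) = q ∧
        Nat.testBit c 2 = w ∧ Nat.testBit c 3 = b := by decide
      have hd : d = .left ∨ d = .right := by
        cases d
        · simp
        · exact absurd hB (hN _ _ _)
        · simp
      obtain ⟨c, hc, k1, k2, k3⟩ := key q w (isR d)
      refine ⟨c, hc, ?_⟩
      have e0 : codeOf rootC 0 false = ⟨true, false, true, true, false⟩ := by
        simp [codeOf, rootC]; decide
      have e1 : codeOf rootC 1 false = ⟨false, false, false, true, true⟩ := by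
        simp [codeOf, rootC]; decide
      have e2 : ∀ q a, (q, a) ≠ (0, false) → (q, a) ≠ (1, false) → (codeOf rootC q a).r = false ∧
        (codeOf rootC q a).l = false := by
        simp only [codeOf]; decide
      intro q' a
      by_cases x0 : (q', a) = (0, false)
      · obtain ⟨rfl, rfl⟩ := Prod.mk.inj x0
        show EMatch (fillE (codeOf rootC 0 false) c) _
        rw [e0, hA]; simp [fillE, EMatch, stOf]
      · by_cases x1 : (q', a) = (1, false)
        · obtain ⟨rfl, rfl⟩ := Prod.mk.inj x1
          show EMatch (fillE (codeOf rootC 1 false) c) _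
          rw [e1, hB]
          rcases hd with rfl | rfl <;> simp [isR] at k3 <;> simp [-Nat.testBit_zero, fillE, EMatch, k1, k2, k3]
        · obtain ⟨y1, y2⟩ := e2 q' a x0 x1
          simp [fillE, y1, EMatch, y2]
  · rcases a3 with h | ⟨q', d', h⟩
    · left; rw [h] at s0; exact s0
    · right; exact ⟨_, _, by simp only [rel, Equiv.symm_apply_apply, h]; rfl⟩

end BB4

namespace BB4

/-! ## Lanes -/

@[simp] theorem tb_lor (a b i : ℕ) : (Nat.lor a b).testBit i = (a.testBit i || b.testBit i) :=
  Nat.testBit_or a b i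
@[simp] theorem tb_land (a b i : ℕ) : (Nat.land a b).testBit i = (a.testBit i && b.testBit i) :=
  Nat.testBit_and a b i
@[simp] theorem tb_xor (a b i : ℕ) : (Nat.xor a b).testBit i = (xor (a.testBit i) (b.testBit i)) :=
  Nat.testBit_xor a b i
theorem tb_shl (a p i : ℕ) : (Nat.shiftLeft a p).testBit i = (decide (p ≤ i) && a.testBit (i - p)) :=
  Nat.testBit_shiftLeft a
@[simp] theorem tb_shr (a p i : ℕ) : (Nat.shiftRight a p).testBit i = a.testBit (p + i) :=
  Nat.testBit_shiftRight a
theorem lowMask_eq (k : ℕ) : lowMask k = 2 ^ k - 1 := by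
  have : Nat.shiftLeft 1 k = 2 ^ k := (Nat.shiftLeft_eq 1 k).trans (one_mul _)
  show Nat.shiftLeft 1 k - 1 = _
  rw [this]
@[simp] theorem tb_lowMask (k i : ℕ) : (lowMask k).testBit i = decide (i < k) := by
  rw [lowMask_eq]; exact Nat.testBit_two_pow_sub_one k i

theorem lt_of_le_lowMask {A N i : ℕ} (h : A ≤ lowMask N) (hi : A.testBit i = true) : i < N := by
  by_contra hc
  have h1 : A < 2 ^ N := by
    rw [lowMask_eq] at h
    have := Nat.two_pow_pos N
    omega
  have : A < 2 ^ i := lt_of_lt_of_le h1 (Nat.pow_le_pow_right (by norm_num) (by omega))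
  rw [Nat.testBit_lt_two_pow this] at hi
  cases hi

theorem beq_true {a b : ℕ} (h : Nat.beq a b = true) : a = b := Nat.eq_of_beq_eq_true h
theorem ble_true {a b : ℕ} (h : Nat.ble a b = true) : a ≤ b := Nat.le_of_ble_eq_true h

theorem brec_true {b x : Bool} (h : Bool.rec (motive := fun _ => Bool) false x b = true) :
    b = true ∧ x = true := by
  cases b
  · cases h
  · exact ⟨rfl, h⟩

theorem andB_true {a b : Bool} (h : andB a b = true) : a = true ∧ b = true := brec_true h

@[simp] theorem force_eq {r : Type} (x : ℕ) (k : r) : force x k = k := by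
  unfold force; cases Nat.ble 0 x <;> rfl

@[simp] theorem forceL_eq {r : Type} (l : List ℕ) (k : r) : forceL l k = k := by
  induction l with
  | nil => rfl
  | cons x l ih => exact (force_eq x _).trans ih

@[simp] theorem Tp.force_eq {r : Type} (c : Tp) (k : Tp → r) : c.force k = k c := by
  simp [Tp.force]

@[simp] theorem PCfg.force_eq {r : Type} (c : PCfg) (k : PCfg → r) : c.force k = k c := by
  simp [PCfg.force]

@[simp] theorem Cyc.force_eq {r : Type} (c : Cyc) (k : Cyc → r) : c.force k = k c := by
  simp [Cyc.force]

@[simp] theorem Ent.force_eq {r : Type} (c : Ent) (k : Ent → r) : c.force k = k c := by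
  simp [Ent.force]

@[simp] theorem Mach.force_eq {r : Type} (c : Mach) (k : Mach → r) : c.force k = k c := by
  simp [Mach.force]

def Ent.lane (e : Ent) (i : ℕ) : EB :=
  ⟨e.s0.testBit i, e.s1.testBit i, e.w.testBit i, e.r.testBit i, e.l.testBit i⟩

def Mach.get (m : Mach) : Fin 4 → Bool → Ent
  | 0, false => m.a0
  | 0, true => m.a1
  | 1, false => m.b0
  | 1, true => m.b1
  | 2, false => m.c0
  | 2, true => m.c1
  | 3, false => m.d0
  | 3, true => m.d1

def Mach.code (m : Mach) (i : ℕ) : Code := fun q a => (m.get q a).lane i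

theorem get_emap (f : Ent → Ent) (m : Mach) (q a) : (m.emap f).get q a = f (m.get q a) := by
  fin_cases q <;> cases a <;> rfl

theorem get_zip (f : ℕ → ℕ → ℕ) (m u : Mach) (q a) :
    (m.zip f u).get q a = (m.get q a).zip f (u.get q a) := by
  fin_cases q <;> cases a <;> rfl

theorem get_mk (f : ℕ → ℕ) (q : Fin 4) (a : Bool) :
    (mkMach f).get q a = mkEnt f (5 * (2 * q.val + a.toNat)) := by
  fin_cases q <;> cases a <;> rfl

/-- If a bitwise operation acts on lane `j` like projection to lane `i`, then codes agree. -/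
theorem code_bmap {f : ℕ → ℕ} {i j : ℕ} (h : ∀ x, (f x).testBit j = x.testBit i) (m : Mach) :
    (m.bmap f).code j = m.code i := by
  funext q a
  simp only [Mach.code, Mach.bmap, get_emap, Ent.lane, Ent.bmap, h]

/-! ### Compaction -/

structure Sub (m : Mach) (A : ℕ) (m' : Mach) (A' : ℕ) : Prop where
  fwd : ∀ i, A.testBit i = true → ∃ j, A'.testBit j = true ∧ m'.code j = m.code i
  bwd : ∀ j, A'.testBit j = true → ∃ i, A.testBit i = true ∧ m'.code j = m.code i

theorem Sub.refl (m A) : Sub m A m A := ⟨fun i h => ⟨i, h, rfl⟩, fun i h => ⟨i, h, rfl⟩⟩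

theorem Sub.trans {m A m' A' m'' A''} (h : Sub m A m' A') (h' : Sub m' A' m'' A'') :
    Sub m A m'' A'' := by
  constructor
  · intro i hi
    obtain ⟨j, hj, e⟩ := h.fwd i hi
    obtain ⟨k, hk, e'⟩ := h'.fwd j hj
    exact ⟨k, hk, e'.trans e⟩
  · intro i hi
    obtain ⟨j, hj, e⟩ := h'.bwd i hi
    obtain ⟨k, hk, e'⟩ := h.bwd j hj
    exact ⟨k, hk, e.trans e'⟩

theorem land_zero {a b : ℕ} (h : Nat.beq (Nat.land a b) 0 = true) (i : ℕ) :
    (a.testBit i && b.testBit i) = false := by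
  rw [← tb_land, beq_true h]; simp

theorem compact1_true {p A mp : ℕ} {m : Mach} {k : Mach → ℕ → Bool}
    (h : compact1 p (Nat.xor A (Nat.land mp A)) (Nat.land mp A)
      (Nat.shiftRight (Nat.land mp A) p) m k = true) :
    ∃ m' A', k m' A' = true ∧ Sub m A m' A' := by
  unfold compact1 at h
  obtain ⟨h1, h⟩ := brec_true h
  obtain ⟨h2, h⟩ := brec_true h
  rw [Mach.force_eq] at h
  refine ⟨_, _, h, ?_⟩
  have z1 : ∀ i, A.testBit i = true → mp.testBit i = false →
      (mp.testBit (p + i) && A.testBit (p + i)) = false := by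
    intro i a b
    have := land_zero h1 i
    simpa [a, b] using this
  have z2 : ∀ i, mp.testBit i = true → A.testBit i = true → p ≤ i := by
    intro i a b
    have := land_zero h2 i
    simpa [a, b] using this
  have c1 : ∀ i, A.testBit i = true → mp.testBit i = false →
      (m.bmap (moveDown p (Nat.xor A (Nat.land mp A)) (Nat.land mp A))).code i = m.code i := by
    intro i a b
    apply code_bmap
    intro x
    have := z1 i a b
    simp only [moveDown, tb_lor, tb_land, tb_xor, tb_shr, a, b, this]
    simp
  have c2 : ∀ j, mp.testBit (p + j) = true → A.testBit (p + j) = true →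
      (m.bmap (moveDown p (Nat.xor A (Nat.land mp A)) (Nat.land mp A))).code j = m.code (p + j) := by
    intro j a b
    apply code_bmap
    intro x
    have := land_zero h1 j
    simp only [tb_land, tb_xor, tb_shr, a, b] at this
    simp only [moveDown, tb_lor, tb_land, tb_xor, tb_shr, a, b]
    revert this
    generalize A.testBit j = u
    generalize mp.testBit j = v
    cases u <;> cases v <;> simp
  constructor
  · intro i hi
    by_cases hm : mp.testBit i = true
    · obtain ⟨j, rfl⟩ := Nat.exists_eq_add_of_le (z2 i hm hi)
      exact ⟨j, by simp [hi, hm], c2 j hm hi⟩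
    · simp only [Bool.not_eq_true] at hm
      exact ⟨i, by simp [hi, hm], c1 i hi hm⟩
  · intro j hj
    simp only [tb_lor, tb_xor, tb_land, tb_shr, Bool.or_eq_true, Bool.and_eq_true] at hj
    rcases hj with hj | ⟨a, b⟩
    · have : A.testBit j = true ∧ mp.testBit j = false := by
        revert hj
        generalize A.testBit j = u
        generalize mp.testBit j = v
        cases u <;> cases v <;> simp
      exact ⟨j, this.1, c1 j this.1 this.2⟩
    · exact ⟨p + j, b, c2 j a b⟩

theorem compact_true {full : ℕ} {qs ps : List ℕ} {k : Mach → ℕ → Bool} :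
    ∀ {m : Mach} {A mk : ℕ}, compact full qs ps k m A mk = true →
    ∃ m' A', k m' A' = true ∧ Sub m A m' A' := by
  induction ps with
  | nil => intro m A mk h; exact ⟨m, A, h, Sub.refl m A⟩
  | cons p ps ih =>
    intro m A mk h
    have h0 := compact1_true (p := p) (A := A) (mp := prefX full qs mk) (m := m)
      (k := fun m' A' => compact full qs ps k m' A'
        (Nat.land mk (Nat.xor full (prefX full qs mk)))) h
    obtain ⟨m', A', h1, h2⟩ := h0
    obtain ⟨m'', A'', h3, h4⟩ := ih h1
    exact ⟨m'', A'', h3, h2.trans h4⟩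

theorem pack_true {d N : ℕ} {m : Mach} {A : ℕ} {k : Mach → ℕ → Bool} (h : pack d N m A k = true) :
    ∃ m' A', k m' A' = true ∧ A' ≤ lowMask N ∧ Sub m A m' A' := by
  obtain ⟨m', A', h1, h2⟩ := compact_true h
  obtain ⟨h3, h4⟩ := brec_true h1
  exact ⟨m', A', h4, ble_true h3, h2⟩

/-! ### Loading -/

theorem tb_horner (cs : List ℕ) : ∀ i b, b < 40 →
    (horner cs).testBit (40 * i + b) = (cs.getD i 0).testBit b := by
  induction cs with
  | nil => intro i b _; show Nat.testBit 0 _ = _; simp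
  | cons c cs ih =>
    intro i b hb
    show (Nat.lor (Nat.land c (lowMask 40)) (Nat.shiftLeft (horner cs) 40)).testBit _ = _
    rw [tb_lor, tb_land, tb_lowMask, tb_shl]
    cases i with
    | zero => simp [hb]
    | succ i =>
      have e : 40 * (i + 1) + b - 40 = 40 * i + b := by omega
      rw [e, ih i b hb]
      have : ¬ (40 * (i + 1) + b < 40) := by omega
      have h2 : 40 ≤ 40 * (i + 1) + b := by omega
      simp [this, h2]

theorem tb_mask (cs : List ℕ) : ∀ j, (mask cs).testBit j = true ↔ ∃ i < cs.length, j = 40 * i := by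
  induction cs with
  | nil => intro j; show Nat.testBit 0 _ = true ↔ _; simp
  | cons c cs ih =>
    intro j
    show (Nat.lor 1 (Nat.shiftLeft (mask cs) 40)).testBit _ = true ↔ _
    rw [tb_lor, tb_shl, Bool.or_eq_true, Bool.and_eq_true, ih]
    constructor
    · rintro (h | ⟨h, i, hi, e⟩)
      · have : j = 0 := by
          by_contra hj
          rw [Nat.testBit_lt_two_pow (Nat.one_lt_two_pow hj)] at h
          cases h
        exact ⟨0, by simp, by omega⟩
      · rw [decide_eq_true_eq] at h
        exact ⟨i + 1, by simpa using hi, by omega⟩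
    · rintro ⟨i, hi, rfl⟩
      cases i with
      | zero => left; simp
      | succ i => right; exact ⟨by rw [decide_eq_true_eq]; omega, i, by simpa using hi, by omega⟩

theorem code_load (cs : List ℕ) (i : ℕ) (hi : i < cs.length) :
    (loadM (mask cs) (horner cs)).code (40 * i) = codeOf (cs.getD i 0) := by
  funext q a
  have hm : (mask cs).testBit (40 * i) = true := (tb_mask cs _).2 ⟨i, hi, rfl⟩
  have hb : 5 * (2 * q.val + a.toNat) + 4 < 40 := by
    have := q.isLt
    have := Bool.toNat_le a
    omega
  simp only [Mach.code, loadM, get_mk, mkEnt, Ent.lane, codeOf]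
  have key : ∀ b, b < 40 →
      (Nat.land (Nat.shiftRight (horner cs) b) (mask cs)).testBit (40 * i) = (cs.getD i 0).testBit b := by
    intro b hb
    rw [tb_land, tb_shr, hm, add_comm, tb_horner cs i b hb]; simp
  simp only [Nat.add_eq]
  rw [key _ (by omega), key _ (by omega), key _ (by omega), key _ (by omega), key _ (by omega)]

theorem withCodes_true {d N : ℕ} {cs : List ℕ} {k : Mach → ℕ → Bool}
    (h : withCodes d N cs k = true) :
    ∃ m A, k m A = true ∧ A ≤ lowMask N ∧
      (∀ c ∈ cs, ∃ j, A.testBit j = true ∧ m.code j = codeOf c) ∧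
      (∀ j, A.testBit j = true → ∃ c ∈ cs, m.code j = codeOf c) := by
  obtain ⟨m, A, h1, h2, h3⟩ := pack_true h
  refine ⟨m, A, h1, h2, ?_, ?_⟩
  · intro c hc
    obtain ⟨i, hi, rfl⟩ := List.getElem_of_mem hc
    obtain ⟨j, hj, e⟩ := h3.fwd (40 * i) ((tb_mask cs _).2 ⟨i, hi, rfl⟩)
    refine ⟨j, hj, e.trans ?_⟩
    rw [code_load cs i hi, List.getD_eq_getElem _ _ hi]
  · intro j hj
    obtain ⟨i', hi', e⟩ := h3.bwd j hj
    obtain ⟨i, hi, rfl⟩ := (tb_mask cs _).1 hi'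
    refine ⟨cs[i], List.getElem_mem hi, e.trans ?_⟩
    rw [code_load cs i hi, List.getD_eq_getElem _ _ hi]

theorem Ent.eqB_true {e u : Ent} {k : Bool} (h : e.eqB u k = true) : e = u ∧ k = true := by
  obtain ⟨h1, h⟩ := brec_true h
  obtain ⟨h2, h⟩ := brec_true h
  obtain ⟨h3, h⟩ := brec_true h
  obtain ⟨h4, h⟩ := brec_true h
  obtain ⟨h5, h⟩ := brec_true h
  refine ⟨?_, h⟩
  cases e; cases u
  simp only [Ent.mk.injEq]
  exact ⟨beq_true h1, beq_true h2, beq_true h3, beq_true h4, beq_true h5⟩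

theorem Mach.eqB_true {m u : Mach} (h : m.eqB u = true) : m = u := by
  obtain ⟨h1, h⟩ := Ent.eqB_true h
  obtain ⟨h2, h⟩ := Ent.eqB_true h
  obtain ⟨h3, h⟩ := Ent.eqB_true h
  obtain ⟨h4, h⟩ := Ent.eqB_true h
  obtain ⟨h5, h⟩ := Ent.eqB_true h
  obtain ⟨h6, h⟩ := Ent.eqB_true h
  obtain ⟨h7, h⟩ := Ent.eqB_true h
  obtain ⟨h8, h⟩ := Ent.eqB_true h
  cases m; cases u
  simp only [Mach.mk.injEq]
  exact ⟨h1, h2, h3, h4, h5, h6, h7, h8⟩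

theorem isCodes_true {d N : ℕ} {cs : List ℕ} {m : Mach} {A : ℕ} (h : isCodes d N cs m A = true) :
    ∀ j, A.testBit j = true → ∃ c ∈ cs, m.code j = codeOf c := by
  obtain ⟨m', A', h1, -, -, h2⟩ := withCodes_true h
  obtain ⟨h3, h4⟩ := brec_true h1
  rw [beq_true h3, Mach.eqB_true h4]
  exact h2

theorem append_true {N : ℕ} {m : Mach} {A : ℕ} {m' : Mach} {A' : ℕ} {k : Mach → ℕ → Bool}
    (h : append N m A m' A' k = true) (hA : A ≤ lowMask N) :
    ∃ m'' A'', k m'' A'' = true ∧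
      (∀ i, A.testBit i = true → ∃ j, A''.testBit j = true ∧ m''.code j = m.code i) ∧
      (∀ i, A'.testBit i = true → ∃ j, A''.testBit j = true ∧ m''.code j = m'.code i) := by
  refine ⟨_, _, h, ?_, ?_⟩
  · intro i hi
    have hN := lt_of_le_lowMask hA hi
    have key : ∀ x y, (Nat.lor (Nat.land x (lowMask N)) (Nat.shiftLeft y N)).testBit i = x.testBit i := by
      intro x y
      rw [tb_lor, tb_land, tb_lowMask, tb_shl]
      have : ¬ N ≤ i := by omega
      simp [hN, this]
    refine ⟨i, by rw [key]; exact hi, ?_⟩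
    funext q a
    simp only [Mach.code, get_zip, Ent.zip, Ent.lane, key]
  · intro i hi
    have key : ∀ x y, (Nat.lor (Nat.land x (lowMask N)) (Nat.shiftLeft y N)).testBit (N + i) = y.testBit i := by
      intro x y
      rw [tb_lor, tb_land, tb_lowMask, tb_shl]
      simp
    refine ⟨N + i, by rw [key]; exact hi, ?_⟩
    funext q a
    simp only [Mach.code, get_zip, Ent.zip, Ent.lane, key]

end BB4

namespace BB4

/-! ## Bit-sliced simulation -/

theorem tb_mux3 (R L Z a b c i : ℕ) : (mux3 R L Z a b c).testBit i =
    ((R.testBit i && a.testBit i) || (L.testBit i && b.testBit i) || (Z.testBit i && c.testBit i)) := by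
  simp [mux3]

theorem hd_eq (l : List ℕ) : hd l = l.getD 0 0 := by cases l <;> rfl

theorem shiftPl_getD (R L Z : ℕ) (l : List ℕ) : ∀ prev k, (shiftPl R L Z l prev).getD k 0 =
    if k < l.length then mux3 R L Z ((prev :: l).getD k 0) (l.getD (k + 1) 0) (l.getD k 0) else 0 := by
  induction l with
  | nil => intro prev k; simp [shiftPl]
  | cons x l ih =>
    intro prev k
    have e : shiftPl R L Z (x :: l) prev = mux3 R L Z prev (hd l) x :: shiftPl R L Z l x := rfl
    rw [e]
    cases k with
    | zero => simp [hd_eq]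
    | succ k => simp only [List.getD_cons_succ, ih]; simp

theorem shiftPl_length (R L Z : ℕ) (l : List ℕ) : ∀ prev, (shiftPl R L Z l prev).length = l.length := by
  induction l with
  | nil => intro prev; rfl
  | cons x l ih => intro prev; exact congrArg (· + 1) (ih x)

theorem lastPl_eq (l : List ℕ) : ∀ p, lastPl l p = (p :: l).getD l.length 0 := by
  induction l with
  | nil => intro p; rfl
  | cons x l ih => intro p; exact (ih x).trans (by simp)

/-- Lane `i` of the bit-sliced tape describes the given tape and head position. -/
def TRep (i : ℕ) (c : Tp) (tape : ℤ → Bool) (head : ℤ) : Prop :=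
  tape head = c.a.testBit i ∧ (∀ k : ℕ, tape (head - 1 - k) = (c.l.getD k 0).testBit i) ∧
    ∀ k : ℕ, tape (head + 1 + k) = (c.r.getD k 0).testBit i

theorem shift_len (c : Tp) (R L Z w : ℕ) : (c.shift R L Z w).l.length = c.l.length ∧
    (c.shift R L Z w).r.length = c.r.length :=
  ⟨shiftPl_length _ _ _ _ _, shiftPl_length _ _ _ _ _⟩

theorem TRep_right {i : ℕ} {c : Tp} {tape head} {R L Z w : ℕ} (hR : R.testBit i = true)
    (hL : L.testBit i = false) (hZ : Z.testBit i = false) (hl : c.l ≠ [])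
    (h : TRep i c tape head) (hlost : (c.shift R L Z w).lost.testBit i = false) :
    TRep i (c.shift R L Z w) (Function.update tape head (w.testBit i)) (head + 1) := by
  obtain ⟨-, h2, h3⟩ := h
  have hlast : (lastPl c.l 0).testBit i = false := by
    have h' := hlost
    simp [Tp.shift, hR, hL] at h'
    exact h'.2
  have hpos : 0 < c.l.length := List.length_pos_of_ne_nil hl
  refine ⟨?_, ?_, ?_⟩
  · rw [Function.update_of_ne (by omega)]
    have := h3 0
    simp only [Nat.cast_zero, add_zero] at this
    rw [this]
    simp [Tp.shift, tb_mux3, hR, hL, hZ, hd_eq]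
  · intro k
    simp only [Tp.shift, shiftPl_getD]
    cases k with
    | zero => simp [hpos, tb_mux3, hR, hL, hZ]
    | succ k =>
      have e : head + 1 - 1 - ((k + 1 : ℕ) : ℤ) = head - 1 - k := by push_cast; ring
      rw [e, Function.update_of_ne (by omega), h2 k]
      split_ifs with hk
      · simp [tb_mux3, hR, hL, hZ]
      · rcases Nat.lt_or_ge k c.l.length with hk' | hk'
        · have : c.l.length = k + 1 := by omega
          rw [lastPl_eq, this] at hlast
          simpa using hlast
        · rw [List.getD_eq_default _ _ hk']
  · intro k
    have e : head + 1 + 1 + (k : ℤ) = head + 1 + ((k + 1 : ℕ) : ℤ) := by push_cast; ring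
    rw [e, Function.update_of_ne (by omega), h3 (k + 1)]
    simp only [Tp.shift, shiftPl_getD]
    split_ifs with hk
    · simp [tb_mux3, hR, hL, hZ]
    · rw [List.getD_eq_default _ _ (by omega)]

theorem TRep_left {i : ℕ} {c : Tp} {tape head} {R L Z w : ℕ} (hR : R.testBit i = false)
    (hL : L.testBit i = true) (hZ : Z.testBit i = false) (hl : c.r ≠ [])
    (h : TRep i c tape head) (hlost : (c.shift R L Z w).lost.testBit i = false) :
    TRep i (c.shift R L Z w) (Function.update tape head (w.testBit i)) (head - 1) := by
  obtain ⟨-, h2, h3⟩ := h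
  have hlast : (lastPl c.r 0).testBit i = false := by
    have h' := hlost
    simp [Tp.shift, hR, hL] at h'
    exact h'.2
  have hpos : 0 < c.r.length := List.length_pos_of_ne_nil hl
  refine ⟨?_, ?_, ?_⟩
  · rw [Function.update_of_ne (by omega)]
    have := h2 0
    simp only [Nat.cast_zero, sub_zero] at this
    rw [this]
    simp [Tp.shift, tb_mux3, hR, hL, hZ, hd_eq]
  · intro k
    have e : head - 1 - 1 - (k : ℤ) = head - 1 - ((k + 1 : ℕ) : ℤ) := by push_cast; ring
    rw [e, Function.update_of_ne (by omega), h2 (k + 1)]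
    simp only [Tp.shift, shiftPl_getD]
    split_ifs with hk
    · simp [tb_mux3, hR, hL, hZ]
    · rw [List.getD_eq_default _ _ (by omega)]
  · intro k
    simp only [Tp.shift, shiftPl_getD]
    cases k with
    | zero => simp [hpos, tb_mux3, hR, hL, hZ]
    | succ k =>
      have e : head - 1 + 1 + ((k + 1 : ℕ) : ℤ) = head + 1 + k := by push_cast; ring
      rw [e, Function.update_of_ne (by omega), h3 k]
      split_ifs with hk
      · simp [tb_mux3, hR, hL, hZ]
      · rcases Nat.lt_or_ge k c.r.length with hk' | hk'
        · have : c.r.length = k + 1 := by omega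
          rw [lastPl_eq, this] at hlast
          simpa using hlast
        · rw [List.getD_eq_default _ _ hk']

theorem TRep_stay {i : ℕ} {c : Tp} {tape head} {R L Z w : ℕ} (hR : R.testBit i = false)
    (hL : L.testBit i = false) (hZ : Z.testBit i = true) (hw : w.testBit i = c.a.testBit i)
    (h : TRep i c tape head) :
    TRep i (c.shift R L Z w) tape head := by
  obtain ⟨h1, h2, h3⟩ := h
  refine ⟨?_, ?_, ?_⟩
  · simp [Tp.shift, tb_mux3, hR, hL, hZ, hw, h1]
  · intro k
    simp only [Tp.shift, shiftPl_getD, h2]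
    split_ifs with hk
    · simp [tb_mux3, hR, hL, hZ]
    · rw [List.getD_eq_default _ _ (by omega)]
  · intro k
    simp only [Tp.shift, shiftPl_getD, h3]
    split_ifs with hk
    · simp [tb_mux3, hR, hL, hZ]
    · rw [List.getD_eq_default _ _ (by omega)]

theorem tb_dot {full i : ℕ} (hf : full.testBit i = true) (p : Ent → ℕ) (m : Mach) (s0 s1 a : ℕ) :
    (dot p m (sel full s0 s1 a)).testBit i =
      (p (m.get (stOf (s0.testBit i) (s1.testBit i)) (a.testBit i))).testBit i := by
  simp only [dot, Oct.sum, Oct.and, sel, Mach.oct, tb_lor, tb_land, tb_xor, hf]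
  cases s0.testBit i <;> cases s1.testBit i <;> cases a.testBit i <;> simp [stOf, Mach.get]

def Oct.get (o : Oct) : Fin 4 → Bool → ℕ
  | 0, false => o.a0
  | 0, true => o.a1
  | 1, false => o.b0
  | 1, true => o.b1
  | 2, false => o.c0
  | 2, true => o.c1
  | 3, false => o.d0
  | 3, true => o.d1

theorem tb_sel {full i : ℕ} (hf : full.testBit i = true) (s0 s1 a : ℕ) (q b) :
    ((sel full s0 s1 a).get q b).testBit i =
      decide (stOf (s0.testBit i) (s1.testBit i) = q ∧ a.testBit i = b) := by
  fin_cases q <;> cases b <;> simp only [Oct.get, sel, tb_land, tb_xor, hf] <;>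
  cases s0.testBit i <;> cases s1.testBit i <;> cases a.testBit i <;> simp [stOf]

/-- No entry carries a mark. -/
def NM (v : Code) : Prop := ∀ q a, ((v q a).r && (v q a).l) = false

structure Rep (i : ℕ) (c : PCfg) (x : Cf) : Prop where
  state : x.state = stOf (c.s0.testBit i) (c.s1.testBit i)
  tape : TRep i c.t x.tape x.head

def LenOk (c : PCfg) : Prop := c.t.l ≠ [] ∧ c.t.r ≠ []

theorem shift_ne (c : Tp) (R L Z w : ℕ) (h : c.l ≠ [] ∧ c.r ≠ []) :
    (c.shift R L Z w).l ≠ [] ∧ (c.shift R L Z w).r ≠ [] := by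
  have := shift_len c R L Z w
  constructor
  · apply List.ne_nil_of_length_pos; rw [this.1]; exact List.length_pos_of_ne_nil h.1
  · apply List.ne_nil_of_length_pos; rw [this.2]; exact List.length_pos_of_ne_nil h.2

theorem LenOk_pstep {full m c} (h : LenOk c) : LenOk (pstep full m c) := shift_ne _ _ _ _ _ h

theorem lost_shift {c : Tp} {R L Z w i : ℕ} (h : (c.shift R L Z w).lost.testBit i = false) :
    c.lost.testBit i = false := by
  simp only [Tp.shift, tb_lor, Bool.or_eq_false_iff] at h
  exact h.1

theorem rep_step {full i : ℕ} (hf : full.testBit i = true) {m : Mach} (hm : NM (m.code i))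
    {c : PCfg} {x : Cf} (hl : LenOk c) (hr : c.t.lost.testBit i = false → Rep i c x)
    (hlost : (pstep full m c).t.lost.testBit i = false) :
    Rep i (pstep full m c) (stepT (dec (m.code i)) x) := by
  have h := hr (lost_shift hlost)
  obtain ⟨h1, h2⟩ := h
  have hent : ent x = (stOf (c.s0.testBit i) (c.s1.testBit i), c.t.a.testBit i) := by
    rw [ent, h1, h2.1]
  set e := c.sel full with he
  have hd : ∀ p, (dot p m e).testBit i = (p (m.get (ent x).1 (ent x).2)).testBit i := by
    intro p; rw [he, PCfg.sel, tb_dot hf, hent]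
  set R := dot Ent.r m e with hR
  set L := dot Ent.l m e with hL
  have hp : pstep full m c = pstep1 m c e R L (Nat.lor R L) (Nat.xor full (Nat.lor R L)) := rfl
  rw [hp] at hlost ⊢
  set E := m.get (ent x).1 (ent x).2 with hE
  have hdec : dec (m.code i) (ent x) = decE (E.lane i) := rfl
  have hR' : R.testBit i = (E.lane i).r := hd _
  have hL' : L.testBit i = (E.lane i).l := hd _
  have hnm : ((E.lane i).r && (E.lane i).l) = false := hm _ _
  have hs0 : (dot Ent.s0 m e).testBit i = (E.lane i).s0 := hd _
  have hs1 : (dot Ent.s1 m e).testBit i = (E.lane i).s1 := hd _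
  have hw : (dot Ent.w m e).testBit i = (E.lane i).w := hd _
  generalize E.lane i = v at *
  obtain ⟨s0, s1, w, r, l⟩ := v
  simp only at hR' hL' hs0 hs1 hw hnm
  cases r <;> cases l
  · have hx : dec (m.code i) (ent x) = none := by rw [hdec]; rfl
    rw [stepT_none hx]
    refine ⟨?_, ?_⟩
    · simp [pstep1, keep, hR', hL', hf, h1]
    · exact TRep_stay hR' hL' (by simp [hR', hL', hf]) (by simp [keep, hR', hL', hf]) h2
  · have hx : dec (m.code i) (ent x) = some (stOf s0 s1, w, .left) := by rw [hdec]; rfl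
    rw [stepT_some hx]
    refine ⟨?_, ?_⟩
    · simp [pstep1, keep, hR', hL', hf, app, hs0, hs1]
    · have := TRep_left (w := keep (Nat.lor R L) (Nat.xor full (Nat.lor R L)) (dot Ent.w m e) c.t.a)
        hR' hL' (by simp [hR', hL', hf]) hl.2 h2 hlost
      have hk : (keep (Nat.lor R L) (Nat.xor full (Nat.lor R L)) (dot Ent.w m e) c.t.a).testBit i = w := by
        simp [keep, hR', hL', hf, hw]
      rw [hk] at this
      exact this
  · have hx : dec (m.code i) (ent x) = some (stOf s0 s1, w, .right) := by rw [hdec]; rfl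
    rw [stepT_some hx]
    refine ⟨?_, ?_⟩
    · simp [pstep1, keep, hR', hL', hf, app, hs0, hs1]
    · have := TRep_right (w := keep (Nat.lor R L) (Nat.xor full (Nat.lor R L)) (dot Ent.w m e) c.t.a)
        hR' hL' (by simp [hR', hL', hf]) hl.1 h2 hlost
      have hk : (keep (Nat.lor R L) (Nat.xor full (Nat.lor R L)) (dot Ent.w m e) c.t.a).testBit i = w := by
        simp [keep, hR', hL', hf, hw]
      rw [hk] at this
      exact this
  · simp at hnm

theorem psteps_succ (full m T c) : psteps full m (T + 1) c = psteps full m T (pstep full m c) :=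
  PCfg.force_eq _ _

theorem rep_steps {full i : ℕ} (hf : full.testBit i = true) {m : Mach} (hm : NM (m.code i)) (T : ℕ) :
    ∀ {c : PCfg} {x : Cf}, LenOk c → (c.t.lost.testBit i = false → Rep i c x) →
    LenOk (psteps full m T c) ∧ ((psteps full m T c).t.lost.testBit i = false →
      Rep i (psteps full m T c) (run (dec (m.code i)) T x)) := by
  induction T with
  | zero => intro c x hl h; exact ⟨hl, h⟩
  | succ T ih =>
    intro c x hl h
    rw [psteps_succ, run_succ]
    exact ih (LenOk_pstep hl) (rep_step hf hm hl h)

theorem zeros_eq (n : ℕ) : zeros n = List.replicate n 0 := by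
  induction n with
  | zero => rfl
  | succ n ih => exact congrArg (List.cons 0) ih

theorem zeros_getD (n k : ℕ) : (zeros n).getD k 0 = 0 := by
  rw [zeros_eq]
  rcases Nat.lt_or_ge k n with h | h
  · rw [List.getD_eq_getElem _ _ (by simpa using h)]; simp
  · rw [List.getD_eq_default _ _ (by simpa using h)]

theorem zeros_ne {W : ℕ} (h : 0 < W) : zeros W ≠ [] := by
  apply List.ne_nil_of_length_pos; rw [zeros_eq]; simpa using h

theorem rep_init (i W : ℕ) : Rep i (pinit W) (initCfg 0) := by
  refine ⟨by simp [pinit, initCfg, stOf], ?_, ?_, ?_⟩ <;>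
  simp only [pinit, zeros_getD] <;> simp [initCfg]

theorem rep_run {full i : ℕ} (hf : full.testBit i = true) {m : Mach} (hm : NM (m.code i)) (T : ℕ)
    {W : ℕ} (hW : 0 < W) :
    LenOk (psteps full m T (pinit W)) ∧ ((psteps full m T (pinit W)).t.lost.testBit i = false →
      Rep i (psteps full m T (pinit W)) (run (dec (m.code i)) T (initCfg 0))) :=
  rep_steps hf hm T ⟨zeros_ne hW, zeros_ne hW⟩ (fun _ => rep_init i W)

/-! ### Counting -/

theorem cells (i : ℕ) (l : List ℕ) : ∃ F : Finset ℕ, F.card = l.countP (fun x => x.testBit i) ∧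
    ∀ k, k ∈ F ↔ (l.getD k 0).testBit i = true := by
  induction l with
  | nil => exact ⟨∅, by simp, by simp⟩
  | cons x l ih =>
    obtain ⟨F, h1, h2⟩ := ih
    by_cases hx : x.testBit i = true
    · refine ⟨insert 0 (F.map ⟨Nat.succ, Nat.succ_injective⟩), ?_, ?_⟩
      · rw [Finset.card_insert_of_notMem (by simp), Finset.card_map, h1,
          List.countP_cons_of_pos (by exact hx)]
      · intro k
        cases k with
        | zero => simpa using hx
        | succ k => simpa using h2 k
    · refine ⟨F.map ⟨Nat.succ, Nat.succ_injective⟩, ?_, ?_⟩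
      · rw [Finset.card_map, h1, List.countP_cons_of_neg (by exact hx)]
      · intro k
        cases k with
        | zero => simpa using hx
        | succ k => simpa using h2 k

def cnt (i : ℕ) (l : List ℕ) : ℕ := l.countP fun x => x.testBit i

theorem ncard_side (i : ℕ) (l : List ℕ) (g : ℕ → ℤ) (hg : Function.Injective g) :
    {j : ℤ | ∃ k, j = g k ∧ (l.getD k 0).testBit i = true}.ncard = cnt i l ∧
    {j : ℤ | ∃ k, j = g k ∧ (l.getD k 0).testBit i = true}.Finite := by
  obtain ⟨F, h1, h2⟩ := cells i l
  have : {j : ℤ | ∃ k, j = g k ∧ (l.getD k 0).testBit i = true} = ((F.map ⟨g, hg⟩ : Finset ℤ) : Set ℤ) := by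
    ext j
    simp only [Set.mem_ofPred_eq, Finset.coe_map, Function.Embedding.coeFn_mk, Set.mem_image,
      Finset.mem_coe, h2]
    constructor
    · rintro ⟨k, rfl, h⟩; exact ⟨k, h, rfl⟩
    · rintro ⟨k, h, rfl⟩; exact ⟨k, rfl, h⟩
  rw [this]
  exact ⟨by rw [Set.ncard_coe_finset, Finset.card_map, h1]; rfl, Finset.finite_toSet _⟩

theorem pos_cases (h j : ℤ) : j = h ∨ (∃ k : ℕ, j = h - 1 - k) ∨ ∃ k : ℕ, j = h + 1 + k := by
  rcases lt_trichotomy j h with a | a | a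
  · right; left; exact ⟨(h - 1 - j).toNat, by omega⟩
  · left; exact a
  · right; right; exact ⟨(j - h - 1).toNat, by omega⟩

/-- The cells carrying a `1`, other than the scanned one. -/
theorem ncard_ones {i : ℕ} {c : Tp} {tape head} (h : TRep i c tape head) :
    {j | tape j = true ∧ j ≠ head}.ncard = cnt i c.l + cnt i c.r ∧
    {j | tape j = true ∧ j ≠ head}.Finite := by
  obtain ⟨-, h2, h3⟩ := h
  have gl : Function.Injective (fun k : ℕ => head - 1 - (k : ℤ)) := by intro a b h; simpa using h
  have gr : Function.Injective (fun k : ℕ => head + 1 + (k : ℤ)) := by intro a b h; simpa using h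
  obtain ⟨a1, a2⟩ := ncard_side i c.l _ gl
  obtain ⟨b1, b2⟩ := ncard_side i c.r _ gr
  have : {j | tape j = true ∧ j ≠ head} =
      {j : ℤ | ∃ k : ℕ, j = head - 1 - (k : ℤ) ∧ (c.l.getD k 0).testBit i = true} ∪
      {j : ℤ | ∃ k : ℕ, j = head + 1 + (k : ℤ) ∧ (c.r.getD k 0).testBit i = true} := by
    ext j
    simp only [Set.mem_ofPred_eq, Set.mem_union]
    constructor
    · rintro ⟨t, hj⟩
      rcases pos_cases head j with rfl | ⟨k, rfl⟩ | ⟨k, rfl⟩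
      · exact absurd rfl hj
      · left; exact ⟨k, rfl, by rw [← h2]; exact t⟩
      · right; exact ⟨k, rfl, by rw [← h3]; exact t⟩
    · rintro (⟨k, rfl, t⟩ | ⟨k, rfl, t⟩)
      · exact ⟨by rw [h2]; exact t, by omega⟩
      · exact ⟨by rw [h3]; exact t, by omega⟩
  rw [this]
  refine ⟨?_, a2.union b2⟩
  rw [Set.ncard_union_eq ?_ a2 b2, a1, b1]
  rw [Set.disjoint_left]
  rintro j ⟨k, rfl, -⟩ ⟨k', h, -⟩
  omega

theorem ncard_Kset {i : ℕ} {c : PCfg} {x : Cf} (h : Rep i c x) :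
    (Kset x).ncard = 1 + (cnt i c.t.l + cnt i c.t.r) := by
  obtain ⟨h1, h2⟩ := ncard_ones h.tape
  have : Kset x = insert x.head {j | x.tape j = true ∧ j ≠ x.head} := by
    ext j
    simp only [Kset, Set.mem_ofPred_eq, Set.mem_insert_iff]
    by_cases hj : j = x.head <;> simp [hj]
  rw [this, Set.ncard_insert_of_notMem (by simp) h2, h1, add_comm]

/-- `u` is the unary representation of `n` in lane `i`. -/
def Unary (i : ℕ) (u : List ℕ) (n : ℕ) : Prop :=
  ∀ k < u.length, (u.getD k 0).testBit i = decide (k < n)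

theorem addU_spec {i x : ℕ} (u : List ℕ) : ∀ (prev n : ℕ) (b : ℕ), b = (if x.testBit i then 1 else 0) →
    Unary i (prev :: u) (n + 1) →
    (∀ k < u.length, ((addU x u prev).getD k 0).testBit i = decide (k < n + b)) ∧
      (addU x u prev).length = u.length := by
  induction u with
  | nil => intro prev n b _ _; exact ⟨by simp, rfl⟩
  | cons y u ih =>
    intro prev n b hb h
    have e : addU x (y :: u) prev = Nat.lor y (Nat.land prev x) :: addU x u y := rfl
    rw [e]
    have h0 : prev.testBit i = true := by simpa using h 0 (by simp)
    have h1 : y.testBit i = decide (0 < n) := by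
      have := h 1 (by simp)
      rw [List.getD_cons_succ, List.getD_cons_zero] at this
      rw [this]; congr 1; simp
    cases n with
    | zero =>
      have hz : ∀ (u : List ℕ) (y : ℕ), (∀ k < (y :: u).length, ((y :: u).getD k 0).testBit i = false) →
          (∀ k < u.length, ((addU x u y).getD k 0).testBit i = false) ∧ (addU x u y).length = u.length := by
        intro u
        induction u with
        | nil => intro y _; exact ⟨by simp, rfl⟩
        | cons z u ih =>
          intro y hy
          have e : addU x (z :: u) y = Nat.lor z (Nat.land y x) :: addU x u z := rfl
          rw [e]
          have a0 := hy 0 (by simp)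
          have a1 := hy 1 (by simp)
          simp only [List.getD_cons_zero, List.getD_cons_succ] at a0 a1
          obtain ⟨b1, b2⟩ := ih z (fun k hk => by
            have := hy (k + 1) (by simpa using hk)
            rwa [List.getD_cons_succ] at this)
          refine ⟨fun k hk => ?_, by simp [b2]⟩
          cases k with
          | zero => simp [a0, a1]
          | succ k => rw [List.getD_cons_succ]; exact b1 k (by simpa using hk)
      have hy := hz u y (fun k hk => by
        have := h (k + 1) (by simpa using hk)
        rw [List.getD_cons_succ] at this
        rw [this]; simp)
      refine ⟨fun k hk => ?_, by simp [hy.2]⟩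
      cases k with
      | zero => rw [hb]; by_cases hx : x.testBit i = true <;> simp_all
      | succ k =>
        rw [List.getD_cons_succ, hy.1 k (by simpa using hk), hb]
        split_ifs <;> simp
    | succ n =>
      obtain ⟨b1, b2⟩ := ih y n b hb (fun k hk => by
        have := h (k + 1) (by simpa using hk)
        rw [List.getD_cons_succ] at this
        rw [this]; congr 1; simp)
      refine ⟨fun k hk => ?_, by simp [b2]⟩
      cases k with
      | zero => simp [h1]
      | succ k =>
        rw [List.getD_cons_succ, b1 k (by simpa using hk)]
        congr 1
        simp only [eq_iff_iff]; omega

theorem addU_unary {i x full : ℕ} (hf : full.testBit i = true) {u : List ℕ} {n : ℕ} (h : Unary i u n) :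
    Unary i (addU x u full) (n + if x.testBit i then 1 else 0) ∧ (addU x u full).length = u.length := by
  obtain ⟨h1, h2⟩ := addU_spec (i := i) (x := x) u full n _ rfl (fun k hk => by
    cases k with
    | zero => simp [hf]
    | succ k =>
      rw [List.getD_cons_succ, h k (by simpa using hk)]
      congr 1; simp)
  exact ⟨fun k hk => h1 k (by rwa [h2] at hk), h2⟩

theorem cntU_unary {i full : ℕ} (hf : full.testBit i = true) (xs : List ℕ) : ∀ {u : List ℕ} {n : ℕ},
    Unary i u n → Unary i (cntU full xs u) (n + cnt i xs) ∧ (cntU full xs u).length = u.length := by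
  induction xs with
  | nil => intro u n h; exact ⟨h, rfl⟩
  | cons x xs ih =>
    intro u n h
    obtain ⟨h1, h2⟩ := addU_unary (x := x) hf h
    obtain ⟨h3, h4⟩ := ih h1
    have e : cntU full (x :: xs) u = cntU full xs (addU x u full) := rfl
    rw [e]
    refine ⟨?_, h4.trans h2⟩
    have : n + cnt i (x :: xs) = n + (if x.testBit i then 1 else 0) + cnt i xs := by
      unfold cnt; rw [List.countP_cons]; omega
    rw [this]; exact h3

theorem big_false {i full : ℕ} (hf : full.testBit i = true) {c : Tp}
    (h : (big full c).testBit i = false) : cnt i c.l + cnt i c.r ≤ 10 := by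
  have h0 : Unary i (zeros 11) 0 := by intro k _; rw [zeros_getD]; simp
  obtain ⟨h1, h2⟩ := cntU_unary hf c.l h0
  obtain ⟨h3, h4⟩ := cntU_unary hf c.r h1
  have hlen : (cntU full c.r (cntU full c.l (zeros 11))).length = 11 := by
    rw [h4, h2, zeros_eq]; simp
  rw [big, lastPl_eq, hlen, List.getD_cons_succ, h3 10 (by omega)] at h
  simp at h
  omega

theorem get_mask (o : Oct) (x : ℕ) (q a) : (o.mask x).get q a = Nat.land (o.get q a) x := by
  fin_cases q <;> cases a <;> rfl

/-- A hit: the lane halts at the given entry with a small count. -/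
theorem hit_spec {full i : ℕ} (hf : full.testBit i = true) {m : Mach} (hm : NM (m.code i)) {T W : ℕ}
    (hW : 0 < W) {q a} (h : ((runHits full m T W).get q a).testBit i = true) :
    ent (run (dec (m.code i)) T (initCfg 0)) = (q, a) ∧ dec (m.code i) (q, a) = none ∧
    (Kset (run (dec (m.code i)) T (initCfg 0))).ncard < 12 ∧
      ((m.code i) q a).r = false ∧ ((m.code i) q a).l = false := by
  obtain ⟨-, hr⟩ := rep_run hf hm T hW
  set c := psteps full m T (pinit W) with hc
  have e : runHits full m T W = Oct.mask (c.sel full) (Nat.xor full (Nat.lor (Nat.lor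
    (dot Ent.r m (c.sel full)) (dot Ent.l m (c.sel full))) (Nat.lor c.t.lost (big full c.t)))) := rfl
  rw [e, get_mask, tb_land, tb_xor, tb_lor, tb_lor, tb_lor, hf, PCfg.sel, tb_sel hf, tb_dot hf,
    tb_dot hf] at h
  simp only [Bool.and_eq_true, decide_eq_true_eq, Bool.true_xor,
    Bool.not_eq_true', Bool.or_eq_false_iff] at h
  obtain ⟨⟨h1, h2⟩, ⟨h3, h4⟩, h5, h6⟩ := h
  have hR := hr h5
  rw [h1, h2] at h3 h4
  refine ⟨?_, ?_, ?_, h3, h4⟩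
  · rw [ent, hR.state, hR.tape.1, h1, h2]
  · have e3 : ((m.code i) q a).r = false := h3
    have e4 : ((m.code i) q a).l = false := h4
    simp [dec, decE, e3, e4]
  · rw [ncard_Kset hR]; have := big_false hf h6; omega

end BB4

namespace BB4

/-! ### Filling -/

theorem tb_cat {N : ℕ} (xs : List ℕ) : ∀ c i, i < N →
    (cat N (lowMask N) xs).testBit (c * N + i) = (xs.getD c 0).testBit i := by
  induction xs with
  | nil => intro c i _; show Nat.testBit 0 _ = _; simp
  | cons x xs ih =>
    intro c i hi
    show (Nat.lor (Nat.land (lowMask N) x) (Nat.shiftLeft (cat N (lowMask N) xs) N)).testBit _ = _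
    rw [tb_lor, tb_land, tb_lowMask, tb_shl]
    cases c with
    | zero => simp [hi]
    | succ c =>
      have h1 : N ≤ (c + 1) * N + i := by nlinarith
      have h2 : (c + 1) * N + i - N = c * N + i := by rw [Nat.succ_mul]; omega
      have h3 : ¬ ((c + 1) * N + i < N) := by omega
      rw [h2, ih c i hi]
      simp [h1, h3]

theorem tb_rep {N c i : ℕ} (hc : c < 16) (hi : i < N) (x : ℕ) :
    (rep N (lowMask N) x).testBit (c * N + i) = x.testBit i := by
  rw [rep, tb_cat _ _ _ hi]
  interval_cases c <;> rfl

theorem code_fill {N c i : ℕ} (hc : c < 16) (hi : i < N) (m : Mach) :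
    (m.fill N (lowMask N)).code (c * N + i) = fun q a => fillE (m.code i q a) c := by
  have hf : (lowMask N).testBit i = true := by simp [hi]
  funext q a
  simp only [Mach.fill, Mach.code, get_emap, Ent.fill, Ent.lane, tb_xor, tb_land, tb_rep hc hi, tb_cat _ _ _ hi,
    fillE]
  generalize (m.get q a).s0.testBit i = s0
  generalize (m.get q a).s1.testBit i = s1
  generalize (m.get q a).w.testBit i = w
  generalize (m.get q a).r.testBit i = r
  generalize (m.get q a).l.testBit i = l
  have e0 : ∀ c < 16, (List.getD [0, lowMask N, 0, lowMask N, 0, lowMask N, 0, lowMask N, 0, lowMask N,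
      0, lowMask N, 0, lowMask N, 0, lowMask N] c 0).testBit i = c.testBit 0 := by
    intro c hc; interval_cases c <;> simp [hi, -Nat.testBit_zero] <;> decide
  have e1 : ∀ c < 16, (List.getD [0, 0, lowMask N, lowMask N, 0, 0, lowMask N, lowMask N, 0, 0,
      lowMask N, lowMask N, 0, 0, lowMask N, lowMask N] c 0).testBit i = c.testBit 1 := by
    intro c hc; interval_cases c <;> simp [hi] <;> decide
  have e2 : ∀ c < 16, (List.getD [0, 0, 0, 0, lowMask N, lowMask N, lowMask N, lowMask N, 0, 0, 0, 0,
      lowMask N, lowMask N, lowMask N, lowMask N] c 0).testBit i = c.testBit 2 := by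
    intro c hc; interval_cases c <;> simp [hi] <;> decide
  have e3 : ∀ c < 16, (List.getD [0, 0, 0, 0, 0, 0, 0, 0, lowMask N, lowMask N, lowMask N, lowMask N,
      lowMask N, lowMask N, lowMask N, lowMask N] c 0).testBit i = c.testBit 3 := by
    intro c hc; interval_cases c <;> simp [hi] <;> decide
  rw [e0 c hc, e1 c hc, e2 c hc, e3 c hc]
  cases r <;> cases l <;> simp

theorem NM_fill (v : Code) (c : ℕ) : NM (fun q a => fillE (v q a) c) := by
  intro q a
  simp only [fillE]
  generalize v q a = e
  obtain ⟨s0, s1, w, r, l⟩ := e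
  cases r <;> cases l <;> simp

def AllM (m : Mach) (A : ℕ) : Prop := ∀ i, A.testBit i = true → GoodM (m.code i)
def AllG (m : Mach) (A : ℕ) : Prop := ∀ i, A.testBit i = true → Good (m.code i)

def Ent.markE (e : EB) (b : Bool) : EB := ⟨e.s0, e.s1, e.w, e.r || b, e.l || b⟩

theorem code_mark (m : Mach) (h : Oct) (i : ℕ) (q a) :
    (m.mark h).code i q a = Ent.markE (m.code i q a) ((h.get q a).testBit i) := by
  fin_cases q <;> cases a <;>
    simp [Mach.code, Mach.mark, Mach.get, Ent.mark, Ent.lane, Ent.markE, Oct.get]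

theorem tb_osum (o : Oct) (i : ℕ) : o.sum.testBit i = true ↔ ∃ q a, (o.get q a).testBit i = true := by
  constructor
  · intro h
    simp only [Oct.sum, tb_lor, Bool.or_eq_true] at h
    rcases h with ((h | h) | (h | h)) | ((h | h) | (h | h))
    exacts [⟨0, false, h⟩, ⟨0, true, h⟩, ⟨1, false, h⟩, ⟨1, true, h⟩, ⟨2, false, h⟩, ⟨2, true, h⟩,
      ⟨3, false, h⟩, ⟨3, true, h⟩]
  · rintro ⟨q, a, h⟩
    fin_cases q <;> cases a <;> simp only [Oct.sum, tb_lor, Bool.or_eq_true] <;> simp_all [Oct.get]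

theorem get_undef (m : Mach) (full : ℕ) (q a) :
    (m.undef full).get q a = Nat.xor full (Nat.lor (m.get q a).r (m.get q a).l) := by
  fin_cases q <;> cases a <;> rfl

/-- The central step: if the filled machine halts at an undefined entry, mark this entry. -/
theorem mark_step {v : Code} {T : ℕ} {q a} (hv : NM v)
    (h1 : ent (run (dec v) T (initCfg 0)) = (q, a)) (h2 : dec v (q, a) = none)
    (h3 : (Kset (run (dec v) T (initCfg 0))).ncard < 12)
    (h4 : (v q a).r = false) (h5 : (v q a).l = false)
    {G : TM} (hG : Match v G) (hO : OneNone G) (hS : NoStay G) (hK : HaltsK G 0) (u : Code)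
    (hu : ∀ q' a', u q' a' = Ent.markE (v q' a') (decide (q' = q ∧ a' = a))) :
    MatchM u G ∧ ∃ q' a', (u q' a').r = false ∧ (u q' a').l = false := by
  have hex : ∃ t, dec v (ent (run (dec v) t (initCfg 0))) = none := ⟨T, by rw [h1, h2]⟩
  classical
  have ht := Nat.find_spec hex
  have hmin := fun s => Nat.find_min (H := hex) (m := s)
  set t := Nat.find hex with htd
  have hrun : run (dec v) t (initCfg 0) = run (dec v) T (initCfg 0) :=
    run_halt_unique ht (by rw [h1, h2])
  have hG' : run G t (initCfg 0) = run (dec v) T (initCfg 0) := by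
    rw [run_ext (Match_dec hG) t _ (fun s hs => hmin s hs), hrun]
  rcases hx : G (q, a) with _ | ⟨q1, w, d⟩
  · exact absurd hK (not_haltsK (t := t) (by rw [hG', h1, hx]) (by rw [hG']; exact h3))
  constructor
  · have key : ∀ (q : Fin 4) (w b : Bool), ∃ c < 16, stOf (Nat.testBit c 0) (Nat.testBit c 1) = q ∧
        Nat.testBit c 2 = w ∧ Nat.testBit c 3 = b := by decide
    have hd : d = .left ∨ d = .right := by
      cases d
      · simp
      · exact absurd hx (hS _ _ _)
      · simp
    obtain ⟨c, hc, k1, k2, k3⟩ := key q1 w (isR d)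
    refine ⟨c, hc, fun q' a' => ?_⟩
    show EMatch (fillE (u q' a') c) _
    rw [hu]
    by_cases he : q' = q ∧ a' = a
    · obtain ⟨rfl, rfl⟩ := he
      rw [hx]
      rcases hd with rfl | rfl <;> simp [isR] at k3 <;>
        simp [-Nat.testBit_zero, Ent.markE, fillE, EMatch, k1, k2, k3]
    · have h6 := hG q' a'
      have h7 := hv q' a'
      have e : Ent.markE (v q' a') (decide (q' = q ∧ a' = a)) = v q' a' := by simp [Ent.markE, he]
      rw [e]
      simpa [fillE, h7] using h6
  · obtain ⟨⟨q0, a0⟩, h0⟩ := hO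
    have hn : G (q0, a0) = none := (h0 _).2 rfl
    have hne : ¬ (q0 = q ∧ a0 = a) := by
      rintro ⟨rfl, rfl⟩; rw [hx] at hn; cases hn
    refine ⟨q0, a0, ?_⟩
    rw [hu]
    have h6 := hG q0 a0
    rw [hn] at h6
    simp only [EMatch] at h6
    rcases hr : (v q0 a0).r <;> rcases hl : (v q0 a0).l <;> simp_all [Ent.markE]

theorem level_true {v : Lv} {m0 : Mach} {alive0 : ℕ} {k : Mach → ℕ → Mach → ℕ → Bool}
    (hW : 0 < v.W) (h : level v m0 alive0 k = true) :
    ∃ mh ah mp ap, k mh ah mp ap = true ∧ ap ≤ lowMask v.P ∧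
      (AllM mh ah → AllG mp ap → AllM m0 alive0) := by
  obtain ⟨h0, h⟩ := brec_true h
  simp only [Mach.force_eq] at h
  unfold levelOut at h
  set m := m0.fill v.N (lowMask v.N) with hm
  set full := lowMask (Nat.mul 16 v.N) with hfull
  set alive := rep v.N (lowMask v.N) alive0 with hal
  set hs := runHits full m v.T v.W with hhs
  obtain ⟨mh, ah, h1, -, s1⟩ := pack_true h
  obtain ⟨mp, ap, h2, h3, s2⟩ := pack_true h1
  refine ⟨mh, ah, mp, ap, h2, h3, fun gh gp i hi G hG hO hS hK => ?_⟩
  have hiN : i < v.N := lt_of_le_lowMask (ble_true h0) hi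
  obtain ⟨c, hc, hG⟩ := hG
  set j := c * v.N + i with hj
  have hcode : m.code j = fun q a => fillE (m0.code i q a) c := code_fill hc hiN m0
  have hNM : NM (m.code j) := by rw [hcode]; exact NM_fill _ _
  have hGj : Match (m.code j) G := by rw [hcode]; exact hG
  have haj : alive.testBit j = true := by rw [hal, hj, tb_rep hc hiN]; exact hi
  have hfj : full.testBit j = true := by
    rw [hfull, tb_lowMask]
    have : c * v.N + i < 16 * v.N := by nlinarith
    exact decide_eq_true this
  by_cases hh : hs.sum.testBit j = true
  · obtain ⟨q, a, hqa⟩ := (tb_osum _ _).1 hh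
    obtain ⟨e1, e2, e3, e4, e5⟩ := hit_spec hfj hNM hW hqa
    have huniq : ∀ q' a', (hs.get q' a').testBit j = decide (q' = q ∧ a' = a) := by
      intro q' a'
      by_cases hb : (hs.get q' a').testBit j = true
      · obtain ⟨e1', -⟩ := hit_spec hfj hNM hW hb
        rw [e1] at e1'
        obtain ⟨rfl, rfl⟩ := Prod.mk.inj e1'
        simp [hb]
      · rw [Bool.not_eq_true] at hb
        rw [hb]; symm
        rw [decide_eq_false_iff_not]
        rintro ⟨rfl, rfl⟩
        rw [hqa] at hb; cases hb
    have hu : ∀ q' a', (m.mark hs).code j q' a' =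
        Ent.markE (m.code j q' a') (decide (q' = q ∧ a' = a)) := by
      intro q' a'; rw [code_mark, huniq]
    obtain ⟨g1, q2, a2, g2, g3⟩ := mark_step hNM e1 e2 e3 e4 e5 hGj hO hS hK _ hu
    have hun : ((m.mark hs).undef full).sum.testBit j = true := by
      rw [tb_osum]
      refine ⟨q2, a2, ?_⟩
      rw [get_undef, tb_xor, tb_lor, hfj]
      have g2' : ((m.mark hs).get q2 a2).r.testBit j = false := g2
      have g3' : ((m.mark hs).get q2 a2).l.testBit j = false := g3
      rw [g2', g3']; rfl
    obtain ⟨j', hj', ec⟩ := s1.fwd j (by rw [tb_land, tb_land, haj, hh, hun]; rfl)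
    have := gh j' hj'
    rw [ec] at this
    exact this G g1 hO hS hK
  · rw [Bool.not_eq_true] at hh
    obtain ⟨j', hj', ec⟩ := s2.fwd j (by rw [tb_xor, tb_land, haj, hh]; rfl)
    have := gp j' hj'
    rw [ec] at this
    exact this G hGj hO hS hK

theorem levels_true {k : Mach → ℕ → Mach → ℕ → Bool} (vs : List Lv) : (∀ v ∈ vs, 0 < v.W) →
    ∀ {m A mp ap}, levels vs k m A mp ap = true →
    ∃ mh ah mq aq, k mh ah mq aq = true ∧ (AllM mh ah → AllG mq aq → AllM m A ∧ AllG mp ap) := by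
  induction vs with
  | nil => intro _ m A mp ap h; exact ⟨m, A, mp, ap, h, fun a b => ⟨a, b⟩⟩
  | cons v vs ih =>
    intro hv m A mp ap h
    obtain ⟨mh, ah, mq, aq, h1, h2, h3⟩ := level_true (hv v (by simp)) h
    obtain ⟨mr, ar, h4, h5, h6⟩ := append_true h1 h2
    simp only [Mach.force_eq] at h4
    obtain ⟨mh', ah', mq', aq', h7, h8⟩ := ih (fun v hv' => hv v (by simp [hv'])) h4
    refine ⟨mh', ah', mq', aq', h7, fun a b => ?_⟩
    obtain ⟨c1, c2⟩ := h8 a b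
    refine ⟨h3 c1 ?_, ?_⟩
    · intro i hi
      obtain ⟨j, hj, e⟩ := h5 i hi
      rw [← e]; exact c2 j hj
    · intro i hi
      obtain ⟨j, hj, e⟩ := h6 i hi
      rw [← e]; exact c2 j hj

end BB4

namespace BB4

/-! ## Translated cycles -/

structure Agree (D : ℤ → Prop) (s : ℤ) (c c' : Cf) : Prop where
  state : c'.state = c.state
  head : c'.head = c.head + s
  tape : ∀ x, D x → c'.tape (x + s) = c.tape x

theorem Agree.ent {D s c c'} (h : Agree D s c c') (hd : D c.head) : ent c' = ent c := by
  rw [BB4.ent, BB4.ent, h.state, h.head, h.tape _ hd]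

theorem Agree.step {f : TM} {D s c c'} (h : Agree D s c c') (hd : D c.head) :
    Agree D s (stepT f c) (stepT f c') := by
  have he := h.ent hd
  rcases hx : f (BB4.ent c) with _ | x
  · rw [stepT_none hx, stepT_none (by rw [he]; exact hx)]; exact h
  · rw [stepT_some hx, stepT_some (by rw [he]; exact hx)]
    refine ⟨rfl, ?_, ?_⟩
    · simp only [app, h.head]; ring
    · intro y hy
      simp only [app, h.head, Function.update_apply, add_left_inj, h.tape y hy]

theorem cyc_abs {f : TM} {c0 : Cf} {T : ℕ} (hT : 0 < T) {D : ℤ → Prop} {s : ℤ}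
    (hD : ∀ x, D x → D (x + s)) (hh : ∀ t ≤ T, D (run f t c0).head)
    (hA : Agree D s c0 (run f T c0)) (hf : f (ent (run f T c0)) ≠ none) (n : ℕ) :
    f (ent (run f n c0)) ≠ none := by
  have key : ∀ n, D (run f n c0).head ∧ Agree D s (run f n c0) (run f (n + T) c0) := by
    intro n
    induction n using Nat.strong_induction_on with
    | _ n ih =>
      have h1 : D (run f n c0).head := by
        by_cases hn : n ≤ T
        · exact hh n hn
        · obtain ⟨a, b⟩ := ih (n - T) (by omega)
          have := b.head
          rw [show n - T + T = n by omega] at this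
          rw [this]; exact hD _ a
      refine ⟨h1, ?_⟩
      cases n with
      | zero => rw [zero_add]; exact hA
      | succ n =>
        obtain ⟨a, b⟩ := ih n (by omega)
        rw [show n + 1 + T = n + T + 1 by omega, run_succ', run_succ']
        exact b.step a
  have hm : ∀ k, f (ent (run f (k * T) c0)) ≠ none := by
    intro k
    have : ent (run f (k * T) c0) = ent (run f T c0) := by
      induction k with
      | zero => rw [zero_mul]; exact (hA.ent (hh 0 (by omega))).symm
      | succ k ih =>
        obtain ⟨a, b⟩ := key (k * T)
        rw [Nat.succ_mul, b.ent a, ih]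
    rw [this]; exact hf
  intro hn
  apply hm n
  have hle : n ≤ n * T := Nat.le_mul_of_pos_right n hT
  obtain ⟨r, hr⟩ := Nat.exists_eq_add_of_le hle
  rw [hr, Nat.add_comm, run_add, run_none hn]; exact hn

theorem NH_of_tail {f : TM} {p : ℕ} (h : ∀ n, f (ent (run f n (run f p (initCfg 0)))) ≠ none) :
    NH f := by
  intro t ht
  apply h t
  rw [← run_add, Nat.add_comm, run_add, run_none ht]; exact ht

theorem orL_false {i : ℕ} {l : List ℕ} (h : (orL l).testBit i = false) :
    ∀ k, (l.getD k 0).testBit i = false := by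
  induction l with
  | nil => intro k; simp
  | cons x l ih =>
    have e : orL (x :: l) = Nat.lor x (orL l) := rfl
    rw [e, tb_lor, Bool.or_eq_false_iff] at h
    intro k
    cases k with
    | zero => exact h.1
    | succ k => exact ih h.2 k

theorem orZ_spec (l : List ℕ) : ∀ us : List ℕ, l.length = us.length →
    (orZ l us).length = l.length ∧ ∀ k, (orZ l us).getD k 0 = Nat.lor (l.getD k 0) (us.getD k 0) := by
  induction l with
  | nil =>
    intro us h
    have : us = [] := by cases us <;> simp_all
    subst this
    exact ⟨rfl, fun k => by simp [orZ]⟩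
  | cons x l ih =>
    intro us h
    cases us with
    | nil => simp at h
    | cons u us =>
      obtain ⟨a, b⟩ := ih us (by simpa using h)
      have e : orZ (x :: l) (u :: us) = Nat.lor x u :: orZ l us := rfl
      rw [e]
      refine ⟨by simp [a], fun k => ?_⟩
      cases k with
      | zero => rfl
      | succ k => exact b k

theorem xorL_false {i : ℕ} (l : List ℕ) : ∀ us : List ℕ, l.length = us.length →
    (xorL l us).testBit i = false → ∀ k, (l.getD k 0).testBit i = (us.getD k 0).testBit i := by
  induction l with
  | nil =>
    intro us h _ k
    have : us = [] := by cases us <;> simp_all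
    subst this; rfl
  | cons x l ih =>
    intro us h hx
    cases us with
    | nil => simp at h
    | cons u us =>
      have e : xorL (x :: l) (u :: us) = Nat.lor (Nat.xor x u) (xorL l us) := rfl
      rw [e, tb_lor, tb_xor, Bool.or_eq_false_iff] at hx
      intro k
      cases k with
      | zero => have := hx.1; simpa using this
      | succ k => exact ih us (by simpa using h) hx.2 k

theorem suf_len (l : List ℕ) : (suf l).length = l.length := by
  induction l with
  | nil => rfl
  | cons x l ih => exact congrArg (· + 1) ih

theorem suf_spec {i : ℕ} (l : List ℕ) : ∀ k k', k ≤ k' → (l.getD k' 0).testBit i = true →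
    ((suf l).getD k 0).testBit i = true := by
  induction l with
  | nil => intro k k' _ h; simp at h
  | cons x l ih =>
    have e : suf (x :: l) = Nat.lor x (hd (suf l)) :: suf l := rfl
    intro k k' hk h
    rw [e]
    cases k' with
    | zero =>
      obtain rfl : k = 0 := by omega
      have h' : x.testBit i = true := h
      show (Nat.lor x (hd (suf l))).testBit i = true
      rw [tb_lor, h']; rfl
    | succ k' =>
      cases k with
      | zero =>
        show (Nat.lor x (hd (suf l))).testBit i = true
        rw [tb_lor, hd_eq, ih 0 k' (by omega) h, Bool.or_true]
      | succ k => exact ih k k' (by omega) h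

theorem xorM_false {i : ℕ} (s : List ℕ) : ∀ l us : List ℕ, s.length = l.length → l.length = us.length →
    (xorM s l us).testBit i = false → ∀ k, (s.getD k 0).testBit i = true →
    (l.getD k 0).testBit i = (us.getD k 0).testBit i := by
  induction s with
  | nil => intro l us _ _ _ k hk; simp at hk
  | cons e s ih =>
    intro l us h1 h2 hx
    cases l with
    | nil => simp at h1
    | cons x l =>
      cases us with
      | nil => simp at h2
      | cons u us =>
        have he : xorM (e :: s) (x :: l) (u :: us) = Nat.lor (Nat.land e (Nat.xor x u)) (xorM s l us) := rfl
        rw [he, tb_lor, tb_land, tb_xor, Bool.or_eq_false_iff] at hx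
        intro k hk
        cases k with
        | zero => have := hx.1; have hk' : e.testBit i = true := hk; rw [hk'] at this; simpa using this
        | succ k => exact ih l us (by simpa using h1) (by simpa using h2) hx.2 k hk

/-- The marker tape. -/
def mtape (h0 : ℤ) : ℤ → Bool := fun j => decide (j = h0)

theorem krep_step {full i : ℕ} (hf : full.testBit i = true) {m : Mach} (hm : NM (m.code i))
    {c : PCfg} {x : Cf} (hr : Rep i c x) {k : Tp} (hk : k.l ≠ [] ∧ k.r ≠ []) {tape : ℤ → Bool}
    (h : TRep i k tape x.head) {k' : Tp}
    (hk' : k' = k.shift (dot Ent.r m (c.sel full)) (dot Ent.l m (c.sel full))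
      (Nat.xor full (Nat.lor (dot Ent.r m (c.sel full)) (dot Ent.l m (c.sel full)))) k.a)
    (hlost : k'.lost.testBit i = false) :
    TRep i k' tape (stepT (dec (m.code i)) x).head := by
  subst hk'
  obtain ⟨h1, h2⟩ := hr
  have hent : ent x = (stOf (c.s0.testBit i) (c.s1.testBit i), c.t.a.testBit i) := by
    rw [ent, h1, h2.1]
  set e := c.sel full with he
  have hd : ∀ p, (dot p m e).testBit i = (p (m.get (ent x).1 (ent x).2)).testBit i := by
    intro p; rw [he, PCfg.sel, tb_dot hf, hent]
  set R := dot Ent.r m e with hR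
  set L := dot Ent.l m e with hL
  set E := m.get (ent x).1 (ent x).2 with hE
  have hdec : dec (m.code i) (ent x) = decE (E.lane i) := rfl
  have hR' : R.testBit i = (E.lane i).r := hd _
  have hL' : L.testBit i = (E.lane i).l := hd _
  have hnm : ((E.lane i).r && (E.lane i).l) = false := hm _ _
  have hup : Function.update tape x.head (k.a.testBit i) = tape := by
    rw [← h.1, Function.update_eq_self]
  generalize E.lane i = v at *
  obtain ⟨s0, s1, w, r, l⟩ := v
  simp only at hR' hL' hnm
  cases r <;> cases l
  · have hx : dec (m.code i) (ent x) = none := by rw [hdec]; rfl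
    rw [stepT_none hx]
    exact TRep_stay hR' hL' (by simp [hR', hL', hf]) rfl h
  · have hx : dec (m.code i) (ent x) = some (stOf s0 s1, w, .left) := by rw [hdec]; rfl
    rw [stepT_some hx]
    have := TRep_left hR' hL' (by simp [hR', hL', hf]) hk.2 h hlost
    rw [hup] at this; exact this
  · have hx : dec (m.code i) (ent x) = some (stOf s0 s1, w, .right) := by rw [hdec]; rfl
    rw [stepT_some hx]
    have := TRep_right hR' hL' (by simp [hR', hL', hf]) hk.1 h hlost
    rw [hup] at this; exact this
  · simp at hnm

structure CLen (W : ℕ) (x : Cyc) : Prop where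
  cl : x.c.t.l.length = W
  cr : x.c.t.r.length = W
  kl : x.k.l.length = W
  kr : x.k.r.length = W
  el : x.eL.length = W
  er : x.eR.length = W

/-- Invariant of the cycle search in lane `i` after `t` steps. -/
structure CI (i : ℕ) (f : TM) (c0 : PCfg) (C0 : Cf) (t : ℕ) (x : Cyc) : Prop where
  lost : x.c.t.lost.testBit i = false → c0.t.lost.testBit i = false
  rep : x.c.t.lost.testBit i = false → Rep i x.c (run f t C0)
  krep : x.c.t.lost.testBit i = false → x.k.lost.testBit i = false →
    TRep i x.k (mtape C0.head) (run f t C0).head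
  vis : x.c.t.lost.testBit i = false → x.k.lost.testBit i = false → ∀ s ≤ t,
    (run f s C0).head = C0.head ∨
    (∃ j : ℕ, (run f s C0).head = C0.head - 1 - j ∧ (x.eL.getD j 0).testBit i = true) ∨
    (∃ j : ℕ, (run f s C0).head = C0.head + 1 + j ∧ (x.eR.getD j 0).testBit i = true)
  ok : x.ok.testBit i = true → ∀ n, f (ent (run f n C0)) ≠ none

theorem cyc_step {full i W : ℕ} (hf : full.testBit i = true) {m : Mach} (hm : NM (m.code i))
    (hW : 0 < W) {c0 : PCfg} {C0 : Cf} {t : ℕ} {x : Cyc} (hl : CLen W x)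
    (h : CI i (dec (m.code i)) c0 C0 t x) :
    CLen W (cycStep full m x) ∧ CI i (dec (m.code i)) c0 C0 (t + 1) (cycStep full m x) := by
  set k' := x.k.shift (dot Ent.r m (x.c.sel full)) (dot Ent.l m (x.c.sel full))
      (Nat.xor full (Nat.lor (dot Ent.r m (x.c.sel full)) (dot Ent.l m (x.c.sel full)))) x.k.a with hk'
  have hs : cycStep full m x = ⟨pstep full m x.c, k', orZ x.eL k'.r, orZ x.eR k'.l, x.ok⟩ := rfl
  rw [hs]
  have ne : ∀ {l : List ℕ}, l.length = W → l ≠ [] := by rintro l hl rfl; simp at hl; omega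
  have hk'l := shift_len x.k (dot Ent.r m (x.c.sel full)) (dot Ent.l m (x.c.sel full))
      (Nat.xor full (Nat.lor (dot Ent.r m (x.c.sel full)) (dot Ent.l m (x.c.sel full)))) x.k.a
  rw [← hk', hl.kl, hl.kr] at hk'l
  obtain ⟨zl, zl'⟩ := orZ_spec x.eL k'.r (by rw [hl.el, hk'l.2])
  obtain ⟨zr, zr'⟩ := orZ_spec x.eR k'.l (by rw [hl.er, hk'l.1])
  refine ⟨⟨?_, ?_, hk'l.1, hk'l.2, zl.trans hl.el, zr.trans hl.er⟩, ?_⟩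
  · exact (shift_len _ _ _ _ _).1.trans hl.cl
  · exact (shift_len _ _ _ _ _).2.trans hl.cr
  have hrep : (pstep full m x.c).t.lost.testBit i = false →
      Rep i (pstep full m x.c) (run (dec (m.code i)) (t + 1) C0) := by
    intro h1; rw [run_succ']
    exact rep_step hf hm ⟨ne hl.cl, ne hl.cr⟩ h.rep h1
  have hkrep : (pstep full m x.c).t.lost.testBit i = false → k'.lost.testBit i = false →
      TRep i k' (mtape C0.head) (run (dec (m.code i)) (t + 1) C0).head := by
    intro h1 h2; rw [run_succ']
    exact krep_step hf hm (h.rep (lost_shift h1)) ⟨ne hl.kl, ne hl.kr⟩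
      (h.krep (lost_shift h1) (lost_shift h2)) hk' h2
  refine ⟨fun h1 => h.lost (lost_shift h1), hrep, hkrep, ?_, h.ok⟩
  intro h1 h2 s hst
  simp only [zl', zr', tb_lor, Bool.or_eq_true]
  rcases Nat.lt_or_ge t s with hlt | hge
  · obtain rfl : s = t + 1 := by omega
    obtain ⟨-, b, c⟩ := hkrep h1 h2
    generalize (run (dec (m.code i)) (t + 1) C0).head = hh at *
    rcases lt_trichotomy hh C0.head with hc | hc | hc
    · right; left
      obtain ⟨j, hj⟩ := Int.le.dest (show hh + 1 ≤ C0.head by omega)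
      refine ⟨j, by omega, Or.inr ?_⟩
      rw [← c j]; simp [mtape, hj]
    · left; exact hc
    · right; right
      obtain ⟨j, hj⟩ := Int.le.dest (show C0.head + 1 ≤ hh by omega)
      refine ⟨j, by omega, Or.inr ?_⟩
      rw [← b j]; simp [mtape]; omega
  · rcases h.vis (lost_shift h1) (lost_shift h2) s hge with h | ⟨j, h, h'⟩ | ⟨j, h, h'⟩
    · left; exact h
    · right; left; exact ⟨j, h, Or.inl h'⟩
    · right; right; exact ⟨j, h, Or.inl h'⟩

theorem cyc_chk {full i W : ℕ} (hf : full.testBit i = true) {m : Mach} (hm : NM (m.code i))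
    {c0 : PCfg} {C0 : Cf} {t : ℕ} (ht : 0 < t) {x : Cyc} (hl : CLen W x)
    (hc0 : c0.t.l.length = W ∧ c0.t.r.length = W)
    (hr0 : c0.t.lost.testBit i = false → Rep i c0 C0)
    (h : CI i (dec (m.code i)) c0 C0 t x) (hc : (cycChk full m c0 x).testBit i = true) (n : ℕ) :
    dec (m.code i) (ent (run (dec (m.code i)) n C0)) ≠ none := by
  simp only [cycChk, tb_land, tb_lor, tb_xor, hf, Bool.and_eq_true, Bool.true_xor, Bool.or_eq_true,
    Bool.not_eq_true', Bool.or_eq_false_iff] at hc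
  obtain ⟨⟨hmv, ⟨hl1, hl2⟩, ha, hs0, hs1⟩, hor⟩ := hc
  have rp := h.rep hl1
  have rk := h.krep hl1 hl2
  have rv := h.vis hl1 hl2
  have r0 := hr0 (h.lost hl1)
  simp only [bne_eq_false_iff_eq] at ha hs0 hs1
  have hst : (run (dec (m.code i)) t C0).state = C0.state := by
    rw [rp.state, r0.state, hs0, hs1]
  have hent : ent (run (dec (m.code i)) t C0) =
      (stOf (x.c.s0.testBit i) (x.c.s1.testBit i), x.c.t.a.testBit i) := by
    rw [ent, rp.state, rp.tape.1]
  have hne : dec (m.code i) (ent (run (dec (m.code i)) t C0)) ≠ none := by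
    simp only [moving, PCfg.sel, tb_lor, tb_dot hf] at hmv
    rw [hent]
    have hNM := hm (stOf (x.c.s0.testBit i) (x.c.s1.testBit i)) (x.c.t.a.testBit i)
    simp only [dec, Mach.code, Ent.lane, decE] at hNM ⊢
    revert hmv hNM
    cases ((m.get (stOf (x.c.s0.testBit i) (x.c.s1.testBit i)) (x.c.t.a.testBit i)).r.testBit i) <;>
    cases ((m.get (stOf (x.c.s0.testBit i) (x.c.s1.testBit i)) (x.c.t.a.testBit i)).l.testBit i) <;> simp
  have hta : (run (dec (m.code i)) t C0).tape (run (dec (m.code i)) t C0).head = C0.tape C0.head := by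
    rw [rp.tape.1, r0.tape.1, ha]
  have hsp : ∀ z : ℤ, z = C0.head ∨ (∃ k : ℕ, z = C0.head - 1 - k) ∨ (∃ k : ℕ, z = C0.head + 1 + k) := by
    intro z
    rcases lt_trichotomy z C0.head with hc | hc | hc
    · right; left; exact ⟨(C0.head - 1 - z).toNat, by omega⟩
    · left; exact hc
    · right; right; exact ⟨(z - C0.head - 1).toNat, by omega⟩
  set C1 := run (dec (m.code i)) t C0 with hC1
  rcases hor with ⟨o1, o2, o3⟩ | ⟨o1, o2, o3⟩
  · have e2 := xorL_false _ _ (by rw [hl.cr, hc0.2]) o2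
    have e3 := xorM_false _ _ _ (by rw [suf_len, hl.el, hl.cl]) (by rw [hl.cl, hc0.1]) o3
    have e1 := orL_false o1
    have hge : C0.head ≤ C1.head := by
      by_contra hcon
      obtain ⟨j, hj⟩ := Int.le.dest (show C1.head + 1 ≤ C0.head by omega)
      have := rk.2.2 j
      rw [e1 j] at this
      simp [mtape, hj] at this
    refine cyc_abs ht (D := fun z => C0.head ≤ z ∨ ∃ k : ℕ, C0.head - 1 - k ≤ z ∧
      (x.eL.getD k 0).testBit i = true) (s := C1.head - C0.head) ?_ ?_ ⟨hst, by rw [← hC1]; ring, ?_⟩ hne n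
    · rintro z (hz | ⟨k, hz, hk⟩)
      · left; omega
      · right; exact ⟨k, by omega, hk⟩
    · intro s hs
      rcases rv s hs with h | ⟨j, h, h'⟩ | ⟨j, h, h'⟩
      · left; omega
      · right; exact ⟨j, by omega, h'⟩
      · left; omega
    · intro z hz
      rcases hsp z with rfl | ⟨k, rfl⟩ | ⟨k, rfl⟩
      · rw [← hta]; congr 1; omega
      · rw [show C0.head - 1 - k + (C1.head - C0.head) = C1.head - 1 - k by ring, rp.tape.2.1,
          r0.tape.2.1]
        rcases hz with hz | ⟨k', hz, hk'⟩
        · omega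
        · exact e3 k (suf_spec _ k k' (by omega) hk')
      · rw [show C0.head + 1 + k + (C1.head - C0.head) = C1.head + 1 + k by ring, rp.tape.2.2,
          r0.tape.2.2]
        exact e2 k
  · have e2 := xorL_false _ _ (by rw [hl.cl, hc0.1]) o2
    have e3 := xorM_false _ _ _ (by rw [suf_len, hl.er, hl.cr]) (by rw [hl.cr, hc0.2]) o3
    have e1 := orL_false o1
    have hge : C1.head ≤ C0.head := by
      by_contra hcon
      obtain ⟨j, hj⟩ := Int.le.dest (show C0.head + 1 ≤ C1.head by omega)
      have := rk.2.1 j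
      rw [e1 j] at this
      simp [mtape] at this; omega
    refine cyc_abs ht (D := fun z => z ≤ C0.head ∨ ∃ k : ℕ, z ≤ C0.head + 1 + k ∧
      (x.eR.getD k 0).testBit i = true) (s := C1.head - C0.head) ?_ ?_ ⟨hst, by rw [← hC1]; ring, ?_⟩ hne n
    · rintro z (hz | ⟨k, hz, hk⟩)
      · left; omega
      · right; exact ⟨k, by omega, hk⟩
    · intro s hs
      rcases rv s hs with h | ⟨j, h, h'⟩ | ⟨j, h, h'⟩
      · left; omega
      · left; omega
      · right; exact ⟨j, by omega, h'⟩
    · intro z hz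
      rcases hsp z with rfl | ⟨k, rfl⟩ | ⟨k, rfl⟩
      · rw [← hta]; congr 1; omega
      · rw [show C0.head - 1 - k + (C1.head - C0.head) = C1.head - 1 - k by ring, rp.tape.2.1,
          r0.tape.2.1]
        exact e2 k
      · rw [show C0.head + 1 + k + (C1.head - C0.head) = C1.head + 1 + k by ring, rp.tape.2.2,
          r0.tape.2.2]
        rcases hz with hz | ⟨k', hz, hk'⟩
        · omega
        · exact e3 k (suf_spec _ k k' (by omega) hk')

theorem cyc_loop {full i W : ℕ} (hf : full.testBit i = true) {m : Mach} (hm : NM (m.code i))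
    (hW : 0 < W) {c0 : PCfg} {C0 : Cf} (hc0 : c0.t.l.length = W ∧ c0.t.r.length = W)
    (hr0 : c0.t.lost.testBit i = false → Rep i c0 C0) (T : ℕ) : ∀ {t : ℕ} {x : Cyc}, CLen W x →
    CI i (dec (m.code i)) c0 C0 t x → (cycLoop full m c0 T x).testBit i = true →
    ∀ n, dec (m.code i) (ent (run (dec (m.code i)) n C0)) ≠ none := by
  induction T with
  | zero => intro t x _ h hx; exact h.ok hx
  | succ T ih =>
    intro t x hl h hx
    have e : cycLoop full m c0 (T + 1) x =
        Cyc.force (cycAdd full m c0 (cycStep full m x)) (cycLoop full m c0 T) := rfl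
    rw [e, Cyc.force_eq] at hx
    obtain ⟨hl', h'⟩ := cyc_step hf hm hW hl h
    refine ih (t := t + 1) (x := cycAdd full m c0 (cycStep full m x)) ?_ ?_ hx
    · exact ⟨hl'.cl, hl'.cr, hl'.kl, hl'.kr, hl'.el, hl'.er⟩
    · refine ⟨h'.lost, h'.rep, h'.krep, h'.vis, ?_⟩
      intro hok
      simp only [cycAdd, tb_lor, Bool.or_eq_true] at hok
      rcases hok with hok | hok
      · exact h'.ok hok
      · exact cyc_chk hf hm (by omega) hl' hc0 hr0 h' hok

theorem psteps_len (full m W) (T : ℕ) : ∀ c : PCfg, (c.t.l.length = W ∧ c.t.r.length = W) →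
    ((psteps full m T c).t.l.length = W ∧ (psteps full m T c).t.r.length = W) := by
  induction T with
  | zero => intro c h; exact h
  | succ T ih =>
    intro c h
    rw [psteps_succ]
    exact ih _ ⟨(shift_len _ _ _ _ _).1.trans h.1, (shift_len _ _ _ _ _).2.trans h.2⟩

theorem cycOk_true {full i p T W : ℕ} (hf : full.testBit i = true) {m : Mach} (hm : NM (m.code i))
    (hW : 0 < W) (h : (cycOk full m p T W).testBit i = true) : NH (dec (m.code i)) := by
  rw [cycOk, PCfg.force_eq] at h
  have zl : (zeros W).length = W := by rw [zeros_eq]; simp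
  obtain ⟨-, hr⟩ := rep_run hf hm p hW
  have hl := psteps_len full m W p (pinit W) ⟨zl, zl⟩
  set c0 := psteps full m p (pinit W) with hc0
  refine NH_of_tail (p := p) (cyc_loop hf hm hW hl hr T (t := 0) ?_ ?_ h)
  · exact ⟨hl.1, hl.2, zl, zl, zl, zl⟩
  · refine ⟨fun h => h, hr, ?_, ?_, ?_⟩
    · intro _ _
      rw [run_zero]
      refine ⟨by simp [mtape, hf], ?_, ?_⟩ <;> intro k <;>
        simp only [zeros_getD, Nat.zero_testBit, mtape, decide_eq_false_iff_not] <;> omega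
    · intro _ _ s hs
      left
      obtain rfl : s = 0 := by omega
      rfl
    · simp

theorem Good_of_mark {v : Code} (h : ¬ NM v) : Good v := by
  intro G hG
  exfalso
  apply h
  intro q a
  have := hG q a
  simp only [EMatch] at this
  rcases hr : (v q a).r <;> rcases hl : (v q a).l <;> simp [hr, hl] at this ⊢

theorem cycStage_true {d N N' p T W : ℕ} (hW : 0 < W) {m : Mach} {A : ℕ} {k : Mach → ℕ → Bool}
    (h : cycStage d N N' p T W m A k = true) :
    ∃ m' A', k m' A' = true ∧ A' ≤ lowMask N' ∧ (AllG m' A' → AllG m A) := by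
  obtain ⟨h0, h⟩ := brec_true h
  obtain ⟨m', A', h1, h2, h3⟩ := pack_true h
  refine ⟨m', A', h1, h2, fun g i hi => ?_⟩
  have hf : (lowMask N).testBit i = true := by
    rw [tb_lowMask]; exact decide_eq_true (lt_of_le_lowMask (ble_true h0) hi)
  by_cases hm : NM (m.code i)
  · by_cases hc : (cycOk (lowMask N) m p T W).testBit i = true
    · exact Good_of_NH (cycOk_true hf hm hW hc)
    · rw [Bool.not_eq_true] at hc
      obtain ⟨j, hj, e⟩ := h3.fwd i (by rw [tb_land, hi, tb_xor, hf, hc]; rfl)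
      rw [← e]; exact g j hj
  · exact Good_of_mark hm

end BB4

namespace BB4

/-! ## Closed position sets -/

noncomputable def PT.get (i : ℕ) (t : PT) : List Bool → Bool :=
  PT.rec (fun x _ => x.testBit i) (fun _ _ iha ihb s => bif s.headD false then ihb s.tail else iha s.tail) t

theorem PT.get_leaf (i x s) : (PT.leaf x).get i s = x.testBit i := rfl
theorem PT.get_node (i a b s) : (PT.node a b).get i s =
    bif s.headD false then b.get i s.tail else a.get i s.tail := rfl
theorem PT.get_node_cons (i a b y s) : (PT.node a b).get i (y :: s) =
    bif y then b.get i s else a.get i s := rfl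

theorem PT.get_map {i : ℕ} {f : ℕ → ℕ} {g : Bool → Bool} (h : ∀ x, (f x).testBit i = g (x.testBit i))
    (t : PT) : ∀ s, (t.map f).get i s = g (t.get i s) := by
  induction t with
  | leaf x => intro s; exact h x
  | node a b iha ihb =>
    intro s
    show (PT.node (a.map f) (b.map f)).get i s = _
    rw [get_node, get_node, iha, ihb]
    cases s.headD false <;> rfl

theorem PT.get_land (i e : ℕ) (t : PT) (s) : (t.map (Nat.land e)).get i s = (e.testBit i && t.get i s) :=
  PT.get_map (g := fun b => e.testBit i && b) (fun x => tb_land e x i) t s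

theorem PT.get_lor (i e : ℕ) (t : PT) (s) : (t.map (Nat.lor e)).get i s = (e.testBit i || t.get i s) :=
  PT.get_map (g := fun b => e.testBit i || b) (fun x => tb_lor e x i) t s

theorem PT.get_or (i : ℕ) (t : PT) : ∀ u s, (t.or u).get i s = (t.get i s || u.get i s) := by
  induction t with
  | leaf x =>
    intro u
    induction u with
    | leaf y => intro s; exact tb_lor x y i
    | node a b iha ihb =>
      intro s
      show (PT.node ((PT.leaf x).or a) ((PT.leaf x).or b)).get i s = _
      rw [get_node, get_node, iha, ihb, get_leaf]
      cases s.headD false <;> rfl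
  | node a b iha ihb =>
    intro u s
    cases u with
    | leaf y =>
      show (PT.node (a.map (Nat.lor y)) (b.map (Nat.lor y))).get i s = _
      rw [get_node, get_node, get_lor, get_lor, get_leaf]
      cases s.headD false <;> exact Bool.or_comm _ _
    | node c d =>
      show (PT.node (a.or c) (b.or d)).get i s = _
      rw [get_node, get_node, get_node, iha, ihb]
      cases s.headD false <;> rfl

theorem PT.get_any {i : ℕ} (t : PT) : ∀ s, t.get i s = true → t.any.testBit i = true := by
  induction t with
  | leaf x => intro s h; exact h
  | node a b iha ihb =>
    intro s h
    show (Nat.lor a.any b.any).testBit i = true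
    rw [tb_lor]
    rw [get_node] at h
    cases hs : s.headD false <;> rw [hs] at h
    · rw [iha _ h]; rfl
    · rw [ihb _ h, Bool.or_true]

theorem PT.get_c0 (i : ℕ) (t : PT) (s) : t.c0.get i s = t.get i (false :: s) := by cases t <;> rfl
theorem PT.get_c1 (i : ℕ) (t : PT) (s) : t.c1.get i s = t.get i (true :: s) := by cases t <;> rfl

theorem PT.get_drop {i : ℕ} {t : PT} {x y s} (h : t.get i (x :: y :: s) = true) :
    (PT.drop 1 t).get i (x :: s) = true := by
  show (PT.node (t.c0.c0.or t.c0.c1) (t.c1.c0.or t.c1.c1)).get i (x :: s) = true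
  simp only [get_node_cons, get_or, get_c0, get_c1]
  cases x <;> cases y <;> simp [h]

theorem PT.get_ins2 (i : ℕ) (t u : PT) (x y z s) :
    (PT.ins 2 t u).get i (x :: y :: z :: s) = bif z then u.get i (x :: y :: s) else t.get i (x :: y :: s) := by
  show (PT.node (.node (.node t.c0.c0 u.c0.c0) (.node t.c0.c1 u.c0.c1))
    (.node (.node t.c1.c0 u.c1.c0) (.node t.c1.c1 u.c1.c1))).get i _ = _
  cases x <;> cases y <;> cases z <;> simp only [get_node_cons, get_c0, get_c1, cond_true, cond_false]

theorem PT.get_tr (i : ℕ) (t : PT) (a b c d s) :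
    (PT.tr 2 2 t).get i (c :: d :: a :: b :: s) = t.get i (a :: b :: c :: d :: s) := by
  show (PT.ins 2 (PT.ins 2 t.c0.c0 t.c0.c1) (PT.ins 2 t.c1.c0 t.c1.c1)).get i _ = _
  rw [get_ins2, get_ins2, get_ins2]
  cases a <;> cases b <;> simp only [get_c0, get_c1, cond_true, cond_false]

theorem PT.get_projL {i : ℕ} {t : PT} {x y s} (h : t.get i (x :: y :: s) = true) (s') :
    (PT.projL 2 t).get i (x :: y :: s') = true := by
  show (PT.node (.node (.leaf t.c0.c0.any) (.leaf t.c0.c1.any))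
    (.node (.leaf t.c1.c0.any) (.leaf t.c1.c1.any))).get i _ = true
  cases x <;> cases y <;> simp only [get_node_cons, get_leaf, cond_true, cond_false] <;>
    apply get_any _ s <;> simpa only [get_c0, get_c1] using h

theorem PT.get_extend {i : ℕ} (u : PT) : ∀ (p : PT) s, u.get i s = true → p.get i s = true →
    (u.extend p).get i s = true := by
  induction u with
  | leaf v =>
    intro p s h1 h2
    show (p.map (Nat.land v)).get i s = true
    rw [get_land, h2, Bool.and_true]; exact h1
  | node a b iha ihb =>
    intro p s h1 h2
    cases p with
    | leaf y => exact h2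
    | node c d =>
      show (PT.node (a.extend c) (b.extend d)).get i s = true
      rw [get_node] at *
      cases hs : s.headD false <;> rw [hs] at h1 h2
      · exact iha _ _ h1 h2
      · exact ihb _ _ h1 h2

theorem PT.get_next {i : ℕ} {b : Bool} {p t : PT} {x s} (h1 : t.get i (x :: b :: s) = true)
    (h2 : p.get i s = true) : (PT.next b p 1 t).get i (x :: s) = true := by
  show (PT.node ((Bool.rec t.c0.c0 t.c0.c1 b : PT).extend p)
    ((Bool.rec t.c1.c0 t.c1.c1 b : PT).extend p)).get i _ = true
  rw [get_node_cons]
  cases x <;> cases b <;> simp only [cond_true, cond_false] <;> apply get_extend _ _ _ _ h2 <;>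
    simpa only [get_c0, get_c1] using h1

theorem PT.get_psum {i : ℕ} {z : PT} (es : List ℕ) : ∀ (ts : List PT) (k : ℕ) s,
    (es.getD k 0).testBit i = true → (ts.getD k (.leaf 0)).get i s = true →
    (psum es ts z).get i s = true := by
  induction es with
  | nil => intro ts k s h; simp at h
  | cons e es ih =>
    intro ts k s h1 h2
    cases ts with
    | nil => simp [get_leaf] at h2
    | cons t ts =>
      show ((t.map (Nat.land e)).or (psum es ts z)).get i s = true
      rw [get_or, get_land]
      cases k with
      | zero =>
        have h1' : e.testBit i = true := h1
        have h2' : t.get i s = true := h2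
        rw [h1', h2']; rfl
      | succ k => rw [ih ts k s h1 h2, Bool.or_true]

theorem PT.viol_false {i full : ℕ} (hf : full.testBit i = true) (t : PT) : ∀ (u : PT),
    (t.viol full u).testBit i = false → ∀ s, t.get i s = true → u.get i s = true := by
  induction t with
  | leaf x =>
    intro u h s hx
    cases u with
    | leaf y =>
      have h' : (Nat.xor (Nat.lor x y) y).testBit i = false := h
      have hx' : x.testBit i = true := hx
      rw [tb_xor, tb_lor, hx'] at h'
      show y.testBit i = true
      simpa using h'
    | node c d =>
      have h' : full.testBit i = false := h
      rw [hf] at h'; cases h'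
  | node a b iha ihb =>
    intro u h s hx
    cases u with
    | leaf y =>
      have h' : full.testBit i = false := h
      rw [hf] at h'; cases h'
    | node c d =>
      have h' : (Nat.lor (a.viol full c) (b.viol full d)).testBit i = false := h
      rw [tb_lor, Bool.or_eq_false_iff] at h'
      rw [get_node] at *
      cases hs : s.headD false <;> rw [hs] at hx
      · exact iha _ h'.1 _ hx
      · exact ihb _ h'.2 _ hx

theorem violL_false {i full : ℕ} (hf : full.testBit i = true) (l : List PT) : ∀ us : List PT,
    (violL full l us).testBit i = false → ∀ k s, (l.getD k (.leaf 0)).get i s = true →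
    (us.getD k (.leaf 0)).get i s = true := by
  induction l with
  | nil => intro us _ k s h; simp [PT.get_leaf] at h
  | cons t l ih =>
    intro us h k s hs
    cases us with
    | nil =>
      have h' : full.testBit i = false := h
      rw [hf] at h'; cases h'
    | cons u us =>
      have h' : (Nat.lor (t.viol full u) (violL full l us)).testBit i = false := h
      rw [tb_lor, Bool.or_eq_false_iff] at h'
      cases k with
      | zero => exact PT.viol_false hf t u h'.1 s hs
      | succ k => exact ih us h'.2 k s hs

theorem anyHalt_false {i : ℕ} (us : List ℕ) : ∀ ts : List PT, (anyHalt us ts).testBit i = false →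
    ∀ k s, (us.getD k 0).testBit i = true → (ts.getD k (.leaf 0)).get i s = false := by
  induction us with
  | nil => intro ts _ k s h; simp at h
  | cons u us ih =>
    intro ts h k s hu
    cases ts with
    | nil => simp [PT.get_leaf]
    | cons t ts =>
      have h' : (Nat.lor (Nat.land u t.any) (anyHalt us ts)).testBit i = false := h
      rw [tb_lor, tb_land, Bool.or_eq_false_iff] at h'
      cases k with
      | zero =>
        have hu' : u.testBit i = true := hu
        rw [hu', Bool.true_and] at h'
        by_contra hc
        rw [Bool.not_eq_false] at hc
        have := PT.get_any t s hc
        rw [h'.1] at this; cases this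
      | succ k => exact ih ts h'.2 k s hu

theorem tmap_getD (f : PT → PT) (l : List PT) : ∀ (k : ℕ), k < l.length →
    (tmap f l).getD k (.leaf 0) = f (l.getD k (.leaf 0)) := by
  induction l with
  | nil => intro k h; simp at h
  | cons t l ih =>
    intro k h
    cases k with
    | zero => rfl
    | succ k => exact ih k (by simpa using h)

theorem tmap_len (f : PT → PT) (l : List PT) : (tmap f l).length = l.length := by
  induction l with
  | nil => rfl
  | cons t l ih => exact congrArg (· + 1) ih

theorem lt_len_of_get {i : ℕ} {l : List PT} {k s} (h : (l.getD k (.leaf 0)).get i s = true) :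
    k < l.length := by
  by_contra hc
  rw [List.getD_eq_default _ _ (by omega), PT.get_leaf] at h
  simp at h

def eix (q : Fin 4) (a : Bool) : ℕ := 2 * q.val + a.toNat

def XS.G (X : XS) (q : Fin 4) (a : Bool) : PT := X.M.getD (eix q a) (.leaf 0)

/-- The local picture of a configuration is in the position set. -/
structure InvS (i : ℕ) (X : XS) (q : Fin 4) (a : Bool) (l r : ℕ → Bool) : Prop where
  mid : ∀ s, (X.G q a).get i (l 0 :: l 1 :: r 0 :: r 1 :: s) = true
  left : ∀ k s, X.L.get i (l (k + 1) :: l (k + 2) :: s) = true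
  right : ∀ k s, X.R.get i (r (k + 1) :: r (k + 2) :: s) = true

theorem flip_G {i : ℕ} {X : XS} {q a b0 b1 c0 c1 s} :
    ((X.flip 1).G q a).get i (c0 :: c1 :: b0 :: b1 :: s) = true ↔
      (X.G q a).get i (b0 :: b1 :: c0 :: c1 :: s) = true := by
  have e : (X.flip 1).M = tmap (PT.tr 2 2) X.M := rfl
  rw [XS.G, XS.G, e]
  constructor
  · intro h
    have hl := lt_len_of_get h
    rw [tmap_len] at hl
    rwa [tmap_getD _ _ _ hl, PT.get_tr] at h
  · intro h
    rw [tmap_getD _ _ _ (lt_len_of_get h), PT.get_tr]; exact h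

theorem InvS_flip {i X q a l r} : InvS i (X.flip 1) q a r l ↔ InvS i X q a l r :=
  ⟨fun h => ⟨fun s => flip_G.1 (h.mid s), h.right, h.left⟩,
    fun h => ⟨fun s => flip_G.2 (h.mid s), h.right, h.left⟩⟩

def Sel.tgt (S : Sel) : Fin 4 → Tgt
  | 0 => S.ta
  | 1 => S.tb
  | 2 => S.tc
  | 3 => S.td

def Tgt.at (t : Tgt) (w : Bool) : List ℕ := bif w then t.w1 else t.w0

theorem newMid_getD (S : Sel) (other : PT) (M : List PT) (q b) :
    (newMid 1 S other M).getD (eix q b) (.leaf 0) =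
      .node (PT.next b other 1 (psum ((S.tgt q).at false) (tmap (PT.drop 1) M) (PT.zero 0)))
        (PT.next b other 1 (psum ((S.tgt q).at true) (tmap (PT.drop 1) M) (PT.zero 0))) := by
  fin_cases q <;> cases b <;> rfl

def consS (w : Bool) (l : ℕ → Bool) : ℕ → Bool := fun k => Nat.rec w (fun k _ => l k) k

theorem stepR {i full : ℕ} (hf : full.testBit i = true) {S : Sel} {X : XS}
    (ho : (openR full 1 S X).testBit i = false) {q a l r} (h : InvS i X q a l r) {q' w}
    (h1 : (S.d.getD (eix q a) 0).testBit i = true)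
    (h2 : (((S.tgt q').at w).getD (eix q a) 0).testBit i = true) :
    InvS i X q' (r 0) (consS w l) (fun k => r (k + 1)) := by
  rw [openR, tb_lor, Bool.or_eq_false_iff] at ho
  refine ⟨?_, ?_, fun k => h.right (k + 1)⟩
  · intro s
    apply violL_false hf _ _ ho.2
    rw [newMid_getD, PT.get_node_cons]
    have key : (PT.next (r 0) X.R 1 (psum ((S.tgt q').at w) (tmap (PT.drop 1) X.M) (PT.zero 0))).get i
        (l 0 :: r 1 :: r 2 :: s) = true := by
      apply PT.get_next _ (h.right 0 s)
      apply PT.get_psum _ _ (eix q a) _ h2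
      have hm := h.mid (r 2 :: s)
      rw [tmap_getD _ _ _ (lt_len_of_get hm)]
      exact PT.get_drop hm
    cases w <;> exact key
  · intro k s
    cases k with
    | zero =>
      apply PT.viol_false hf _ _ ho.1
      exact PT.get_projL (PT.get_psum _ _ (eix q a) _ h1 (h.mid s)) s
    | succ k => exact h.left k s

theorem oct_list_getD (p : Ent → ℕ) (m : Mach) (q a) :
    ((m.oct p).list).getD (eix q a) 0 = p (m.get q a) := by
  fin_cases q <;> cases a <;> rfl

theorem sel_d (full : ℕ) (m : Mach) (dir : Ent → ℕ) (q a) :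
    (mkSel full m dir).d.getD (eix q a) 0 = dir (m.get q a) := oct_list_getD _ _ _ _

theorem sel_tgt {full i : ℕ} (hf : full.testBit i = true) (m : Mach) (dir : Ent → ℕ) (q a)
    (hd : (dir (m.get q a)).testBit i = true) {e : Ent} (he : m.get q a = e) :
    ((((mkSel full m dir).tgt (stOf (e.s0.testBit i) (e.s1.testBit i))).at (e.w.testBit i)).getD
      (eix q a) 0).testBit i = true := by
  rw [he] at hd
  rcases h0 : e.s0.testBit i <;> rcases h1 : e.s1.testBit i <;> rcases hw : e.w.testBit i <;>
    simp only [stOf, Sel.tgt, mkSel, mkTgt, Tgt.at, cond_true, cond_false, oct_list_getD, he, tb_land,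
      tb_xor, hf, h0, h1, hw, hd] <;> rfl

theorem single_get (i x : ℕ) (s : List Bool) : (PT.single x 2).get i (false :: false :: s) = x.testBit i := rfl

theorem cps_true {full i K : ℕ} (hf : full.testBit i = true) {m : Mach} (hm : NM (m.code i))
    (h : (cps full 1 K m).testBit i = false) : NH (dec (m.code i)) := by
  unfold cps at h
  set SR := mkSel full m Ent.r with hSR
  set SL := mkSel full m Ent.l with hSL
  set X := xiter 1 SR SL K (xinit full 1) with hX
  simp only [cpsBad, tb_lor, Bool.or_eq_false_iff] at h
  obtain ⟨⟨oR, oL⟩, hi, hh⟩ := h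
  simp only [notInit, tb_lor, Bool.or_eq_false_iff] at hi
  obtain ⟨i1, i2, i3⟩ := hi
  have hhalt : ∀ q a l r, InvS i X q a l r → dec (m.code i) (q, a) ≠ none := by
    intro q a l r hI hn
    have hu : (((m.undef full).list).getD (eix q a) 0).testBit i = true := by
      rw [Mach.undef, oct_list_getD, tb_xor, tb_lor, hf]
      have hNM := hm q a
      simp only [dec, decE, Mach.code, Ent.lane] at hn hNM
      revert hn hNM
      cases (m.get q a).r.testBit i <;> cases (m.get q a).l.testBit i <;> simp
    have h1 := anyHalt_false _ _ hh (eix q a) [l 0, l 1, r 0, r 1] hu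
    have h2 := hI.mid []
    rw [XS.G, h1] at h2; cases h2
  have hinv : ∀ t, ∃ l r : ℕ → Bool, (∀ k : ℕ, (run (dec (m.code i)) t (initCfg 0)).tape
      ((run (dec (m.code i)) t (initCfg 0)).head - 1 - k) = l k) ∧ (∀ k : ℕ,
      (run (dec (m.code i)) t (initCfg 0)).tape
      ((run (dec (m.code i)) t (initCfg 0)).head + 1 + k) = r k) ∧
      InvS i X (ent (run (dec (m.code i)) t (initCfg 0))).1 (ent (run (dec (m.code i)) t (initCfg 0))).2 l r := by
    intro t
    induction t with
    | zero =>
      refine ⟨fun _ => false, fun _ => false, fun _ => rfl, fun _ => rfl, ?_, ?_, ?_⟩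
      · intro s
        exact violL_false hf _ _ i3 0 _ hf
      · intro k s
        exact PT.viol_false hf _ _ i1 _ hf
      · intro k s
        exact PT.viol_false hf _ _ i2 _ hf
    | succ t ih =>
      obtain ⟨l, r, hl, hr, hI⟩ := ih
      rw [run_succ']
      generalize run (dec (m.code i)) t (initCfg 0) = c at *
      have hne := hhalt _ _ _ _ hI
      obtain ⟨x, hx⟩ := Option.ne_none_iff_exists'.1 hne
      rw [stepT_some hx]
      have hx' := hx
      simp only [dec, decE, Mach.code, Ent.lane] at hx'
      rcases hR : (m.get (ent c).1 (ent c).2).r.testBit i <;>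
        rcases hL : (m.get (ent c).1 (ent c).2).l.testBit i <;>
        simp only [hR, hL, cond_true, cond_false, reduceCtorEq, Option.some.injEq] at hx'
      · have hs := stepR hf oL (InvS_flip.2 hI) (by rw [hSL, sel_d]; exact hL)
          (sel_tgt hf m Ent.l (ent c).1 (ent c).2 hL rfl)
        rw [InvS_flip] at hs
        refine ⟨fun k => l (k + 1), consS ((m.get (ent c).1 (ent c).2).w.testBit i) r, ?_, ?_, ?_⟩
        rotate_left 2
        · have e2 : (app x c).tape (app x c).head = l 0 := by
            rw [← hx']
            simp only [app, Dir.move]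
            rw [Function.update_of_ne (by omega), ← hl 0]
            congr 1; push_cast; ring
          have e1 : (app x c).state = stOf ((m.get (ent c).1 (ent c).2).s0.testBit i)
            ((m.get (ent c).1 (ent c).2).s1.testBit i) := by rw [← hx']; rfl
          rw [ent, e1, e2]
          exact hs
        · intro k
          rw [← hx']
          simp only [app, Dir.move]
          rw [Function.update_of_ne (by omega), ← hl (k + 1)]
          congr 1; push_cast; ring
        · intro k
          rw [← hx']
          simp only [app, Dir.move]
          cases k with
          | zero => simp [consS]
          | succ k =>
            rw [Function.update_of_ne (by push_cast; omega)]
            show _ = r k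
            rw [← hr k]
            congr 1; push_cast; ring
      · have hs := stepR hf oR hI (by rw [hSR, sel_d]; exact hR)
          (sel_tgt hf m Ent.r (ent c).1 (ent c).2 hR rfl)
        refine ⟨consS ((m.get (ent c).1 (ent c).2).w.testBit i) l, fun k => r (k + 1), ?_, ?_, ?_⟩
        rotate_left 2
        · have e2 : (app x c).tape (app x c).head = r 0 := by
            rw [← hx']
            simp only [app, Dir.move]
            rw [Function.update_of_ne (by omega), ← hr 0]
            congr 1; push_cast; ring
          have e1 : (app x c).state = stOf ((m.get (ent c).1 (ent c).2).s0.testBit i)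
            ((m.get (ent c).1 (ent c).2).s1.testBit i) := by rw [← hx']; rfl
          rw [ent, e1, e2]
          exact hs
        · intro k
          rw [← hx']
          simp only [app, Dir.move]
          cases k with
          | zero => simp [consS]
          | succ k =>
            rw [Function.update_of_ne (by push_cast; omega)]
            show _ = l k
            rw [← hl k]
            congr 1; push_cast; ring
        · intro k
          rw [← hx']
          simp only [app, Dir.move]
          rw [Function.update_of_ne (by omega), ← hr (k + 1)]
          congr 1; push_cast; ring
  intro t
  obtain ⟨l, r, -, -, hI⟩ := hinv t
  exact hhalt _ _ _ _ hI

theorem cpsStage_true {d N N' K : ℕ} {m : Mach} {A : ℕ} {k : Mach → ℕ → Bool}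
    (h : cpsStage d N N' 1 K m A k = true) :
    ∃ m' A', k m' A' = true ∧ A' ≤ lowMask N' ∧ (AllG m' A' → AllG m A) := by
  obtain ⟨h0, h⟩ := brec_true h
  obtain ⟨m', A', h1, h2, h3⟩ := pack_true h
  refine ⟨m', A', h1, h2, fun g i hi => ?_⟩
  have hf : (lowMask N).testBit i = true := by
    rw [tb_lowMask]; exact decide_eq_true (lt_of_le_lowMask (ble_true h0) hi)
  by_cases hm : NM (m.code i)
  · by_cases hc : (cps (lowMask N) 1 K m).testBit i = true
    · obtain ⟨j, hj, e⟩ := h3.fwd i (by rw [tb_land, hi, hc]; rfl)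
      rw [← e]; exact g j hj
    · rw [Bool.not_eq_true] at hc
      exact Good_of_NH (cps_true hf hm hc)
  · exact Good_of_mark hm

theorem chunk_true {v : Ck} {cs out : List ℕ} {k : Mach → ℕ → Bool} (hv : ∀ u ∈ v.vs, 0 < u.W)
    (h : chunk v cs out k = true) (hout : ∀ c ∈ out, Good (codeOf c)) :
    ∃ m A, k m A = true ∧ (AllM m A → ∀ c ∈ cs, GoodM (codeOf c)) := by
  obtain ⟨m, A, h1, -, h2, -⟩ := withCodes_true h
  obtain ⟨mh, ah, mq, aq, h3, h4⟩ := levels_true _ hv h1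
  obtain ⟨h5, h6⟩ := andB_true h3
  obtain ⟨m1, A1, h7, -, g1⟩ := cpsStage_true h6
  obtain ⟨m2, A2, h8, -, g2⟩ := cycStage_true (by norm_num) h7
  refine ⟨mh, ah, h5, fun hM c hc => ?_⟩
  have hG : AllG mq aq := g1 (g2 (fun i hi => by
    obtain ⟨c, hc, e⟩ := isCodes_true h8 i hi
    rw [e]; exact hout c hc))
  obtain ⟨j, hj, e⟩ := h2 c hc
  rw [← e]; exact (h4 hM hG).1 j hj

end BB4

namespace BB4

/-! ## Finite automata reduction -/

theorem bitB_eq (x i : ℕ) : bitB x i = x.testBit i := by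
  have h : Nat.land (Nat.shiftRight x i) 1 = (x.testBit i).toNat := by
    show (x >>> i) &&& 1 = _
    rw [Nat.and_one_is_mod, Nat.testBit, Nat.and_comm, Nat.and_one_is_mod]
    rcases Nat.mod_two_eq_zero_or_one (x >>> i) with h | h <;> rw [h] <;> rfl
  unfold bitB
  rw [h]
  cases x.testBit i <;> rfl

theorem allN_true {p : ℕ → Bool} {n : ℕ} (h : allN p n = true) : ∀ i < n, p i = true := by
  induction n with
  | zero => intro i hi; omega
  | succ n ih =>
    have h' : Bool.rec (motive := fun _ => Bool) false (allN p n) (p n) = true := h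
    obtain ⟨h1, h2⟩ := brec_true h'
    intro i hi
    rcases Nat.lt_succ_iff_lt_or_eq.1 hi with h3 | rfl
    · exact ih h2 i h3
    · exact h1

theorem brec_imp {b x : Bool} (h : Bool.rec (motive := fun _ => Bool) true x b = true) (hb : b = true) :
    x = true := by subst hb; exact h

theorem subB_true {x y : ℕ} (h : subB x y = true) {i : ℕ} (hi : x.testBit i = true) : y.testBit i = true := by
  have := beq_true h
  rw [← this, tb_lor, hi]; rfl

theorem iter_true {D : FD} {c L fuel : ℕ} {k : ℕ → ℕ → Bool} : ∀ {T U : ℕ}, D.iter c L fuel T U k = true →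
    ∃ T U, k T U = true := by
  induction fuel with
  | zero => intro T U h; cases h
  | succ n ih =>
    intro T U h
    simp only [FD.iter, force_eq] at h
    revert h
    generalize Nat.beq T _ = b1
    generalize Nat.beq U _ = b2
    intro h
    cases b1
    · exact ih h
    · cases b2
      · exact ih h
      · exact ⟨T, U, h⟩

theorem reach_true {D : FD} {T fuel : ℕ} {k : ℕ → Bool} : ∀ {S : ℕ}, D.reach T fuel S k = true →
    ∃ S, k S = true := by
  induction fuel with
  | zero => intro S h; cases h
  | succ n ih =>
    intro S h
    simp only [FD.reach] at h
    revert h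
    generalize Nat.beq S _ = b1
    intro h
    cases b1
    · exact ih h
    · exact ⟨S, h⟩

theorem tb_row (D : FD) (T X Y : ℕ) (hm : D.m = lowMask D.s) :
    (D.row T X).testBit Y = (decide (Y < D.s) && T.testBit (X * D.s + Y)) := by
  unfold FD.row
  rw [tb_land, hm, tb_lowMask, tb_shr, Bool.and_comm]; rfl

theorem SE_at (c : ℕ) (q : Fin 4) (a : Bool) :
    SE.at c q.val a.toNat = ⟨(stOf (codeOf c q a).s0 (codeOf c q a).s1).val, (codeOf c q a).w.toNat,
      (codeOf c q a).r, (codeOf c q a).l⟩ := by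
  have key : ∀ z < 32, (mkSE z).q = (stOf (Nat.testBit z 0) (Nat.testBit z 1)).val ∧
      (mkSE z).w = (Nat.testBit z 2).toNat ∧ (mkSE z).r = Nat.testBit z 3 ∧ (mkSE z).l = Nat.testBit z 4 := by
    decide
  unfold SE.at
  simp only [force_eq]
  set z := Nat.land (Nat.shiftRight c (Nat.mul 5 (Nat.add (Nat.mul 2 q.val) a.toNat))) 31 with hz
  have hz1 : z < 32 := lt_of_le_of_lt Nat.and_le_right (by norm_num)
  have hb : ∀ i < 5, z.testBit i = c.testBit (5 * (2 * q.val + a.toNat) + i) := by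
    intro i hi
    rw [hz, tb_land, tb_shr]
    have : Nat.testBit 31 i = true := by revert i; decide
    rw [this, Bool.and_true]; rfl
  obtain ⟨k1, k2, k3, k4⟩ := key z hz1
  rw [hb 0 (by omega), hb 1 (by omega)] at k1
  rw [hb 2 (by omega)] at k2
  rw [hb 3 (by omega)] at k3
  rw [hb 4 (by omega)] at k4
  generalize mkSE z = e at *
  obtain ⟨a1, a2, a3, a4⟩ := e
  subst k1 k2 k3 k4
  rfl

/-- The right automaton accepts a stream. -/
inductive Acc (D : FD) (T U : ℕ) : ℕ → (ℕ → Bool) → Prop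
  | here (r) : Acc D T U (4 * D.k) r
  | step {X Y : ℕ} {r : ℕ → Bool} : (D.row (bif r 0 then U else T) X).testBit Y = true →
      Acc D T U Y (fun j => r (j + 1)) → Acc D T U X r

/-- The left automaton reaches a state. -/
inductive LSt (D : FD) : ℕ → (ℕ → Bool) → Prop
  | blank : LSt D 0 (fun _ => false)
  | cons {i : ℕ} {b : Bool} {l : ℕ → Bool} : LSt D i l → LSt D (D.delta i b.toNat) (consS b l)

theorem tail_consS (b l) : (fun j => consS b l (j + 1)) = l := rfl

theorem okL_true {D : FD} {T U V g s q : ℕ} {b : Bool} (h : D.okL T U V g b.toNat s q = true) (i : ℕ) (hi : i < D.k)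
    (Y) (hY : Y < D.s) (h1 : (D.row (bif b then U else T) (D.ix s i)).testBit Y = true) (Z)
    (h2 : (D.row V Y).testBit Z = true) : (D.row g (D.ix q (D.delta i b.toNat))).testBit Z = true := by
  have h3 := allN_true h i hi
  simp only [force_eq] at h3
  have h4 := allN_true h3 Y hY
  rw [bitB_eq] at h4
  refine subB_true (brec_imp h4 ?_) h2
  cases b <;> exact h1

theorem ok_NH {D : FD} {c T U S : ℕ} (hs : D.s = 4 * D.k + 1) (hm : D.m = lowMask D.s)
    (h : D.ok c T U S = true) (hNM : NM (codeOf c)) : NH (dec (codeOf c)) := by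
  unfold FD.ok at h
  obtain ⟨c1, h⟩ := andB_true h
  obtain ⟨c2, h⟩ := andB_true h
  obtain ⟨c3, h⟩ := andB_true h
  obtain ⟨c4, h⟩ := andB_true h
  obtain ⟨c5, h⟩ := andB_true h
  obtain ⟨c6, h⟩ := andB_true h
  obtain ⟨c7, h⟩ := andB_true h
  obtain ⟨c8, c9⟩ := andB_true h
  rw [bitB_eq] at c1 c2 c4 c5
  have c3' := beq_true c3
  have c2' : S.testBit (4 * D.k) = false := by
    rcases hb : S.testBit (4 * D.k) with _ | _
    · rfl
    · have hb' : S.testBit (Nat.mul 4 D.k) = true := hb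
      rw [hb'] at c2; cases c2
  have hk : 0 < D.k := by
    rcases Nat.eq_zero_or_pos D.k with h0 | h0
    · rw [h0] at c2'; rw [c2'] at c1; cases c1
    · exact h0
  have hd : ∀ i < D.k, ∀ b : Bool, D.delta i b.toNat < D.k := by
    intro i hi b
    obtain ⟨h1, h2⟩ := andB_true (allN_true c6 i hi)
    cases b
    · exact ble_true h1
    · exact ble_true h2
  have hE : ∀ (q : Fin 4) (a : Bool), D.okE T U (bif a then U else T) q.val ⟨(stOf (codeOf c q a).s0 (codeOf c q a).s1).val, (codeOf c q a).w.toNat,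
      (codeOf c q a).r, (codeOf c q a).l⟩ = true := by
    intro q a
    rw [← SE_at]
    cases a
    · exact allN_true c8 q.val q.isLt
    · exact allN_true c9 q.val q.isLt
  have hix : ∀ (q : Fin 4) i, i < D.k → D.ix q.val i < 4 * D.k := by
    intro q i hi
    show q.val * D.k + i < 4 * D.k
    have : q.val * D.k ≤ 3 * D.k := Nat.mul_le_mul_right _ (by omega)
    omega
  have hH : ∀ b : Bool, (D.row (bif b then U else T) (4 * D.k)).testBit (4 * D.k) = true := by
    intro b
    rw [tb_row _ _ _ _ hm]
    have : decide (4 * D.k < D.s) = true := by simp [hs]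
    rw [this, Bool.true_and]
    cases b
    · exact c4
    · exact c5
  have hrow : ∀ {T X Y}, (D.row T X).testBit Y = true → Y < D.s := by
    intro T X Y h
    rw [tb_row _ _ _ _ hm] at h
    simp at h; exact h.1
  have hLk : ∀ i l, LSt D i l → i < D.k := by
    intro i l h
    induction h with
    | blank => exact hk
    | cons _ ih => exact hd _ ih _
  have hLt : ∀ i l, LSt D i l → ∃ j, LSt D j (fun n => l (n + 1)) ∧ i = D.delta j (l 0).toNat := by
    intro i l h
    cases h with
    | blank => exact ⟨0, .blank, c3'.symm⟩
    | cons h => exact ⟨_, h, rfl⟩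
  have hcons : ∀ r : ℕ → Bool, consS (r 0) (fun n => r (n + 1)) = r := by
    intro r; funext n; cases n <;> rfl
  have hstep : ∀ (q : Fin 4) (a : Bool) (i : ℕ) (l r : ℕ → Bool), LSt D i l →
      ¬ Acc D T U (D.ix q.val i) (consS a r) →
      (∃ q' w, dec (codeOf c) (q, a) = some (q', w, .right) ∧
        ¬ Acc D T U (D.ix q'.val (D.delta i w.toNat)) r) ∨
      (∃ q' w j, dec (codeOf c) (q, a) = some (q', w, .left) ∧ LSt D j (fun n => l (n + 1)) ∧
        ¬ Acc D T U (D.ix q'.val j) (consS (l 0) (consS w r))) := by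
    intro q a i l r hl hA
    have he := hE q a
    have hnm := hNM q a
    have hik := hLk _ _ hl
    simp only [dec, decE]
    generalize codeOf c q a = e at *
    obtain ⟨s0, s1, w, er, el⟩ := e
    have hst : ∀ (X Y : ℕ), (D.row (bif a then U else T) X).testBit Y = true → Acc D T U Y r →
      Acc D T U X (consS a r) := fun X Y h1 h2 => .step (r := consS a r) h1 h2
    have hbit : ∀ Y, Y < D.s → bitB (bif a then U else T) (D.ix q.val i * D.s + Y) = true →
        (D.row (bif a then U else T) (D.ix q.val i)).testBit Y = true := by
      intro Y hY h
      rw [bitB_eq] at h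
      rw [tb_row _ _ _ _ hm, h]; simp [hY]
    cases er <;> cases el
    · exfalso
      have h1 := allN_true (show allN _ _ = true from he) i hik
      exact hA (hst _ _ (hbit (4 * D.k) (by omega) h1) (.here r))
    · right
      obtain ⟨h0, h1⟩ := andB_true (show andB _ _ = true from he)
      obtain ⟨j, hj, hij⟩ := hLt _ _ hl
      refine ⟨stOf s0 s1, w, j, rfl, hj, ?_⟩
      intro hacc
      apply hA
      have hjk := hLk _ _ hj
      have hV : (Bool.rec T U (Nat.beq w.toNat 1) : ℕ) = bif w then U else T := by cases w <;> rfl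
      have hok : D.okL T U (bif w then U else T) (bif a then U else T) (l 0).toNat (stOf s0 s1).val q.val = true := by
        rw [← hV]
        cases l 0
        · exact h0
        · exact h1
      generalize hX : D.ix (stOf s0 s1).val j = X at hacc
      have hXn : X ≠ 4 * D.k := by rw [← hX]; exact (hix _ _ hjk).ne
      generalize hR : consS (l 0) (consS w r) = R at hacc
      cases hacc with
      | here => exact absurd rfl hXn
      | step g1 g2 =>
        rename_i Y
        subst hR
        subst hX
        have g2' : Acc D T U Y (consS w r) := g2
        have g3 : ∃ Z, (D.row (bif w then U else T) Y).testBit Z = true ∧ Acc D T U Z r := by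
          generalize hR : consS w r = R at g2'
          cases g2' with
          | here => exact ⟨_, hH w, .here r⟩
          | step g4 g5 => subst hR; exact ⟨_, g4, g5⟩
        obtain ⟨Z, g4, g5⟩ := g3
        rw [hij]
        exact hst _ _ (okL_true hok j hjk Y (hrow g1) g1 Z g4) g5
    · left
      refine ⟨stOf s0 s1, w, rfl, ?_⟩
      have h1 := allN_true (show allN _ _ = true from he) i hik
      intro hacc
      have h2 := hix (stOf s0 s1) _ (hd i hik w)
      exact hA (hst _ _ (hbit (D.ix (stOf s0 s1).val (D.delta i w.toNat)) (by omega) h1) hacc)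
    · cases hnm
  have hinit : ∀ X r, Acc D T U X r → (∀ n, r n = false) → X < D.s → S.testBit X = true → False := by
    intro X r h
    induction h with
    | here r => intro _ _ h; rw [c2'] at h; cases h
    | step g1 _ ih =>
      rename_i X Y r _
      intro hr hXs hX
      refine ih (fun n => hr (n + 1)) (hrow g1) ?_
      rw [hr 0] at g1
      have := allN_true c7 X hXs
      rw [bitB_eq] at this
      exact subB_true (brec_imp this hX) g1
  have hinv : ∀ t, ∃ (i : ℕ) (l r : ℕ → Bool), (∀ k : ℕ, (run (dec (codeOf c)) t (initCfg 0)).tape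
      ((run (dec (codeOf c)) t (initCfg 0)).head - 1 - k) = l k) ∧ (∀ k : ℕ,
      (run (dec (codeOf c)) t (initCfg 0)).tape
      ((run (dec (codeOf c)) t (initCfg 0)).head + 1 + k) = r k) ∧ LSt D i l ∧
      ¬ Acc D T U (D.ix (ent (run (dec (codeOf c)) t (initCfg 0))).1.val i)
        (consS (ent (run (dec (codeOf c)) t (initCfg 0))).2 r) := by
    intro t
    induction t with
    | zero =>
      refine ⟨0, fun _ => false, fun _ => false, fun _ => rfl, fun _ => rfl, .blank, ?_⟩
      intro h
      have h0 : D.ix (ent (run (dec (codeOf c)) 0 (initCfg 0))).1.val 0 = 0 := by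
        show 0 * D.k + 0 = 0
        omega
      rw [h0] at h
      refine hinit _ _ h ?_ (by omega) c1
      intro n; cases n <;> rfl
    | succ t ih =>
      obtain ⟨i, l, r, hl, hr, hL, hA⟩ := ih
      rw [run_succ']
      generalize run (dec (codeOf c)) t (initCfg 0) = C at *
      rcases hstep _ _ _ _ _ hL hA with ⟨q', w, hx, hA'⟩ | ⟨q', w, j, hx, hj, hA'⟩
      · rw [stepT_some hx]
        refine ⟨_, consS w l, fun n => r (n + 1), ?_, ?_, .cons hL, ?_⟩
        · intro k
          simp only [app, Dir.move]
          cases k with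
          | zero => simp [consS]
          | succ k =>
            rw [Function.update_of_ne (by push_cast; omega)]
            show _ = l k
            rw [← hl k]
            congr 1; push_cast; ring
        · intro k
          simp only [app, Dir.move]
          rw [Function.update_of_ne (by omega), ← hr (k + 1)]
          congr 1; push_cast; ring
        · have e2 : (ent (app (q', w, .right) C)).2 = r 0 := by
            simp only [ent, app, Dir.move]
            rw [Function.update_of_ne (by omega), ← hr 0]
            congr 1; push_cast; ring
          rw [e2, hcons]; exact hA'
      · rw [stepT_some hx]
        refine ⟨j, fun n => l (n + 1), consS w r, ?_, ?_, hj, ?_⟩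
        · intro k
          simp only [app, Dir.move]
          rw [Function.update_of_ne (by omega), ← hl (k + 1)]
          congr 1; push_cast; ring
        · intro k
          simp only [app, Dir.move]
          cases k with
          | zero => simp [consS]
          | succ k =>
            rw [Function.update_of_ne (by push_cast; omega)]
            show _ = r k
            rw [← hr k]
            congr 1; push_cast; ring
        · have e2 : (ent (app (q', w, .left) C)).2 = l 0 := by
            simp only [ent, app, Dir.move]
            rw [Function.update_of_ne (by omega), ← hl 0]
            congr 1; push_cast; ring
          rw [e2]; exact hA'
  intro t
  obtain ⟨i, l, r, hl, hr, hL, hA⟩ := hinv t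
  rcases hstep _ _ _ _ _ hL hA with ⟨q', w, hx, hA'⟩ | ⟨q', w, j, hx, hj, hA'⟩
  · exact fun h => Option.some_ne_none _ (hx.symm.trans h)
  · exact fun h => Option.some_ne_none _ (hx.symm.trans h)

theorem codeOf_congr {x y : ℕ} (h : ∀ i < 40, x.testBit i = y.testBit i) : codeOf x = codeOf y := by
  funext q a
  have h1 : 5 * (2 * q.val + a.toNat) + 4 < 40 := by
    have := q.isLt
    cases a <;> simp <;> omega
  unfold codeOf
  simp only
  rw [h _ (by omega), h _ (by omega), h _ (by omega), h _ (by omega), h _ (by omega)]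

theorem tb_mir (c : ℕ) : ∀ j < 8, (mirC c).testBit (5 * j) = c.testBit (5 * j) ∧
    (mirC c).testBit (5 * j + 1) = c.testBit (5 * j + 1) ∧ (mirC c).testBit (5 * j + 2) = c.testBit (5 * j + 2) ∧
    (mirC c).testBit (5 * j + 3) = c.testBit (5 * j + 4) ∧ (mirC c).testBit (5 * j + 4) = c.testBit (5 * j + 3) := by
  have key : ∀ j < 8, (Nat.testBit 283744936200 (5 * j - 1) = false ∧ Nat.testBit 283744936200 (5 * j) = false ∧
    Nat.testBit 283744936200 (5 * j + 1) = false ∧ Nat.testBit 283744936200 (5 * j + 2) = false ∧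
    Nat.testBit 283744936200 (5 * j + 3) = true) ∧ (
    Nat.testBit 567489872400 (5 * j + 1) = false ∧ Nat.testBit 567489872400 (5 * j + 2) = false ∧
    Nat.testBit 567489872400 (5 * j + 3) = false ∧ Nat.testBit 567489872400 (5 * j + 4) = true ∧
    Nat.testBit 567489872400 (5 * j + 5) = false) ∧
    Nat.testBit 248276819175 (5 * j) = true ∧ Nat.testBit 248276819175 (5 * j + 1) = true ∧
    Nat.testBit 248276819175 (5 * j + 2) = true ∧ Nat.testBit 248276819175 (5 * j + 3) = false ∧
    Nat.testBit 248276819175 (5 * j + 4) = false := by decide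
  intro j hj
  obtain ⟨⟨a1, a2, a3, a4, a5⟩, ⟨b1, b2, b3, b4, b5⟩, d1, d2, d3, d4, d5⟩ := key j hj
  unfold mirC
  simp only [tb_lor, tb_shl, tb_shr, tb_land]
  refine ⟨?_, ?_, ?_, ?_, ?_⟩
  · rw [d1, a1, show 1 + 5 * j = 5 * j + 1 by ring, b1]; simp
  · rw [d2, show 5 * j + 1 - 1 = 5 * j by omega, a2, show 1 + (5 * j + 1) = 5 * j + 2 by ring, b2]; simp
  · rw [d3, show 5 * j + 2 - 1 = 5 * j + 1 by omega, a3, show 1 + (5 * j + 2) = 5 * j + 3 by ring, b3]; simp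
  · rw [d4, show 5 * j + 3 - 1 = 5 * j + 2 by omega, a4, show 1 + (5 * j + 3) = 5 * j + 4 by ring, b4]; simp
  · rw [d5, show 5 * j + 4 - 1 = 5 * j + 3 by omega, a5, show 1 + (5 * j + 4) = 5 * j + 5 by ring, b5]; simp

theorem codeOf_mir (c : ℕ) (q a) : codeOf (mirC c) q a =
    ⟨(codeOf c q a).s0, (codeOf c q a).s1, (codeOf c q a).w, (codeOf c q a).l, (codeOf c q a).r⟩ := by
  have h1 : 2 * q.val + a.toNat < 8 := by
    have := q.isLt
    cases a <;> simp <;> omega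
  obtain ⟨h0, h1, h2, h3, h4⟩ := tb_mir c _ h1
  unfold codeOf
  simp only [h0, h1, h2, h3, h4]

theorem dec_mir (c : ℕ) : dec (codeOf (mirC c)) = rel 1 true (dec (codeOf c)) := by
  funext ⟨q, a⟩
  simp only [dec, rel, codeOf_mir]
  show _ = (decE (codeOf c q a)).map _
  generalize codeOf c q a = e
  obtain ⟨s0, s1, w, r, l⟩ := e
  cases r <;> cases l <;> rfl

theorem farOk_good {x : ℕ} (h : farOk x = true) : Good (codeOf x) := by
  by_cases hNM : NM (codeOf x)
  swap
  · exact Good_of_mark hNM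
  apply Good_of_NH
  have hc : codeOf x = codeOf (Nat.land x (lowMask 40)) := by
    apply codeOf_congr
    intro i hi
    rw [tb_land, tb_lowMask]; simp [hi]
  rw [hc] at hNM ⊢
  unfold farOk at h
  simp only [force_eq] at h
  unfold FD.run at h
  obtain ⟨T, U, h⟩ := iter_true h
  obtain ⟨S, h⟩ := reach_true h
  revert h
  cases bitB x 40
  · intro h
    exact ok_NH rfl rfl h hNM
  · intro h
    have h1 := ok_NH rfl rfl h (by
      intro q a
      show ((codeOf (mirC _) q a).r && (codeOf (mirC _) q a).l) = false
      rw [codeOf_mir, Bool.and_comm]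
      exact hNM q a)
    have h2 : NH (dec (codeOf (mirC (Nat.land x (lowMask 40))))) := h1
    rw [dec_mir] at h2
    exact NH_rel rfl h2

theorem allL_true {p : ℕ → Bool} {l : List ℕ} (h : allL p l = true) : ∀ x ∈ l, p x = true := by
  induction l with
  | nil => intro x hx; cases hx
  | cons y l ih =>
    obtain ⟨h1, h2⟩ := brec_true (show Bool.rec (motive := fun _ => Bool) false (allL p l) (p y) = true from h)
    intro x hx
    rcases List.mem_cons.1 hx with rfl | hx
    · exact h1
    · exact ih h2 x hx

theorem memB_true {x : ℕ} {l : List ℕ} (h : memB x l = true) : x ∈ l := by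
  induction l with
  | nil => cases h
  | cons y l ih =>
    have h' : Bool.rec (motive := fun _ => Bool) (memB x l) true (Nat.beq x y) = true := h
    rcases hb : Nat.beq x y with _ | _
    · rw [hb] at h'; exact List.mem_cons_of_mem _ (ih h')
    · rw [beq_true hb]; exact List.mem_cons_self

theorem decided_true {spec l : List ℕ} (h : decided spec l = true) (hs : ∀ x ∈ spec, Good (codeOf x)) :
    ∀ x ∈ l, Good (codeOf x) := by
  intro x hx
  have h1 := allL_true h x hx
  revert h1
  cases Nat.beq (Nat.shiftRight x 40) 0
  · exact farOk_good
  · exact fun h1 => hs x (memB_true h1)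

end BB4

namespace BB4

/-! ## Data -/

/-- Machines with a late translated cycle. -/
def cycs : List ℕ :=
  [11320809741, 756573059757, 13208369741, 777407192685, 722238822669, 9215400333]

/-- The partial machines with two defined transitions more than the root. -/
def firsts : List ℕ :=
  [16792333, 17179885325, 595609613, 609885375501, 807469, 595613709, 609885379597, 18626573, 18254412813,
   25182797, 25773069, 629164045, 618500475917, 25186893, 25777165, 629168141, 618500480013, 824190989,
   19352529933, 824195085, 20132674573, 25769820781, 25770443789, 26407356429, 678604852237, 25769824877,
   25770447885, 26407360525, 678604856333, 25789736973, 845034826765, 824653658125, 845034830861, 803469,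
   673549, 671893517, 687195573261, 807565, 677645, 671897613, 687195577357, 21768205, 21475634189, 20986637,
   21474852621, 729827341, 747324328973, 807597, 729831437, 747324333069, 827336717, 847182310413, 22820877,
   22549380109, 25182925, 25904141, 763381773, 755939429389, 25187021, 25908237, 763385869, 755939433485,
   828385293, 23647497229, 828389389, 24427641869, 25769820909, 25770574861, 26541574157, 816043805709,
   25769825005, 25770578957, 26541578253, 816043809805, 25793931277, 849329794061, 824657852429,
   849329798157, 284429, 268458765, 274877931277, 327174157, 335007468557, 807213, 302798861, 309238455309,
   25182541, 25510925, 360728589, 343622568973, 805327181, 805655565, 360732685, 344402713613, 10762595341,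
   10762599437, 25769820525, 25770181645, 26138920973, 403726945293, 824633741677, 824634102797,
   825002842125, 403726949389, 25781348365, 25781352461, 415501, 402676493, 412316884749, 807341, 437016589,
   446677408781, 25182669, 25641997, 494946317, 481061522445, 805327309, 805786637, 494950413, 481841667085,
   15057562637, 15057566733, 25769820653, 25770312717, 26273138701, 541165898765, 824633741805, 824634233869,
   825137059853, 541165902861, 25785542669, 25785546765]

def part0 : List ℕ :=
  [24427641869, 755939429389, 402676493, 595613709, 828389389, 807597, 807469, 729827341, 803469, 25777165,
   673549, 10762595341, 25182797, 824190989]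

/-- Machines left over by the fast deciders, with certificates. -/
def rest0 : List ℕ :=
  [761982780016499181252012848205956860860706317, 20570942895886798293588269, 289362136054388749,
   289362323956160973, 2210448921133, 2903409775149, 60224603325212052175469, 19047165111448567830989,
   289362107136752653, 289362140349356045, 60445946240625803803373, 60445946240625770478125,
   156834486470708025805, 157374918993220225773, 289362324090145517, 1669228032878871772435559242253,
   157374919744679070733, 20632107687549764621326861, 2208196745709, 2212457174317,
   5802917124186084162755309, 2966224391469, 74112367976306465133, 3779924312717, 14869860771296215470299469,
   157374918988937054573, 14869644598514097369732461, 60445946238989510464877, 74364571207939250189,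
   3694175928973, 60289473174955737759245, 289361443449490797, 2212487518573, 289361443453685101,
   2212491712877, 15474310422506772673972237, 1130311423744525, 60445946239470580291597,
   20628565624457579824961549, 577593264891779565, 289360691864262925, 289360691868457229, 3632183884813,
   289362134980123181, 289362530077658669, 2214776556077, 2561545720493, 289362139275090477, 2886605296301,
   15172078967603329420971565, 60432111180931958091437, 1131416310274797, 60298408316301768120653,
   4055234924077, 157374918984638777901, 2637047520780562693644139533, 60441352568062402148365,
   20628565624456484613380109, 2543007912621, 74400599922039313069, 2543142523565, 2543142130349,
   5482825185793116442515949, 2561243730605, 152763232970509699437, 2698683077293, 2698682684077,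
   2217860258253, 74400599837363622573, 60298408315540488116237, 577593262748522861, 60224909570034116185101,
   157392933802846278669, 1130726958912525, 2680446866093, 4913780024607808439173773,
   37936631042220778641901, 2680581083821, 289362311964580205, 60298696546152301024749, 2561377948333,
   4913780024607897506235021, 2698816901805, 2841406095053, 19047165111036247890541, 3917803307597,
   289360973360283213, 3960363113197, 3307781575341, 60298408315207800864333, 2532529159757,
   108212465301908052332635169868365, 3930993214029, 2490598250509, 156834486548305528845,
   289360683275377229, 157374918985712650829, 2493815019533, 60298408315813349541901, 289360694011615885,
   20632107687549769986890093, 289360694011615501, 2601158458669, 289360694011615629,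
   60224585311809931002509, 3930993312333, 60440794121013792484941, 577593685832646221, 1130322323717709,
   2556092307469, 577593685835332621, 157392933802879833101, 1131067364888045, 1130726992466957,
   289361103148373005, 156834486608143538797, 289361308326152205, 60224585310725783144461,
   289362480541981293, 2738657182285, 60436470667224731339789, 157374918502901175789,
   4048450936890631723617343821, 3632053992461, 157374919752721845869, 156834486677159693933, 3937420038829,
   3320666401389, 4075948363373, 3320604547693, 3320800619117, 20632107687549764621326957,
   60432129197175019621997, 148151546129961014893, 20632107687550045938767885, 157374918984571798093,
   156834486582665267213, 60445946240832161336653, 60224585311548193882765, 19047165111438041038445,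
   19047165111414441785965, 4055095463565, 157374919731884739981, 157374919731888934285, 577593685832646253,
   289362543074659341, 19664243595231617452726285, 1131067398442477, 289362244453121581, 3000527072269,
   2970620022061, 2863089599053, 289361342685890573, 289360969966540813, 289360969970735117,
   289361385242344461, 74364570079513137837, 4075945217645, 157374918997515192941, 60440794121690249833069,
   19047165111438108147309, 19047165111414508894829, 157374919731887885709, 74364570231803040429,
   289362551015526029, 60445694039310943435789, 74364570665830632173, 289361795518650925,
   157122718107333639181, 289361795748211341, 20575443901441354822343309, 1131419668859533,
   289361795882429069, 1132174866927277, 60298408315193677601421, 1131411074730637,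
   20632107687549764621326989, 1131413226408589, 289362551023914637, 289362551026011789, 289362551028108941,
   289362551030206093, 148151546960671984269, 156834486286270579341, 19047165111080518664845,
   156834486278754386573, 2564111553069, 2564111684141, 156834486608112075405, 20628565624456144237123949,
   19047165111414159786637, 14869860771295799943747597, 59251555590801091576397, 156834486608104735373,
   2214446092845, 2214446223917, 60224585310572989076141, 289361377045628941, 2680450142893,
   156834486402088125069, 3632188079117, 152763232967254852173, 60224585310457138238125, 2564599304877,
   156834486423542022797, 289362134980123309, 289362495861566061, 20575443901441666271853581,
   289362139275090605, 60298408316306063087949, 60298408315905557387661, 3320666401453, 289361007610969773,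
   1132153661705901, 20632241120200266005040813, 157374919731519639213, 157374918984638906957,
   157392932594856406029, 289362461236452077, 156834487329701091981, 60284861488970664101901,
   60445946240832228445517, 289360697237035341, 577595105431801229, 74364571413154941965,
   60298408315540488247309, 157374918988933743181, 60224909570034248994157, 5482825185794960996879693,
   2936323557389, 2936327751693, 289362311964711277, 156834485934132647405, 2222932573645, 2979209956685,
   2979209956813, 156834486677158972813, 1132177022832333, 60298696546934547274445, 156834487044087798413,
   577594373139909357, 97435026373951813547562428481069, 3307785769645, 4075944165965, 157374918988932598477,
   2689236424717, 5482825185793404213647373, 2208193567437, 157374918400379214541, 2208196942317,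
   4073786294925, 4074078978701, 577595126205173453, 289362461237500653, 577594370995571405,
   289361784075539117, 156834487329702140557, 2498109986829, 289362175890308621, 289362175924386829,
   289362175756091053, 2955663427949, 74364569568323950925, 60298372288242209211021, 1131833941769773,
   3711611552333, 60436470666138134915085, 2556092438541, 157122718165779884429, 60445405808133905533325,
   2693531392013, 2212487715309, 2212491909613, 2518882421394417041101, 1338290801752918112973,
   157122718174370244621, 1132167359155917, 148151545854572583277, 59251555589299484743693,
   14869860771296221912881485, 152763233729999490797, 4055242264109, 60445405807796818038125, 4055062269325,
   1132174875348717, 1132174863814381, 1132174868008685, 577595128349511405,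
   66324572984697568665343523713433133, 3941715006125, 60298408315193677601517, 20632107687549764621327085,
   148151546129961015021, 157374918984706015821, 60298696546668256156141, 19047165111060151156461,
   3308990579341, 3608564679309, 1132174872202989, 1132174874300141, 1132174876397293, 1132174878494445,
   157122718108876060685, 1131419668892397, 4079153893005, 4079827078157, 1132178088185485, 4079832321037,
   289362554236818093, 4079166442797, 1132178398596109, 60441334552971317957933, 2980084763661,
   60298372287844240048781, 5482825185793116442712557, 19047165112228372299277, 289362175925435405,
   289362175757139501, 74112369466688945901, 156834486677234273677, 4054866022125, 60298372288242607869325,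
   156834486677227064717, 1132154164006541, 74400600205947227149, 577595118685834989, 73824139457936673805,
   4055242263981, 19047165111483285065261, 19047165111266309586669, 10336172774959832910543885,
   2498077146733, 5482825185793404209576973, 157374918993228843277, 289360691865311501, 289360691869505805,
   3312014613037, 2698899642381, 10336388947740839606769677, 2217855965677, 2733255186445, 2217860159981,
   2733259380749, 15172083579289189507947117, 20575443901440257354382925, 3941715005997,
   60298696547278141020909, 289360992519411725, 289360694011517293, 289360694015711597, 2699973384205,
   157374919270254233613, 3926104166957, 60298408316817923363373, 60298408316304928025197, 3307785769517,
   577593911130733293, 577593911131789773, 3307719645805, 20632107687548659729815885, 289362049220627053,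
   60298408316558299058733, 3780217917997, 157374919271327975437, 152763233252195942989, 289360969964443661,
   289360969968637965, 14869644598514690174498829, 2223337913933, 2222935260749, 289361314637436941,
   10336388947741360471161453, 4075932634733, 10336388947741360068508269, 157374919753365474317,
   157374919683639363597, 289362481228563021, 4075932634797, 157374919753427340301,
   20575443901441341937441421, 1131406783957645, 60298408315883015657485, 157374919675053623309,
   157374919675057817613, 289360696159000941, 289360696163195245, 20575443901441346232408717,
   1131411078924941, 289361787292494477, 60289473175325045446669, 157374918172742801901,
   20628565912688206231649293, 20570647747981367850908685, 4648847597389240685, 157374918379978381325,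
   2704268351501, 3597539037741, 2971634259981, 60298408315596322887949, 3779864416813, 289361180423903245,
   60445946239569442912269, 2826670725133, 37936631044082089872653, 60298408316305000388877,
   60298408315192603859213, 157374918984641825037, 60298408315193677601037, 2486302955533,
   157374919262740957197, 157374918988932598029, 157374918988936792333, 2489524181005, 157374918991084275981,
   2689235965965, 2490597922829, 157374919267035924493, 2208196483565, 2807408376845, 289361258632993517,
   1132174876396813, 289361474624968717, 289360983926004461, 3307719645485, 60298408315505062729741,
   2688659604109, 2688952287885, 2209199243917, 2508773343885, 152763232183456647181, 289361258634042093,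
   289361018285742701, 2551230976557, 60441334553654094805005, 3320302617165, 60432129197183610473485,
   2483077601293, 2551226651181, 2551226782253, 2218728608301, 2498071903853, 21472623726342323158029,
   519225667383974410667748001957901, 21472623727439129199181, 2886804461933, 2214433509933, 2214433641005,
   2830965692429, 60289473175288534030349, 74364571056538900749, 157374919388366096653,
   60298408315596320790797, 60298408315192603859341, 2556091979789, 2623741909005,
   14567629892853306327681293, 2212492597517, 289360687575456013, 60298408316296410454413, 2626963134477,
   2693530933261, 2628036876301, 2212487256557, 2212491450861, 2807412571149, 289361258637187821,
   577593926388825101, 289361478919936013, 289361121364957933, 3307719645613, 60298408315642501683213,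
   2213560998253, 2591521265677, 2213565192557, 2591525459981, 3312014612909, 2694604675085,
   10336388947740702167816205, 2213560998381, 2728960219149, 2213565192685, 2728964413453,
   289361258638236397, 3962012445640281157121200685, 1487179049037970185720140181545374223776781,
   2488953819693, 60289473174024162234925, 289361155724696173, 289362070560266253, 4054730624653,
   60224585310594342044301, 756198003373, 10336389235971420834781197, 5518242934416217941197453,
   2214345425485, 60224585310572976493229, 2680437428909, 2680437559981, 60224585311685263737485,
   2518882421178091684493, 60224044878617826251309, 60298120084816449264109, 157374918984638941677,
   2208197794285, 148151545848106826285, 2807414668301, 60289473173531828507181, 2218635153965,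
   2498076098157, 3962012445640280829984330285, 60284861489128512538637, 289362297624314445,
   60284861489128504150029, 60298408315707989809165, 6583004057827805838358072589, 157374919250927045101,
   2474481703405, 2474485897709, 60224585310366964597389, 60298696545856643942893, 289362049019626061,
   291756397229, 60298408315192600713709, 5518242934416002363376269, 60224585310444253336237, 2551714271917,
   2551714402989, 60298696545851280836621, 2490591729677, 157374918984638810605, 60224585311466467836557,
   2518882420958223090317, 60224044878626407830061, 60445405808452493138413, 4064134155853,
   20629746216077149403207949, 74364570094669183629, 22593227399742047431309, 2749365541517, 2216923810445,
   10336389235971736220252781, 157392932973015510029, 1132174862765805, 157122718107367160845,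
   74400600152555700813, 3629841233933, 148151546952082049677, 2221014303309, 289362210194111789,
   4071638811277, 4071931495053, 152763232613624660621, 3308987433613, 3608561533581, 152763232191016059533,
   4048450936890630614450199277, 3889195030213956781395925293, 289362554239896877, 3320604547373,
   2532529159469, 4068432170285, 7261018391798028804791373051744617059629, 289360683280619821,
   157392932594856012813, 3627109696141, 3308520817293, 74112369762150725645, 2209107794381,
   157392932594990296077, 2842764264483818596464563965100382917055501, 577593685832645933, 2532533353773,
   2566893092141, 1669228032878871773870069962765, 3769605963053, 325393227633175565, 1132175180614669,
   2532467653645, 60436740882049195785229, 2498170928141, 2523596046989, 2635609881613,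
   157699179742228890253, 74364571125179695757, 2508579357325, 157699179557759173261, 74364571134833967757,
   2566528188109, 60284861488618479831373, 289360691869505869, 60224044878892775066957, 2212628875821,
   78435825474049920013, 4878362275987656718700141, 14869860771295109524511341, 3307719711341, 2966325054925,
   157374919752720666157, 3320660181581, 19047165111094477308557, 78994271771743829005,
   60432111182776938941773, 156834486333430487373, 2680417830253, 3004685702157, 3004685107789,
   2964181044237, 5518306921558432267189261, 20628565624456136724076877, 14869644598513275990202701,
   2208196549101, 289360683280619853, 56890336319102037343245, 2212628875565, 2690807087757, 2691099771533,
   157374918985712650573, 37940918469403331283277, 11320809741, 2566792429133, 2841770999117, 2968476011533,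
   19047165111163230534989, 2979209952589, 289361041874239213, 289362186518387021, 577593685832645965,
   2532533353805, 577593685835070477, 1669228032878871773915230780749, 2212492597581,
   20575443901440772909579597, 5482825185794228940521069, 5518242934416438561520973,
   65251190927348740321754752817118893, 3307719711149, 148151545850243929581, 1130309274294829,
   19047165111094477307533, 157374918228593105389, 1130309274294573, 1130309274294605,
   60445694037410557807085, 2212624681453, 2212628875757, 289362134980122989, 10336172774959237993879917,
   20570942895886272223886893, 4897168731570439067811565, 2209107794285, 2209107794413,
   994304674993990395022086789709, 60298696545579477359341, 289360694011615597, 78435825475123661837,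
   2967398796749, 19047165111414174466701, 4648847700468455789, 157374918988924305997, 2600032945485,
   2597062267917, 2597061673549, 156834486677193248109, 156834486677226802541, 60445946240097792051565,
   19047165112582301764973, 148151546129961014637, 2208196581869, 157392932594856078349, 1132174878494061,
   2209202389645, 2508776489613, 157392932663709772813, 577593685835103245, 289360688642906861,
   2213561096557, 2213565290861, 2213561096685, 2213565290989, 289360689716648557, 289360689716648685,
   2214446088781, 2214446219853, 289360689716648429, 2592726304781, 152763232244525455853,
   74364570118108757389, 74364570152468888589, 1130906305051661, 4054860779149, 1130322322669133,
   289360996814379021, 3642749600397, 2218732896909, 3695832580749, 156834487638929300109,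
   289361292962775693, 3779993387661, 3833661604493, 19047165111437906820717, 19047165111414307568237,
   289361787093277293, 3311775859341, 2555526103693, 289361031225655949, 3964624650893,
   157374919731887623565, 3711342035597, 3731756761741, 2223338045005, 577593960709504397,
   577593960710552973, 10336388947740572310191117, 15187288308090982600689101, 2518882421439455807885,
   15187288308090858168272365, 60298408315596319742221, 156834486677226802573, 2223325462093,
   60298408315205488761229, 60298408316293189228941, 2979207199757, 2532530600973, 2692954571405,
   2209203438221, 2223327559245, 60445694037421191413133, 2487372568589, 20628565912687611310791021,
   157374918988933908845, 2212492761453, 74364569557555303789, 2223329656397, 156834485944867044749,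
   577593685832646029, 577593685835136013, 156834485944699993805, 2979211394061, 1130768866098189,
   2532534795277, 2223331753549, 2627085912077, 60298408315196895681005, 2669875838669, 2669607403213,
   289362134980123053, 20632107687550314374092813, 4068429123149, 3931472872077, 289362244587339309,
   74364570658180192877, 2969546280269, 20628565624457236224530765, 20632107687550417453307917,
   3780223156877, 2969546280397, 21412635779024636258957, 60298408316616449637389, 19047165111036247726701,
   2557250753197, 20632107687550451813046285, 2886601101997, 3322808717997, 3322617877037, 2955320578733,
   3769337725581, 3930993316525, 3768858300973, 14869860771295112745736941, 2557351416493,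
   20632107687550554892261389, 3770633537549, 3769928893005, 4055234923949, 3780032184973, 2669867449933,
   4075948363181, 3320604547501, 2532529159597, 289360961384929293, 4068432170413, 2498174958605,
   2694320997005, 2508778586765, 289360693782106669, 60284861488962074167309, 289361038117687853,
   289360698174460461, 289361042835231277, 20628565624456480318412813, 60298408315664805384749,
   2214405198381, 2210278232621, 60298408315709566865965, 2543138329261, 2543138329133,
   5482825185793631691985453, 2543137936045, 2558740779565, 2543138067117, 10299638998321713721490989,
   10299638998321690122238509, 2669870595661, 289360688452162093, 289361066041233965, 289360688642906765,
   2669870595789, 289361121174311469, 289361132617290285, 2213561096461, 2488442148877, 2213565290765,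
   2488446343181, 2213561096589, 2625881102349, 2213565290893, 2625885296653, 60298408315197859648045,
   2694030414381, 5482825185793552280146477, 2694388109997, 2694388109869, 2213366026797, 2694387716781,
   2213565290957, 2694387847853, 60298408315575838921261, 2590955098669, 2669871644365, 577593685832646061,
   2532533353901, 20575443901440590309939213, 289361098823882765, 1130792457000973, 289361103118850061,
   156834486608138295917, 60224585311694021444237, 2518882421188996874893, 2523730264717,
   2518882422273476117133, 2214438982189, 2661445650445, 2694030119469, 2661449844749, 2694030250541,
   60224585311685431509645, 2518882421178259456653, 156834486402080785037, 60224585311638274917005,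
   2669874790093, 2518882421130031219341, 2646018310797, 2518882422229529215629, 2556595655213,
   2210278003245, 2210278134317, 60224585311638266528397, 2518882421130021782157, 156834486416025830029,
   4913780024607816861374957, 1130597106367501, 2217856162285, 157122716969258212077,
   60298408315665034893965, 3780230136397, 60440794121484091402861, 2970620022221, 157374918377827490285,
   157374919752720797293, 21408348353972097465357, 1130321081227757, 152763232981164316109,
   60445946239584460357069, 2486303152141, 1130837617688013, 2490598119437, 2208193567181, 2208196680173,
   289360973257817101, 2209266227693, 2863013059309, 5802917124185861139417453, 157374918369237555949,
   2214446121549, 157374918369237555693, 2979209952717, 577593685832646093, 2532533353933,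
   577593685835201549, 156834485944700059341, 2867308026605, 21408348352177061450413, 156834486402087862925,
   19047165111208135574157, 156834486402080522893, 60298120084816448215533, 2210285628973,
   60298408315707996100621, 2971693763917, 2971693764045, 2474483800557, 2474487994861, 3632053861389,
   156834487546898230285, 157374918151271799277, 60298408315596322822637, 152763232382086040269,
   2729128317965, 3004920485901, 152763232156600257005, 157374917884981795309, 157374918675257121261,
   2208193436141, 152763232244512872941, 2208197630445, 152763232244517067245, 148151546129961014765,
   2208193567213, 157374918400379214317, 2208196712941, 2208197761517, 289360683280620013, 2221013254733,
   577593685835234317, 21408348352829292532397, 156834486423541760653, 74400598833435945997,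
   19047165111217789846157, 156834486416025567885, 156834486460231990989, 60298120084816448182765,
   60289473174955741953037, 289361430568783181, 78435825291608311821, 78435824722526128141,
   19047165111414184041197, 4054470381133, 289362137127606285, 156834487638916848269, 157374919731888671757,
   2863089593357, 157374919731888737293, 289362141422573581, 4079166475277, 4079159135245,
   156834486677225360781, 1132154172394509, 289360693441188397, 289360693701366317, 289360682715271725,
   289360949003375149, 157374919752732134413, 60298408315205484566541, 289361361882077197,
   60298408315192599664653, 2474483406861, 2474487601165, 157374918985715566605, 60298408316635704219661,
   60289473174635703195661, 2611922360333, 2611926554637, 157374918990010533901, 289362254662062637,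
   10336388947740254417475597, 289362254922240557, 1486132583818761770440708653, 289361782710555181,
   289362048998658605, 157374917884979993069, 1486132583818762030033490477, 157392932285752585229,
   60289473173532026358061, 152763232966580486733, 1132167362300941, 289361782797326349,
   19047165111094342598125, 157392932663575194637, 2532532304909, 157374918990010632205,
   156834486608124598893, 2199770453389, 577593685831597069, 156834486608124631789, 74364570015029541901,
   1130768867802125, 157374918990007486477, 152763232970875454029, 2213562144781, 2213566339085,
   157374918371388184589, 156834486367606528653, 2199340663437, 60289473173532034746861,
   152763231866689964525, 60289473173532026358253, 2532536499213, 2524367798925, 157374918976048744461,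
   3298556133965, 2199603402765, 2199607597069, 2199037235757, 2212982280749, 157374917876390058445]

def size0 : Ck := ⟨10, 14, [⟨14, 16, 10, 8, 125, 99⟩, ⟨125, 20, 10, 11, 1061, 939⟩, ⟨1061, 37, 12, 15, 6957, 10019⟩, ⟨6957, 106, 16, 17, 0, 80092⟩], 17, 91149, 14, 12000, 16, 3000⟩

def part1 : List ℕ :=
  [20986637, 25186893, 671893517, 729831437, 268458765, 25182925, 763385869, 494950413, 415501, 827336717,
   618500475917, 284429, 343622568973, 25182541]

/-- Machines left over by the fast deciders, with certificates. -/
def rest1 : List ℕ :=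
  [74364571041635260429, 15172083579289120528775757, 289361793502172909, 289362344867550925,
   74400600145513175789, 60298696547209161980493, 289362581460630221, 3848975895277, 2552836932301,
   5189279731886865005, 2690275885773, 345261807112995563668878645344877, 157374919319608511085,
   19047165111528155265517, 344315156845, 2210319028813, 2210310640205, 289361224251620013,
   19047165111276732627597, 19047165112376244255021, 289360691608271437, 1131792623321805,
   60445946239389110131053, 19047165111276732365453, 2518882421404806429293, 2693492916941, 2693497111245,
   156834486349506564685, 1130726924767821, 2557131899597, 2694570853069, 2213527671373,
   156834486383862108749, 3642623774221, 2214605476429, 60445946239389110131149, 157374919533689029325,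
   60445694039055529957869, 2213530817101, 2214581512749, 1130779706546733, 1130779710741037, 3897280678605,
   152763232975862880717, 152763233541729016269, 3900928447053, 3905223414349, 3892338512461, 3591688802893,
   74400599734497597805, 3896633479757, 15187288308090235217498701, 20632319825106272405207789,
   289360684055386765, 21486170554187322276589, 2794368641037, 2213568401997, 2795442513933,
   74400599837576812909, 157374918988798477005, 3896633578061, 289361258934032845, 2212496790093,
   2212487352909, 2212491547213, 74400599871936551277, 60224909569279378410029, 2700986591245,
   4913780024608997260024301, 3917656511053, 60224909569284743973485, 2518882421301987199597,
   2518882421314859551341, 289361797864248941, 156834486553632295597, 157374919604157532173,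
   157374919785595685229, 3917803311693, 3917803307725, 3917790728781, 3917795967693, 3935288185421,
   1130925656528589, 289362413576539725, 152763233583981973069, 3930993218125, 3930993214157,
   1130307068181069, 156834485929742160461, 148151547557568658029, 157374918494999927373, 289361293264405197,
   289361306223761421, 60298408315815541627245, 60298408316914919034221, 3930993316429, 3930993312461,
   157374918494999927213, 74400599838692988941, 1417543600244304252720724717, 289362186625043021,
   157374919408712403533, 152763232289741101421, 157392933802879242829, 156834486449479469645,
   157392933802879238861, 577593262777815629, 1130726991876685, 289361103147782733, 3848748481261,
   3768431659597, 156834486553732863565, 152763233589353797325, 3930990169677, 157392933837238981197,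
   157374919505349429837, 1130312524878413, 289361137503326797, 289361137507521101, 157374919457049561709,
   157374919510717778541, 2738657182029, 2218674076237, 1130312528024141, 289362447950960205,
   60289473174988389991117, 148151547604859472557, 1130917074982637, 3320734571117, 60298120085514884496109,
   3320738765421, 289362413576539757, 3307849669229, 157374919602409557613, 2552937595597,
   21486170554189469760237, 157374918537961134093, 1130960136820749,
   814721456644500661778841060269904112620263437, 157699180760593324653, 4896223011676399706036845,
   3848748514029, 3768431659629, 156834486677092587117, 152763232981169231597, 2557232562893,
   60431858981060332703341, 156834486264749512429, 2219034661453, 156834486402253477485,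
   156834486455921694317, 3320735619693, 3320769174125, 3938506264173, 10336389235971736420506221,
   3320724085357, 3320728279661, 289361795811138157, 3320660185677, 156834486595206141645,
   60445946240763409345133, 60445405807708747475565, 157374919663201602157, 3986414848621,
   156834486608211629645, 156834486628626355789, 40214803937129849838317, 56890660579741993913005,
   156834486460231992013, 74364570665797077741, 60445405807708681358061, 577594371052192461,
   289362486190458893, 577595036779594445, 74364570665789737709, 20632107687549015649696365,
   78976257293442239757, 157374919285252967021, 289362413584961165, 289362413587058317, 289362413589155469,
   289362413591252621, 18964154763507980878541, 5189279736181832301, 577595049969500877, 2508953469645,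
   19047165111252332593869, 2886932388205, 2886936582509, 60298408316970885077357, 156834486608112073357,
   289360984027024013, 1130826916971213, 157699180004611898093, 2213674472013, 2646392423117, 2213661889101,
   2213666083405, 156834486450568315597, 289360689527936589, 2886735282893, 289361039193429613,
   157122716311332835917, 2213665034829, 2213669229133, 2214581512877, 60445405807696847194477,
   4020740965069, 4020774586989, 73824139376027425517, 60298408315905691605389, 4041584427725,
   289361041608953517, 4028699525837, 3595983770189, 2474627285709, 3320300493549, 157374919285254015341,
   157374919705487557325, 148151547339460336365, 289360696976980557, 2831110491149, 60298408316695968668013,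
   1132133649729901, 2612066108109, 60432435441825562872845, 60298408315596457040365,
   19047165111448634940109, 289361236425986637, 756573059757, 4055104901709, 4055095464525, 4055100703437,
   157374919731888734925, 152763233734922491469, 21408348352939435644621, 289362551025981133,
   156834486608213007085, 4010047490061, 60445405807733354384077, 577595126852274925, 74364571283601280717,
   74400599805742337741, 156834486458069535437, 577594373106354925, 3667587812365, 74364570668037882573,
   4055229682253, 2518882421439455811981, 1132154172392141, 1132154173444685, 577594373099014893,
   1131063095482061, 4075944170061, 4075944166093, 60298372288112998272717, 156834486230255884909,
   3320301542125, 2886968066765, 156834486230255885037, 18964154763508047987405, 2831143980045,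
   1132167362298573, 156834487330002164429, 1131707462304461, 289362347384912621, 157374918632438880845,
   2955629873517, 2955656059245, 60298408315815541624173, 157374918632438880685, 60445405807777157599821,
   3917769887117, 3768431659725, 4069079402989, 1131844901257933, 1131844902310477, 156834486450553342669,
   2955629873645, 577595121483565805, 2612057037293, 2612061231597, 2955622533613, 2808327153677,
   152763233576163890797, 21408348352780677043949, 289361793737053933, 4011121231885, 1132037436395245,
   74400599805742337773, 73824139410387229293, 157374919594524167917, 4099167078413, 4113114122253,
   18903878586890229928525, 1130917209200365, 577594988764090093, 5482825185793114504680013,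
   1132037433249517, 74364571008720228077, 1132037435346669, 74364571008722325229, 3320801706317,
   1132037437443821, 74364571008724422381, 1132037424860909, 74364571008711839469, 1132037426958061,
   83623971842587676397, 157122718176821689069, 152763233600390188045, 3000527071245, 3701914195981,
   78976257281325944205, 152763233597639773197, 152763233597627190285, 157374919594591145357,
   152763233584754871309, 152763233589048691725, 3848748645101, 20227756733300216347373,
   156834487742084397805, 3917803179469, 2831179337197, 4048450936890631721410902605,
   19047165112376579578125, 156834487570514041101, 60298408315481331652621, 3906284573261,
   20613222833304874516765421, 60289473174641263792717, 14869860771296216350997069, 2217660928589,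
   74364570300657711597, 60298408316303051078221, 60298120085926899366221, 148151547582319282189,
   2218640527949, 289361292870271693, 3320669547117, 3320803764845, 60289473173544716479085,
   289362413582831213, 3307850717805, 3307853863533, 289360949306571341, 1568058563358511822805488205,
   74400599449897616077, 19047165112488248596493, 74400600102095143629, 289362049220631149,
   74400599716185719501, 60289473174917528146509, 20628565624457827293870701, 1131416008284909,
   3320723036781, 3320756591213, 289361795739828941, 289362447938372301, 289362461463954125,
   289362481228567117, 157374919602412473997, 157374919605231045645, 74364569565983423053,
   20632107687549050009434733, 20632107687549153088649837, 2214742741581, 14869860771296219706440269,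
   20632107687549187448388205, 60284861489235876924429, 60432111182309814160045, 20628565912686522603419981,
   60298408316307346045517, 21408348353903802207501, 289360698117732941, 1130890680580589,
   577594624462734029, 60445946239568803281517, 4967837749882216398267372109, 3582025126477,
   157374919606707440909, 1130307067853389, 20632107687548660878686797, 2508550816461, 3320302621261,
   74112367974167198285, 2886938679661, 2830674283533, 3307853863341, 3312148830637, 2645989769933,
   157374919560124942605, 20628565624457237373401677, 5482825185793861325634157, 2214345429581,
   60445694039055521569261, 5053994826828349970282232493, 5482825185793114336901709,
   20575660362454449774901869, 289362297624318541, 3822543557197, 2474426120877,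
   2024193476637144104136772930829, 2474615921133, 2474620115437, 289362049016484429, 289362049019630157,
   2474615527917, 2474619722221, 102826105661646329529616874951245, 60289473173813721420365, 2474615658989,
   2474619853293, 156834486195856069197, 152763232252843801197, 289360692883274317, 2532536500557,
   289362083505914573, 289362083539536493, 157374919285212136141, 2749533313677, 4011085572109,
   4011219789837, 1131419722367693, 1132209225646797, 157392932986602956813, 577594371051143885,
   1132085446492877, 577595160556520141, 157374919602412506765, 2529757084205, 577595047822017229,
   577594362372080333, 3627794417677, 3632089384973, 3618130741261, 157392932594990303245, 2831141882893,
   74364571283596037869, 83623971842591870701, 289362104349377229, 2508944949965, 3630345605709,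
   3630333022797, 2209078399565, 2213372279373, 2214446021197, 2555830029325, 2209278835277,
   289360983867570861, 289360999470447149, 2209379498573, 2508550822605, 2508945081037,
   60298408316592928045773, 60298408316592928045517, 2208976845389, 2209010399821, 2209111063117,
   5189279577402751693, 19047165111094342997485, 60445405808567701231949, 289360691809565261,
   74112369083409578573, 74112369083409578701, 289361087142648365, 148151547420129704685, 2564111552109,
   2565185585485, 60436470666745936370285, 2518882421095898897005,
   24955274598732981547320741343762504120810869185133, 156834486286270581389, 1131421444101741,
   19047165111094477310605, 156834486278754388621, 2841771003213, 156834486286270581453, 1132164812163085,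
   156834486278754388685, 289361018026179149, 5518242934416071283431821, 1131103615210061, 3004685107917,
   3004685107533, 2826806053901, 1130307067918925, 19047165112136061409613, 2543011281581,
   289361018428348781, 4648847656399295821, 2518882421267697654093, 2831101021197, 1338290800412847397197,
   60224585310504631130445, 20632038512260161208760941, 60224585310504633063853, 156834486264611199629,
   2543145597613, 20570937707741204314573837, 2612056644077, 2612060838381, 74112367976244499021,
   19047165111276735452621, 60445405807640018540909, 1131796921341517, 2508948095693, 2646387049165,
   148151547339656742925, 2831106296845, 2831108393997, 2831097908237, 2612056670925, 2831100005389,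
   2612060865229, 3694343473869, 3696513894413, 1130695991775821, 2597061673293, 3700808861709,
   3686850217997, 157392932663709779981, 289361087105190605, 1130930072046605, 289362403924397805,
   20632107687549280863927021, 3938509409645, 2886934485357, 2826806086669, 2832823864333, 2508651479757,
   4648847666053535085, 20575443901440865095145837, 2831101053965, 60436470665987545779213,
   4911418841366325481593197, 157699180004309908205, 2646090433229, 156834486608112073453, 2214446086733,
   2214446092877, 2214446223949, 2826480110605, 156834486471034919309, 19047165111276933626605,
   2217656865357, 2217661059661, 577593834142587373, 682539655956798380784237,
   172863636323433703551862565321453, 19047165111070808750829, 2218741086797, 19047165111123891862125,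
   289361292970834637, 1130930060155373, 2564111617645, 289361086745524813, 156834486608208484973,
   156834486608212679277, 74400599029078972781, 289361271127259629, 21408348352780677036525,
   577593911128636013, 577593912202377837, 346212545063166735720841678834701, 152763232201740900749,
   289361237135866605, 148151545852533783117, 289361087141626573, 156834486470740163309,
   682539655956798380620397, 577593696703633901, 2214446119501, 5131363718100444940079774381,
   157122716318911945101, 60298408315596495804909, 60445694037762038549901, 60298408315596495411693,
   13208369741, 60298408315596495477229, 60298408315596495542765, 20553234021576037154273933,
   60445946239574439123405, 3986187434733, 1338290800584349432461, 2564111650413, 2669975454029,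
   3745870402125, 3745857819213, 157374919422683433581, 60298408315630813567373, 3745863058125,
   3745896680045, 157374919422651089613, 156834486608208517869, 577595036773302989, 3763062950605,
   3767357917901, 1132168033388557, 3759841725133, 21408348352918116022765, 59251555590732368858861,
   3769928897101, 5482825185794837088320237, 74364570206000396909, 74364570205564615405, 3320734570925,
   3766706520781, 3320738765229, 3307849669037, 3754895364685, 3308927605165, 3312144636333, 3313222572461,
   289361789378124205, 157374919285245626989, 102823629819346690632634056653421,
   108212465301908052332637045772877, 108212465301908052332969909932621, 60224909570375439340109,
   2213573671501, 577593263864003149, 157374918323201235533, 156834487467432598157, 2646383903437,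
   2213668049485, 3767771976269, 156834487467432598189, 60298408316730366868173, 60298408316730366867917,
   2213373366861, 60298408316914751262061, 157374918323201235373, 682539655956660941667053,
   152763232284372392301, 60289473173949708786029, 157699180760593324461, 60224585310504631130541,
   156834486367649518157, 3986187303661, 2214446152269, 1338290800446910478989, 156834486367690414733,
   2213674465869, 156834486621701651053, 2645989776077, 156834487488952653837, 156834486367950461581,
   2213663986253, 2646384034509, 2213668180557, 60298408316730366999117, 60298408316730366999245,
   60298408316730366998989, 2213305367117, 2518882422229775571437, 60445405807467751266989,
   156834486367654761037, 60224585310538763287181, 19047165111448634939853, 156834486470775134669,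
   157374918323204544973, 156834486471034919373, 2626992227021, 2564111683181, 60445405807502522927725,
   3780230140493, 73824139170040693453, 289361342256667309, 156834486608212744941, 156834486608212998893,
   156834486230255876845, 156834486623247817453, 156834487742084397549, 289361155465132621,
   156834486230255622765, 19047165111139657275693, 10336388947740254214378061, 1130313275529805,
   2214345423437, 2214378977869, 2214446125645, 289361305957420045, 60298408316914784816493,
   10336388947740254210019917, 60298120086538923560397, 152763232285446134125, 3848748350189,
   156834486608212736749, 2680584551085, 156834486402088123021, 19047165112307658996013, 2214379108941,
   156834486402087860877, 289361033830087277, 152763232149084068429, 577593262780961357, 2628061774541,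
   2628065968845, 2518882421095899060845, 2508948226765, 2646387180237, 156834486458069273293,
   1130826984084045, 289361203139990093, 60298408316730366999149, 156834486450553080525,
   60298696547291232226797, 60298696547291234323949, 60298696547291223838189, 2831166754285, 2831170948589,
   156834487570515089677, 1130925512481261, 152763232485165259245, 5482825185793114504673869,
   21408348353536524540397, 60436470666747014306285, 152763232132981447149, 21408348353536517986797,
   2886733185741, 60298696546669539342925, 2209077508685, 2209211726413, 5802700951404995042889197,
   2518882421267697654253, 1130930063301101, 60298696547291226983917, 577593696706779629,
   1338290800412847397357, 1130711018363373, 60224585310538763451021, 156834486367954655981,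
   60224585310504633227693, 156834486367954655725, 157374918151405820365, 21408348353536519035341,
   2214446217805, 74400599837579958285, 60224909569278288972333, 1130313511643149, 3917031427661,
   157374918989953092173, 2214447360013, 157374919663189117549, 157374918985680013325, 157374919697548855661,
   2199771304525, 152763233576163888141, 289361791882121805, 20572118587590579550802509,
   152763233589353794573, 577594370290926285, 2199346559533, 2209174902797, 1131706723975885,
   157374918502898846733, 3930993314829, 157374918323204380685, 156834486607742909037, 1130711016823277,
   157374919422670948973, 60289473173536696029773, 156834487467440986125, 1131844162929357,
   156834487467434694669, 156834486367955703821, 157374918502900583917, 152763232132977940973,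
   60289473173798314334701, 157374918975994350157, 156834485921198265933, 156834486607721944685,
   3299229353997, 3298556138061, 1131397486265037]

def size1 : Ck := ⟨10, 14, [⟨14, 16, 10, 8, 134, 90⟩, ⟨134, 20, 10, 12, 1081, 1063⟩, ⟨1081, 37, 12, 15, 6968, 10328⟩, ⟨6968, 106, 16, 17, 0, 78922⟩], 17, 90403, 14, 12000, 15, 3000⟩

def part2 : List ℕ :=
  [755939433485, 481841667085, 22820877, 805327181, 344402713613, 16792333, 302798861, 15057562637, 677645,
   18626573, 25641997, 10762599437, 327174157, 629164045]

/-- Machines left over by the fast deciders, with certificates. -/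
def rest2 : List ℕ :=
  [2210319187501, 289362273264753677, 74112367976149171757, 156834486677020368269, 289362530077662765,
   289361040755023373, 147611114249223429645, 74364569903272320525, 289362277559720973, 289362277561818125,
   157392932778253245453, 60445694039062004608013, 4071955585037, 289360689424444941, 275403946509,
   289360689695632973, 60445405807725183875821, 2216594782893, 289361224248474285, 3797333793805,
   2761990097261, 60445405808670451186125, 289362530080808493, 2214613888589, 3318647116109,
   148151546640392535565, 4854902304952745573277197, 60445946239732536466733, 10299638998321999215222061,
   2214580465197, 3316307475181, 514390413220203502207125489507885, 2560471916077, 3320336177709,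
   157392933049169435661, 60224585311947680308781, 60224585310848157146669,
   28924700618981068356875873605722254451841482413, 1131900363824141, 3666443820045,
   20570942895886946635103981, 157374918993895996109, 289362358185999053, 4075944173101, 289360689424444973,
   3866869086221, 3866864891917, 3313921316589, 2518882422538644151853, 3694762022605, 157374919525499910701,
   60224585310107015523885, 156834487776544316813, 156834487776536976781, 5482825185794974015315309,
   156834486264883764781, 156834486677020270221, 2518882421439429271085, 156834486677024464557,
   19047165112591192611853, 156834486677024464301, 60224044878892776054221, 1130313510596141,
   1130828403355309, 20268706505038997304139341, 1131054447025549, 10336389235970630366089549, 2837116991501,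
   4075944173133, 289361430636223789, 2830709573997, 60298408315815407405421, 60298408315199076838989,
   401422692506914940245222435853, 60371618830741680827981, 3848745499213, 156834486608182330957,
   156834486608215885389, 2738657641485, 60298408315939958578669, 157374918503504562669, 2830709574125,
   4055100710445, 4055100710477, 4055100710605, 777407192685, 289362139259625069, 4075944173165,
   3320331913837, 289362139393842797, 4075948367469, 3320336108141, 15171876053417007079775853,
   2562732973069, 4055095467597, 60298408315939992526221, 289361376356740717, 60298408315939992264077,
   1131054514986381, 4055095467437, 4055100710317, 2749097106061, 4075945221741, 3320634952301,
   157374919662840990317, 74364570300679085453, 289361382797097581, 156834486264817760909,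
   156834486286270586509, 73824139187065609901, 4076250552333, 19047165111094477315725, 74364570665427978989,
   74364570665729968877, 148151546960571320973, 152763233734603324013, 156834487707921365741,
   156834486264812518029, 2214748106317, 157374919731690748525, 2214580596269, 19047165112582570172077,
   19047165112582558637741, 73824139187065642541, 157374918998190832333, 289362495494572653,
   73824139187065642637, 289362276519730189, 3666448014349, 4075944173229, 289362538142162605,
   289362538134822573, 60445405807776988847789, 3665440332813, 4077006413453, 4077679598605,
   157392933052797443373, 289362552092417325, 73824138345059114381, 289362540994288653,
   156834487364027569613, 3313925510893, 156834487386554127853, 156834486642506643821, 3699056989901,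
   5482825185794219988863661, 20570942895886751997910733, 20268706505038997304139469, 2979209960781,
   2979209960909, 289361447501683341, 156834486286270586573, 1131054581374349, 3666449062925,
   577594372737256173, 577594373039246061, 4075944173261, 152763233734908725261, 2214342635213,
   21408348354030347503885, 577594370592918221, 577594370894908109, 1131741817846413, 156834487570186091213,
   157392932630423723021, 2955260774765, 2955562764653, 152763233734606866445, 3848745499341,
   60224585311556917976781, 1132175180613645, 4076250548237, 289362304804335117, 2737718117389,
   4055242268205, 4055234928173, 3320331983597, 156834486423542029965, 60224585311947680308973,
   60224585310848157146861, 60224621339645213138317, 3666450111501, 60445946239341652860653,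
   289360689424445165, 157122718108098017901, 289362280108579853, 3667587816461, 1131419266239213,
   74364570665733114605, 4079153897101, 4079827082253, 289362554239901325, 4079832325133,
   19047165112329112902957, 156834487800662613293, 289362554239900973, 3320331979501, 3320336173805,
   2518882422538644152045, 156834486677226937741, 4055229685325, 156834486264749514477,
   60298408315940126743949, 60298408315940126350733, 60298408315940126449037, 60298408315940126481805,
   1131054649204109, 4055229685165, 3848749693677, 3848745499373, 156834486264883764973,
   156834486608182331117, 156834486677221596813, 2518882421439429271277, 156834486677225791149,
   19047165112591393938445, 4055242268077, 4055234928045, 156834486677225790893, 156834486677226937805,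
   1131103615209805, 156834486608215885549, 2564397948653, 2705141545677, 289362546430106637,
   157374919611265038349, 60432435441210942536237, 1131105692433005, 20556775796438189216217741,
   60298408315742284954317, 2214342569517, 1130313276861997, 289362529820761645, 148151547694961417613,
   289362530114231693, 2798943228237, 157374918640894238189, 4073785155117, 3780230012493,
   289361307633987245, 2024193476637144102687825701901, 1258516885139374043451512429,
   60298696546062384258669, 289361795409529453, 1258516885139373684131780173, 289361376623275021,
   3318655242573, 289362276665024109, 60298408316957257644653, 289362276799241837, 60298408316305163964749,
   4075932638829, 289361369912195693, 3322815992141, 60298408315995184970349, 60298408316785458952813,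
   60298408316819818691181, 3321374456429, 3321370262125, 157374919754072569869, 21472335496438324669965,
   57923678247468132219469, 60284861488902954826445, 1131074553919853, 2532168448621, 289361213408688749,
   74364570343004584557, 3002504071437, 2832823757837, 5482825185794982040329485, 37940918469340350918349,
   157374919740113926157, 156834487788855647501, 156834487789929389325, 289361028122434573,
   289361267901348589, 152763232623542950925, 60284861489368623233645, 20575660362453500852263949,
   2214345420365, 2832957975565, 2214476852493, 289361032417401869, 289361272196315885, 4068416445997,
   60289473174293170117645, 60445405807776987799213, 156834486676894268013, 60284861488894364891853,
   157374918640333512141, 5482825185794973450395085, 2518882421164149815949, 2208139065901,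
   157374919576937052909, 2697594953005, 2216729065773, 20570942895886609559313709, 289361361624349261,
   3318186523373, 3917334592237, 4064134159949, 289361783905602157, 157374919284883868269, 2216521157261,
   2216823147149, 2901271686765, 5459364962558415095507981, 4076250547213, 148151546951981386381,
   1417828274434076324944719469, 74364570344078326381, 3608561534605, 2827453315085, 157122717411568146157,
   157122717783827306189, 2212299880749, 157699179660848052525, 2518882421095666465069,
   11488618243430300260617338112472205005, 3006829443693, 19047165111843630594733, 21265079842682287152141,
   148151546457784564365, 148151546595487604205, 2564111681133, 2966325059021, 148151547626015865453,
   21476947181707342595757, 21408348353283821910573, 40214803936430710733549, 60224621339645212712333,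
   4054802086541, 4913780024608436360297133, 1131707055684333, 2968144660493, 289361784979344109,
   1131063111146509, 157374918641407253837, 157374918642749496333, 5482825185794975866379277, 2700839574541,
   2700973792269, 2691334200973, 19047165112582330989293, 2543008234157, 157374918986446879277,
   19047165112170081630893, 60298120085925347973453, 289361443557825549, 5121977064708421334197721421,
   2566893100365, 289362323827308877, 156834486264812518093, 2543142451885, 156834486309915475469,
   289361073839528461, 60441352567745581431821, 73824139238487865997, 60436470666848855146029, 4073785253421,
   289361430636256653, 21265079842683360893965, 2967398800845, 289361373133421165,
   1568058563358513677590716045, 15474323681103901548887725, 15171876053417140223860461, 2832823856141,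
   4075944172909, 15187288308092095438282093, 2214446083661, 74364570038744702317,
   20632107687549419936308589, 2214446116429, 2562732710925, 156834486642506709357, 2694689709613,
   289361272196414189, 4068416544301, 289361445429206573, 2214446214733, 74364570109330075245,
   157374919525666274029, 609315344717, 1130725929167885, 3780230143565, 156834486608141564653,
   60445405807639984984397, 156834486539421989517, 1131054480383469, 1131054513937805,
   60445694037760661675021, 60371618831428198215277, 289361374207162989, 156834486642775144845,
   15187288308090982600693197, 2968208292557, 2968144726029, 2560316432109, 15187288308090858168276461,
   289361266833340813, 2562728549389, 577593911130306573, 74364570205560388333, 577593911132242957,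
   1131019799083405, 1130779703467405, 289361472991639949, 2762049862381, 2212299815469, 289361039882313101,
   5802917124185792390216397, 1130792423022285, 2562732743693, 156834486642506709389, 289361477286607245,
   2693330385613, 156834486333537434093, 289361168578928333, 156834486415034899469, 1130710561372653,
   40361513197182145714669, 156834486333268998637, 4913780024607725715995085, 60445405808842417879469,
   60298120086470515899117, 20556775796438189383989901, 60445946239337370770989, 15474310422506807775738573,
   1131054446861709, 21472335496301053488653, 3986183240429, 4068429127245, 2518882421301756541581,
   60298120086607954950765, 60445694038958186016461, 157374919422322821741, 2901271817837, 2656458784429,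
   157374919525800524525, 60298372288207919626893, 157122717411982094061, 1131707156347629,
   74112368734875531917, 60224585311741288102637, 2831748282381, 4075944172973, 4075948367277, 4068432174509,
   152763232319114096205, 21481270638084025137901, 156834487797888146445, 289360688820113741, 2213373557325,
   60432435441207821941293, 2969282034285, 157122717857920429773, 19047165112273160845997, 3986183109357,
   2518882421164317588109, 156834486621697456749, 60445405807468228366669, 156834486367891733197,
   289361169652670157, 2970620026317, 5482825185793882519461485, 289361376354646637, 73824139376027417325,
   156834486195897219789, 2701836902125, 157374917894375987661, 577593883080731661,
   5482825185794982040329677, 60298696546336980098509, 157374917898670823885, 2214342634957,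
   157374918640335609293, 157374918641407253965, 5482825185794974524136909, 156834486264611191437,
   156834487570186090957, 2680447187629, 15172078967602217034833357, 156834486470708017613,
   156834486642506709453, 2518882421095670659533, 60224621339301419596237, 3848745499085,
   156834486470775126477, 2214581516973, 2680581405357, 60445405808601865927117, 289360689696910829,
   60445405808624392494573, 157374918640335871469, 2210285633069, 2730111839245, 2971693768141,
   289361377428388461, 156834486423541767821, 2730045910029, 1130837587284301, 157374918366142717421,
   60284861487857232010733, 289361266833340909, 2791747336685, 157374918640325418477, 157374918640896335341,
   577593539716262925, 157374918502901040621, 152763232147316878829, 157374918640335609325,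
   157374918641407253997, 60284861489129514351309, 1131062981123085, 2796042303981, 156834486677025512461,
   4054470385229, 1131054479990157, 10336388947741359799024237, 4648847816352881677, 4077011655693,
   4079166479373, 4079159139341, 1131054647762317, 156834486677226839053, 289360693130711373,
   60298408316297984355917, 60432435441949676157549, 20570942895886746830003501, 289362323724843757,
   2700773186573, 4648847678580933645, 60289473173881362591437, 74364571399896447725, 4648847323551974413,
   156834486607738714733, 10336388947741362574348621, 157374919525531663085, 157374918337542827021,
   156834486607738747629, 60289473173984441806541, 156834486367220644493, 60445405807468173840717,
   156834486642573817869, 2214447364109, 1130313511644173, 2738657183757]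

def size2 : Ck := ⟨10, 14, [⟨14, 16, 10, 8, 131, 93⟩, ⟨131, 20, 10, 12, 1085, 1011⟩, ⟨1085, 37, 12, 15, 6994, 10366⟩, ⟨6994, 106, 16, 17, 0, 82713⟩], 17, 94183, 14, 12000, 15, 3000⟩

def part3 : List ℕ :=
  [23647497229, 25187021, 20132674573, 21768205, 25908237, 805786637, 481061522445, 763381773, 19352529933,
   807213, 807341, 824195085, 360732685, 360728589]

/-- Machines left over by the fast deciders, with certificates. -/
def rest3 : List ℕ :=
  [289362341986259981, 74400599838486647821, 3848647694957, 289362106501443085, 1131726802402829,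
   1131726054764045, 1131726819212301, 289362277561814029, 4071951389709, 4071955584013, 289361180585643021,
   3894329266375132657631046381, 157374919304677112845, 60445405807790128877869, 289362348424516621,
   289362348428710925, 157392932849120138253, 60445405807571332976941, 19051452539221891044749,
   1130848457214701, 74112369615038010765, 157699180898065765069, 156834486215487012365,
   20570937707739771607690765, 74400599769969343501, 4003659565069, 15187205297743492091793101,
   157374919304676686861, 3625711945741, 289361018260804301, 289361224251615917, 1131793361651725,
   60445946239388939408749, 10299638998321655618164077, 4854902304950892630628877, 289360689729350221,
   2518882422367248110285, 3952341255832607082459474957, 34752541817895609155226878143393737741,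
   3626047492813, 2796782143501, 1112997892386134176265054598559837588565741, 74400599836880917197,
   74688832412056933069, 289362169840751981, 3695270646797, 60224909569696936767021,
   15474033721345722932483629, 60431858980873404690125, 156834487432939688653, 156834486402257702445,
   3763486446285, 60224909569746353377997, 157392933870996344365, 2738622213133, 2738757348365,
   2492176509421, 4913780024607897741052397, 2841670332109, 3941179567117, 2738624211981, 1130917075309965,
   3917803311821, 148151546133916696141, 3935288185549, 3597057764941, 60298408315203371679309,
   60298408315203505897037, 3930993218253, 289362049019631181, 37936631043580316076621,
   20613222833303465805654605, 3627121234637, 73824139307571858061, 74400599837954659021,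
   19125239515363499430605, 148151546471075137549, 60298408315815541623149, 3930993316557,
   60224603324922420805197, 60220297883677971983949, 60224044878568481631821, 60445405807045104774733,
   60440794121022382419533, 2518882421370673124941, 60431858980873354952365, 60431858980872834854573,
   60431858980873438244557, 1130318028750413, 157122716725725385421, 1130710883325421, 1130930060151277,
   3764560188109, 1130827923608269, 289360698218621517, 577593877103888397, 2738662419757,
   289361087172299405, 156834486458050958029, 289362174138766029, 60289473173544550816365,
   60436470666753828662893, 3592762928749, 21481558869475638685293, 289360984094132845, 2865501620237,
   156834486587005192205, 60298120085243766517357, 3780230139469, 157374919457049562733,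
   157374919682482912877, 156834486608378346093, 3711604345453, 2562732964877, 157699180760593320557,
   157374919442031984237, 152763233427848703597, 156834486608373175917, 156834486402257702509, 3765633929933,
   156834486367857070797, 156834487467375055565, 156834486367855039181, 156834486582710355981, 2862284785677,
   3868323004045, 3608561538701, 3938811597837, 289362276150169165, 60445405807045107920461,
   156834486402256621133, 60445405807040812953165, 3320769170029, 157374919682550021741,
   156834486608445454957, 2701556764301, 156834486458084512461, 1131726823406605, 4076250551309,
   156834486608212743917, 60298696547365626851053, 74400599462480497389, 1338290801752916021965,
   156834486608213006061, 289362072139574925, 156834486196164348557, 157392932985833303053,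
   148151546960705538701, 74400599943181291213, 157374919304680881165, 156834486264817767117,
   60298372288173858769261, 2223338040909, 2219043073613, 156834486449494577869, 156834486367896982221,
   1130827990717133, 156834486367888593613, 19047165112307659003533, 2738624310285, 56743086626849510046733,
   289362173065089741, 2596967988237, 2597102205965, 2518882421405167342989, 157374919719110592525,
   10351585029633084486044333, 3631955487757, 3627660520461, 157392932985866857485, 2596934433805,
   60437047126409835402605, 289362174135719277, 3699565614093, 74112368700175698285, 1130710983988717,
   3767781413581, 2214447370669, 2733020731405, 2565185589677, 20570942895886822931912397,
   10336388947741362575070541, 4055104901837, 4055100707533, 2596968021005, 2597102238733,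
   40214803936431787264749, 60445405807777491407149, 1131054648481165, 156834487776746853069,
   156834486677226836685, 4075944170189, 157374919753470330893, 21408348353280872857293,
   5802917700647942775680013, 289362278969822221, 577594371029125837, 60224585311212908366541,
   156834486333598288173, 1131707462306509, 19047165112136086803949, 289362171595341325, 289362171629419533,
   2596934466573, 2955294329197, 156834486677193247085, 1130711017543149, 3768855155405, 1131844901128909,
   156834486367964091085, 156834486367955702477, 60445946239457503696589, 60445946239457503685325,
   289362313394269709, 289362309099302413, 289362313395842061, 289362309100874765, 2734507469837,
   2734507502605, 2734507535373, 289362313390075565, 2738802174989, 2734507207693, 2734507273229,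
   4913780024608722175874797, 74364571146159181549, 74364571146163375853, 60445405807790363758893,
   60298120085926899363565, 74112367985064951533, 289362102853549581, 1131726051716621,
   157122718108737648653, 60298372288193230056461, 157122718108871866381, 18964154763516239465197,
   289362486257567757, 74364570665460521709, 74364570665460517613, 3701210600141, 156834487727332703981,
   156834486608512596717, 3769928897229, 74364571455734634509, 74364571455734630413, 60298696547261168760845,
   289361121536133389, 3935275602637, 2218740956717, 2219037699629, 37940918469349511015917,
   60298696546062091701837, 2218740956749, 20575443901440253059415629, 2219037699661,
   60445946240095461267181, 577594059527771149, 289360969056927341, 10336172774958149287554381,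
   3574164212141, 2518882420975389333133, 157374919579558755341, 2218908728909, 2219042946637,
   60298408316304961583725, 60298408316305095801453, 152763233629850844173, 3320756587117,
   289361795739833037, 289362447938376397, 289362461463958221, 157374919478557821965,
   60445946240818907555853, 157374919579559803917, 289360694179282669, 60298120085926899363149,
   60298408317092553305453, 4912599432987970644660941, 3574164343213, 60436470666754485403245,
   152763232155901112013, 60298408316772578283085, 2493774839533, 5482825185794228545203821, 2219030461997,
   3597056454253, 289361258974955789, 2487534340109, 60436470665791756021005, 2493779033837,
   60432435441488266771469, 15187288308091614402040525, 2219036655181, 60289473174637950286445,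
   1130966104953549, 148151546507108766733, 74112367988893494925, 59251555589497565761069, 2218640518701,
   60224585310366964591149, 2219037703757, 2218640518733, 156834486196155959949, 60224585310366964591245,
   2474426116781, 289362375235840013, 2768856169773, 3917761268461, 289361784039819885,
   57923678246402348297837, 5517062342795319449441677, 289362436137931469, 74112368534093082253,
   74364570094664989325, 2216554711693, 157374918997544585837, 21408348353280805748429,
   21408348353282951133933, 74400599943181291245, 157122717420492205805, 4113114115085,
   157122718108469213197, 60298372288193221667853, 19115763940549218053773, 157392932642235919373,
   148151546952115604109, 152763233286215445997, 74400599943169756909, 156834486230255884013, 3768858193197,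
   3631955094541, 3627660127245, 2521904236557, 4648847748386565421, 3632089377805, 3627794410509,
   3630341411533, 3627121225421, 157392932661954827629, 60371618831048834926605, 157122717784335930381,
   4648847885825518989, 289361271855564813, 19047165112239168902445, 325393240518077453, 289362106498068077,
   60284861489173664644557, 19047165112307659003181, 851767963705762610131103062747651055846632013,
   2509013404141, 152763233491937668813, 5500617070453616081881101, 6504120153911680904663674573,
   514430027301460634374417470729709, 37940918470860769406573, 152763233455121452781, 3779924315789,
   289360694179348205, 60445405807296429672781, 2690814103181, 289362266084920333,
   4043937535124629747175566349, 2562494316269, 2532405750797, 3779923889805,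
   1112997892386134176265054598558806226316845, 2518882421267697649997, 60298372288173856672077,
   289361409294223693, 289361484356860941, 2518882421130258696525, 2562498510573, 73824138081132521485,
   2210286620973, 2543145593517, 2518882421027177384429, 74400599838621187789, 74400599838655462413,
   3700661398541, 289362175751334925, 2214446082637, 2214446213709, 289361072136142445, 289361121536264557,
   59251267359022160460813, 59251267359022294678541, 73824139238492056269, 60445946239457503694541,
   152763233455121485549, 74400599735609081197, 60436470666857564618349, 3631955160077, 74400599769969179661,
   3627660192781, 157392932985531313165, 60298372288192827403277, 3700808854541, 3696513887245,
   74400599837954649805, 289361271855630349, 2219034656333, 2218741083725, 157374919372628700781,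
   20268706505038065329481741, 60298372288173856672109, 289361409294223725, 157374918311773154669,
   2562732702733, 289362171585904205, 1131794770865773, 74364571041599078125, 156834487411972362957,
   2702620348717, 74400599838692981773, 60298120085243751837293, 289361168574730957, 156834486471042255245,
   73824137613068873325, 2218741087821, 2223331749453, 2219037830733, 1130318027701837,
   156834487639273228685, 74400599454293183085, 74400600107128309773, 2219043077709,
   682539655956730030282125, 2223329652301, 60445694037760661666829, 20632024677200755353988813,
   152781248111743281773, 2219030494797, 577593911489811469, 1130317994474893, 1131073975106957,
   1131054648219021, 2562728541197, 3608523721325, 336925368335705766827142480710029, 2620688484365,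
   2219032591949, 60298372288173860866413, 2219034689101, 60224909570983504336269, 60445405807755253229965,
   2562732735501, 156834485940405026509, 2219036786253, 73824138083280005133, 2219037834829,
   157122716318911941005, 60298372287898976930285, 156834486333596125677, 73824138001440745965,
   1130711017281005, 156834486333595863533, 2669871640269, 15171876053418291430664749,
   15474310422506504306310701, 2527268882445, 73824137613068906221, 3768855408173, 3768855408333,
   3764560441037, 60284861487974609858157, 3768855407917, 1130745276618125, 156834487467374990029,
   156834486367854973645, 2518882421147188024973, 1338290800434071688845, 1338290801752909730509,
   5802917124187235268635245, 4044169521165, 152763233423654399469, 152763233455121551085, 3597057764781,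
   157374919444232685581, 2694035328653, 157392932985598422029, 2659343190029, 156834486333597993261,
   289360694117482029, 60289473173537255969485, 3896620995277, 60289473174017732365901, 3767444817933,
   3768855146189, 3764560178893, 157699180760593320365, 157374919442011536973, 3759191478989,
   20556775796438086376172077, 60445405807486817513101, 156834486367893830285, 156834486367885447885,
   1131844892871309, 2518882422229540743821, 152763233492071886541, 2518882421130256599533,
   289361176967531021, 60445405808533374978605, 289361102074041037, 289360689628686925,
   152763233455121583853, 289361479768594445, 289361479768590349, 37936631042225039949549, 1131108201085965,
   15187288308090673466460621, 577594371029125581, 2532405881869, 1131707462306253, 3780058107533,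
   2214447370541, 60445946239457503695565, 156834486539786868173, 289361178780937869, 156834485940405092045,
   5482825185794699646325453, 157122717857920438989, 74364571091066014157, 2680584546989,
   74400599976060141261, 1130726991876813, 289361103147782861, 2662422238221, 74400599976065384141,
   2738657645581, 156834486402088160909, 60445946239569572674029, 60298696546049723026445,
   152763232588278024685, 152763232151611846125, 2525119629325, 15491797935888615009994765, 2565185589549,
   2518882421267697650157, 1130930063297005, 156834487433114798573, 2518882421130258696685,
   156834486402087898765, 289362169843897357, 289362174138864653, 3004685113357, 3004685109261,
   289360694103785005, 289360693453663789, 289362357744063181, 60289473173546359598669, 289362254674284109,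
   60298408316302279323213, 5198385615548839207382637, 157374919269550763021, 157392932298637487117,
   157392932294342519821, 152763233285477248717, 157392932661957973005, 4648847645738019853,
   4648847782746303501, 60289473173889952525869, 60289473173889952526029, 152763233319836987085,
   4648847666053600269, 156834486333597567309, 289362175756086285, 74400599838688295949, 289362171461118989,
   60289473173993031740973, 60289473173993031741133, 152763233422916202189, 156834486677092652045,
   1131844901259277, 157392933870997392397, 156834486333597567469]

def size3 : Ck := ⟨10, 14, [⟨14, 16, 10, 8, 134, 90⟩, ⟨134, 20, 10, 12, 1080, 1064⟩, ⟨1080, 37, 12, 15, 6993, 10287⟩, ⟨6993, 106, 16, 17, 0, 81572⟩], 17, 93013, 14, 12000, 15, 3000⟩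

def part4 : List ℕ :=
  [671897613, 618500480013, 805327309, 15057566733, 828385293, 437016589, 807565, 25904141, 629168141,
   25182669, 494946317, 805655565, 595609613, 25773069, 25510925]

/-- Machines left over by the fast deciders, with certificates. -/
def rest4 : List ℕ :=
  [60224585311775877421805, 3868313573389, 289362137094767629, 4003523319821, 74364569559675262477,
   2518882421439430318829, 289362141389734925, 5802917124185792390224589, 10638620114414059487875725,
   3316174564077, 3848744164077, 3873678088205, 3316040477421, 3316174695149, 3848748358381,
   156834486470775132621, 3873682282509, 3316174301933, 514390413220203502206370240060141,
   10638620114414070182269581, 60436470666751208610317, 4897168731570673308457997, 60445405807330590206701,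
   60436470667022902274061, 156834486264812460653, 20629746216077389962959213, 20628565624457853603437933,
   1130315747055981, 60445946239607985167725, 4937079350278739981, 2508944955917, 60445946239470546928653,
   156834486677226934733, 60289473174980337026061, 3889195030213956025452879341, 74364569557619202541,
   156834486471034917325, 156834487725084498477, 426295955479198579966406376610349, 3867004950541,
   289362392641855021, 20025269759442964317526637, 39121528104185051273837, 20556775796438223984962157,
   4004443904013, 60445405807627053980013, 346212545063166735720122507340525, 156834486460216760877,
   20025269759442964317526765, 60224585311775877323501, 3883103902445, 3883108096749, 156834487829237520749,
   15474033721345722932485677, 1486132583818762353842083853, 157392932602506487821, 60289473174637650689613,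
   157392932671225964557, 60436470665997208411149, 2836130061325, 40214803936804706375693,
   20632038512259177975765549, 613622678238387213, 156834486415034893325, 156834486608215853613,
   3930990173741, 1486132583818761769723484717, 156834487501759830573, 156834487550064581165,
   156834486402252462701, 156834486608215886381, 20575660362454454630374861, 156834486454847986285,
   14567629892852786538764781, 1130316820797933, 3868078692365, 20570942895886822998923853,
   5189279277824596557, 2837409258509, 148151547557568666221, 4005517645837, 10336388947740254214377933,
   156834486608216148557, 401422711396380872415360854765, 21472335496786607397613, 2837610650637,
   5802917412417474218339053, 2832816160461, 157374918504578570253, 74112368592610666861,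
   60298408315816481413133, 289362049019627085, 156834485929742162509, 83623972118114641933,
   157392932603580229645, 152781247753383946253, 1130317894539629, 157374919663007713869, 1130931003218957,
   577593881253108749, 3897280682573, 156834486608215853645, 3930990173773, 60298408315198003075661,
   4896223011676619574563469, 156834486608215886413, 156834486554525190893, 2738657182157, 2738657772557,
   2738657510413, 157374918503504566765, 157374918502901171693, 1130317894539757,
   2001769714817643557899733051917, 156834486264812526189, 156834486388276058669, 148151547557568667245,
   1130917142093421, 156834486460217023085, 156834486460216760941, 3320670595693, 3320804813421,
   289362413576543853, 74364569835726199405, 5482825185793732208221805, 38010093759966124235789,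
   22593227400363370667021, 73824138228088069133, 157374919663007713901, 1130917075246477,
   289361087035071085, 74688831578531965325, 2826735476109, 2827820096525, 2827824290829, 2827811707917,
   2827815902221, 2832106675213, 1130731285239821, 60445405807468029258477, 4896223011676468324848269,
   2863090189325, 2833181432845, 2833181563917, 74364570183506746381, 60445405807717371619853,
   156834486264812526221, 156834486264812524173, 156834486625270977165, 4005752526861, 156834485936252665421,
   3938506268269, 3320634956397, 3320469269101, 289361376354647661, 156834486608213723757, 1130985761954413,
   156834486264817769101, 156834486264817767053, 156834486630639686285, 60224585311947680307949,
   156834487364330445453, 156834487364330443405, 156834487707921373933, 3986183117549, 3986187311853,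
   60445405807708681361133, 4011121235981, 74364570665696414445, 289362417472035853, 60445405807708681349869,
   156834487732298797709, 289361795886623373, 19047165111036516162157, 148151546960537766541,
   15474323681104213034969101, 74364569566206908781, 156834487639197735565, 156834486623244667629,
   156834486423541994125, 156834486402088161933, 426613176405339639047220102486701, 3871299917837,
   20570942895886822998923949, 289362409985268749, 289361135838707373, 3940241692685, 3768431663693,
   20025269759442968612493933, 289361796859701869, 4913780024609134633888365, 289362449694828557,
   60224909570008433318509, 4008738871309, 4008892028941, 3700807817229, 346212545063166735719405248555565,
   289361796845066989, 226009779117861097933, 4112040384525, 60445405807742907296141, 289362495855188717,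
   3320670595757, 60437047126121677904557, 60437047126422309952173, 2582869564480115727021,
   60445405807330590370541, 20611077534614134653770765, 157392932663708735501, 21412635779396053489677,
   4032596072461, 289361782827047309, 344281569965, 577593684759402509, 1130826951246861,
   156834487329962187437, 10336389235970630366089869, 289361308330351629, 10336389235970981104308877,
   156834487725084498637, 3872373659661, 20570942895886822998923981, 5189279277824596685,
   156834486264812526285, 3695440156685, 156834486391497284141, 3696513898509, 60224909569677744003661,
   3322782440045, 60298408316307203900749, 60224909569701343255149, 5213650296271391464794733, 4009812613133,
   2508953475789, 3699735123981, 3700808865805, 156834486460217023181, 156834486460216761037,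
   20556775796439495288904429, 289361797918808813, 577594373005691629, 156834487044356200749, 3632090437645,
   156834487776648255789, 4113114126349, 60445405807835359926637, 289362530214927085, 156834486677226079629,
   5802917412417611657292525, 156834487044346796781, 289362588200130573, 152763233734908729357,
   2214342639309, 60289473174291539903757, 83623972255553595405, 577594370861353677, 4099167082509,
   157392932607875196941, 3686850222093, 157392932663709784077, 74364571273937608397, 2955529210221,
   152781247757678913549, 1130322189506925, 289361293264411341, 60371618831392345283277, 289361454291767757,
   2508945087181, 2543304825549, 156834486449479604941, 577593685833144333, 1130826905803469,
   156834486449479342797, 3897280682701, 156834486450553215693, 156834486402257705581,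
   60436182434999665220301, 19047165112136021433037, 156834486460216695405, 60298408315939958577645,
   1130322189507053, 2832205339661, 3316171234029, 514390413220203502206370249497325, 3873447401485,
   3316175428333, 157374919336116569837, 1132016490209005, 60298696545577202965229, 3941727493741,
   3320466201325, 74364570665460520685, 4010886354957, 3320470395629, 157122717418117225197,
   21408348352780609937133, 1130917142093549, 156834486608216148717, 3700809914381, 1130589561314029,
   3942387144717, 3986521637325, 289362486001715213, 1131419534674669, 38010093759970419203085,
   22593227400367665634317, 6504120153911681202940258317, 60298408315802687790477, 1130917209464205,
   2827954314253, 2827958508557, 2827945925645, 2827950119949, 2832253475853, 2832240892941, 2832245087245,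
   682539655956730030284173, 156834486608215853805, 20632033900574074162470637, 3004685440013,
   156834486608215886573, 3917803183565, 2831179341293, 2831166758381, 2831170952685, 2214345588269,
   2214613761613, 2518882421164149822093, 2518882420975389332109, 2214342573613, 289360689428577837,
   60224044879992493199821, 2561646285261, 60298408315768284664269, 156834486342105291309,
   60298408315199076712013, 3917803176397, 74112369084604961421, 2798464384013, 289362413582835309,
   74112369829021602445, 2498177090573, 60298408315889483274253, 2214747979341, 3917803180493,
   289361795578350189, 289361795582544493, 60298408315858500997581, 157374919752732131789,
   157374919753201895437, 60298696546186660437645, 60289473175252135861261, 289361787296688781,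
   148151546129594006541, 60298408317004976245101, 289360689427594797, 289360964770348621,
   60298408315199210929741, 157374918552914514381, 10336388947741362570482317, 3917761600781,
   60298120084822990012109, 21408348353285327504653, 1130837617693133, 10336388947741965391614605,
   152763232151131150349, 577594988766190861, 2828528802829, 60298408316914315320589, 2832823770125,
   157374918503974584781, 157374918504444348429, 289361783771384429, 157374918538804086797, 2827948940301,
   20570647747982799651757357, 289361259001106893, 1669228032878871773528390385229, 2827453029389,
   2831747996685, 20575660362453831769246253, 2214445989453, 722238822669, 60298408316914312600845,
   2828663020557, 2832957987853, 157699179729323020941, 152763232492388113421,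
   11408216873134984104193561445741877517, 157699179536271757965, 60289473174155174363597,
   60298696546192498903053, 2832243907597, 60224585310572880843405, 60224585310380902273677,
   10336388947740838432360461, 20575443901440248764448333, 1568058563358511822637877805,
   157374918410076706829, 1417543600244305077610404333, 157122717920859445261, 157122717920863639565,
   3316175427885, 60224585310676358453997, 2827745582093, 60224044878593289345581,
   38633632518567356837391430549010136653, 289362083307805293, 152763232979151836781, 289362083311999597,
   2523310702253, 4897168731570699992312557, 3608386361965, 2827812756493, 22593227399742051625613,
   2216789592717, 74400599462614715117, 157392932296087349997, 157392933086461995021, 157392932986693142541,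
   157122718083810896621, 157122718208465610765, 157392932283705764493, 157392932974121756685,
   157122717409870129805, 148151546951947831949, 157122718099212380173, 156834487707727776045,
   40214803936431921482477, 60224585310848157145837, 10638620114414139158748461, 60445405807560482347309,
   156834486721135958637, 1131419262076653, 157392933074952890381, 2827946974221, 74112369082472114445,
   3320670595373, 3320804813101, 20553229121659367934241069, 157392932593916553229, 157392932288000731437,
   60437047126443900119053, 19115763940560222923405, 5518242934416036904315245, 157392932662636029965,
   4648847622220917133, 20632107687549282242551149, 1130308230863213, 3003276116429, 1130308230863341,
   289360689695637069, 2557670342317, 14870963540715363366165005, 3662155143181, 156834486378612382285,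
   156834487364323990125, 2564111550061, 2565185585613, 3642746100333, 2828886498317,
   20556775796437983466793581, 60445405807722606111053, 57923678247535707277325, 78435823960892035533,
   289360687576828237, 60298408316307203769677, 156834486333598287181, 74364570665460516589,
   289361784979348205, 3642746100461, 3004685829133, 3004685698061, 3004685435917, 1131419600693581,
   2557938253517, 1130589561313613, 60445405807030007486797, 60436470665725822150669, 157392932594990295053,
   157392932663709771789, 20632107687549282276105581, 1130309304605037, 56890336318782065432941,
   289361441406865869, 10336388947741362574677325, 5518306921558146650855757, 60445405807468028963565,
   3003745912845, 6583004057827806171879758317, 1130309304605165, 60298696546672524871021, 4066950633485,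
   3620274034701, 20575660362453350260006541, 20268706505038018378161517, 2597062263821, 2597062001677,
   20556775796438258401303917, 289362403924401901, 2214345424461, 2832823860237, 74112369704465358189,
   3938509413741, 2832823868429, 1130589561313645, 60436470665760181889037, 4648847622086699373,
   2214446087757, 20575443901440865095141741, 289361109586041197, 289361442480607693,
   60298408316695700232557, 289362406075122125, 4913780024607931797757293, 157374918502894656973,
   157374918502894657005, 157392933940318198157, 74364569561910991245, 2765500733837, 2765504928141,
   60224585311947643572685, 157392933974678329357, 577593846894417933, 2799860865037, 2799865059341,
   156834485936249519693, 3917803307469, 577593881254156301, 74112368528152603245, 60440794121599892170765,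
   289362186625047117, 2901270740589, 74364569977449076749, 2214748110413, 3917803311565,
   60445405807708547197549, 60445405807708412979821, 157122717000603294093, 577593271367752077,
   1131001869785485, 289361378025691533, 156834486539720023437, 577593684758353933, 3917757373837,
   577593685832095757, 60224909570983504338317, 60298372286680147580941, 3917790728653, 1130960150483405,
   1130959402844621, 1130959872608269, 2620544112653, 74364569840017365005, 1131097467408845,
   21408348352170627062029, 60289473174909545240589, 740208460855667905550428202370899764105468301,
   9215400333, 2827810659341, 2827814853645, 60436470665794541627405, 4854902304951312726677517,
   2827944877069, 2827949071373, 577593572016510989, 74364570345779777997, 6369303674375476893044791309,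
   74364569557619071309, 577593606376249357, 20632029288886750290598445, 2214446120525,
   271047301701168618394055788058637, 289361086982236845, 1130311452088685, 74364569557619071341,
   60298408315905423169933, 577593675095726093, 156834486677092585933, 74364570015033088013, 2832239844365,
   2832244038669, 289361104221526477, 289361105295726605, 60298408315199076817293, 74364569557619071437,
   156834486414952059533, 577593743815202829, 1130311451171309, 682539655956523765946957, 1130826847344653,
   289361103142115341, 20570942895886660987759245, 1130710883260909, 577593778174154765, 1130311452088813,
   74364569557619071469, 156834486402079773325, 157122716725726926861, 577593778174941197, 2660749557421,
   2660753751725, 60224585311672563389069, 60224585311655433818765, 2832040549389, 3862920944205,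
   4000359897677, 3765234358285, 3759841729101, 156834487467403205229, 152763232979156031085,
   289361142272575085, 60289473174636837160269, 289361238917824141, 21412635779024640453261, 3986414852717,
   60445405807708547230445, 2660750605997, 2660754800301, 156834487776746852813, 156834486382795701965,
   2518882422253142102669, 3770598873101, 74364570665561179885, 156834486622778474221,
   21408348353282847360749, 2832241941517, 3004786099213, 2518882422263836562061, 148151547578440506797,
   2661017468621, 3755566487565, 289361259006349773, 148151545852457310541, 60298696545574020565581,
   3767310604301, 20632107687549282376768877, 148151545852457310573, 289361444628091341,
   2518882421164313399949, 1130724842788877, 2518882421142893056653, 156834486677226836429,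
   60224585310573048615565, 60224585310552700965517, 289361138581264845, 156834486539485958797,
   156834487776403903117, 156834487825781346957, 148151545852457310669, 156834486451392074381,
   156834486450519495309, 60445405807468029127309, 156834486367694604941, 156834486367964090829,
   156834487467469263501, 156834487483593216653, 60298696546178503564781, 1130312525830637,
   148151545852457310701, 156834486367955702221, 156834486367689462413, 74364570046645487117,
   14833184608852406204586509, 156834486264611197581, 156834486554525187821,
   346212545063166735719397732231725, 60445405807502522930797, 60445694038512168000109,
   60445405807502522919533, 2833181465613, 60224585310594509822605, 156834486623244664557,
   156834486423541731981, 1130311420922317, 148151547420129712877, 2833315683341, 156834486539786870221,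
   157374918460372146637, 2214342639053, 78976256053874022413, 83623971980675688461,
   2024193476637144102413001087341, 20632107687549282410323309, 1130313599572333, 156834486539786867149,
   74364569979599215053, 289361445701833165, 1130792378258061, 156834486414951797389, 156834486677092651469,
   1130313598687725, 1130313599572461, 5199400186473703437490701, 156834486453472285325, 577593262780963405,
   289362443252770829, 148151546474188463117, 2214580600365, 156834486402087899789, 1131810502952429,
   60224585311947675065069, 1130837587284429, 2738657514509, 156834486333598287341, 3004920481805,
   1130925512477165, 152763232155425855981, 2826874936813, 157374918503972494829, 60432435440723468246509,
   78976255837871987181, 1130589561313773, 60298408315458749651437, 60436182435512846408013,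
   577593262780963149, 2214446218829, 577593262780963181, 289361446775574989, 2831165709805, 2831169904109,
   289361111737719277, 289361103141853197, 1130779505971853, 156834486402079511181, 60298408315596188604909,
   289361103141984269, 577593262780963245, 577593262780963277, 577593262780963309,
   1486132583818762373636054573, 2209141348365, 60224909569677720934957, 3917031431757, 4648847322542102541,
   1130917041429517, 1130917074983949, 156834486367874964077, 156834486608393067245, 156834486367874964109,
   156834487329969526797, 289362495854139405, 60445405807743018129773, 156834487044356233229,
   156834487329970575373, 19047165111139574602445, 156834486367874964173, 60289473175241496091661,
   1130917209201677, 289361258992652749, 152763232485543009293, 152763232485547203597,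
   60289473174155174370317, 157392932296590665741, 4648847622120253453, 157392932289074472973, 2199510141581,
   60445405807364949420781, 3930993318925, 156834487638526644877, 156834487638916846221,
   156834487033561174669, 156834487432993264269, 1130312527927309, 157392933802879244301, 577593262777817101,
   2628061779981, 2628065974285, 60445405807468028635757, 156834486367874898541, 157392933837238982669,
   1130312524879885, 2662421518349, 2662425712653, 157374918502900588013, 1130312528025613,
   156834485921198299693, 3299228309517, 3299229358093, 156834485921198299853, 157392932275015165965,
   1130298566137869, 156834485920963449485, 156834486367203873421]

def size4 : Ck := ⟨10, 15, [⟨15, 16, 10, 8, 135, 105⟩, ⟨135, 20, 10, 12, 1104, 1056⟩, ⟨1104, 37, 12, 15, 7026, 10638⟩, ⟨7026, 106, 16, 17, 0, 81772⟩], 17, 93571, 14, 12000, 15, 3000⟩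

end BB4

namespace BB4

theorem chunk0 : chunk size0 part0 rest0 (fun _ A => Nat.beq A 0) = true := by decide +kernel

end BB4

namespace BB4

theorem chunk1 : chunk size1 part1 rest1 (fun _ A => Nat.beq A 0) = true := by decide +kernel

end BB4

namespace BB4

theorem chunk2 : chunk size2 part2 rest2 (fun _ A => Nat.beq A 0) = true := by decide +kernel

end BB4

namespace BB4

theorem chunk3 : chunk size3 part3 rest3 (fun _ A => Nat.beq A 0) = true := by decide +kernel

end BB4

namespace BB4

theorem chunk4 : chunk size4 part4 rest4 (fun _ A => Nat.beq A 0) = true := by decide +kernel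

end BB4

namespace BB4

theorem cyc_ok : withCodes 9 6 cycs (fun m A => cycStage 3 6 0 100 80 60 m A fun _ A => Nat.beq A 0) = true := by
  decide +kernel

theorem prefix_ok : chunk ⟨6, 1, [⟨1, 10, 10, 4, 16, 16⟩, ⟨16, 16, 10, 8, 132, 60⟩], 7, 76, 7, 76, 1, 1⟩ [rootC] []
    (isCodes 13 132 firsts) = true := by
  decide +kernel

end BB4

namespace BB4

theorem dec0 : decided (List.append fins cycs) rest0 = true := by decide +kernel

end BB4

namespace BB4

theorem dec1 : decided (List.append fins cycs) rest1 = true := by decide +kernel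

end BB4

namespace BB4

theorem dec2 : decided (List.append fins cycs) rest2 = true := by decide +kernel

end BB4

namespace BB4

theorem dec3 : decided (List.append fins cycs) rest3 = true := by decide +kernel

end BB4

namespace BB4

theorem dec4 : decided (List.append fins cycs) rest4 = true := by decide +kernel

end BB4

namespace BB4

/-! ## The root of the search is good -/

theorem fins_good : ∀ x ∈ fins, Good (codeOf x) := fun x hx _ hG _ _ _ => ⟨x, hx, Or.inl hG⟩

theorem cycs_good : ∀ x ∈ cycs, Good (codeOf x) := by
  obtain ⟨m, A, h1, -, h2, -⟩ := withCodes_true cyc_ok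
  obtain ⟨m', A', h3, -, h4⟩ := cycStage_true (by norm_num) h1
  have h5 : AllG m A := by
    apply h4
    intro i hi
    rw [Nat.eq_of_beq_eq_true h3] at hi
    simp at hi
  intro x hx
  obtain ⟨j, h6, h7⟩ := h2 x hx
  rw [← h7]
  exact h5 j h6

theorem spec_good : ∀ x ∈ List.append fins cycs, Good (codeOf x) := by
  intro x hx
  rcases List.mem_append.1 hx with h | h
  · exact fins_good x h
  · exact cycs_good x h

theorem part_good {v : Ck} {cs out : List ℕ} (hv : ∀ u ∈ v.vs, 0 < u.W)
    (h : chunk v cs out (fun _ A => Nat.beq A 0) = true) (hd : decided (List.append fins cycs) out = true) :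
    ∀ c ∈ cs, GoodM (codeOf c) := by
  obtain ⟨m, A, h1, h2⟩ := chunk_true hv h (decided_true hd spec_good)
  apply h2
  intro i hi
  rw [Nat.eq_of_beq_eq_true h1] at hi
  simp at hi

def parts : List ℕ := part0 ++ part1 ++ part2 ++ part3 ++ part4

theorem parts_good : ∀ c ∈ parts, GoodM (codeOf c) := by
  intro c hc
  simp only [parts, List.mem_append] at hc
  rcases hc with (((h | h) | h) | h) | h
  · exact part_good (by simp [size0]) chunk0 dec0 c h
  · exact part_good (by simp [size1]) chunk1 dec1 c h
  · exact part_good (by simp [size2]) chunk2 dec2 c h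
  · exact part_good (by simp [size3]) chunk3 dec3 c h
  · exact part_good (by simp [size4]) chunk4 dec4 c h

/-- Numeric exchange of the states 2 and 3. -/
def swpN (c : ℕ) : ℕ :=
  (fun x => Nat.xor x (Nat.land (Nat.shiftRight x 1) 35468117025))
    (c % 1048576 + (c / 1073741824) * 1048576 + (c / 1048576 % 1024) * 1073741824)

def eqE (e e' : EB) : Bool :=
  e.s0 == e'.s0 && e.s1 == e'.s1 && e.w == e'.w && e.r == e'.r && e.l == e'.l

theorem eqE_true {e e' : EB} (h : eqE e e' = true) : e = e' := by
  obtain ⟨a, b, c, d, f⟩ := e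
  obtain ⟨a', b', c', d', f'⟩ := e'
  simp [eqE] at h
  simp [h]

def swpOk (c : ℕ) : Bool :=
  parts.contains c || (parts.contains (swpN c) &&
    decide (∀ q a, eqE (codeOf (swpN c) q a) (swapC (codeOf c) q a) = true))

theorem swp_ok : firsts.all swpOk = true := by decide +kernel

theorem firsts_good : ∀ c ∈ firsts, GoodM (codeOf c) := by
  intro c hc
  have h := List.all_eq_true.1 swp_ok c hc
  simp only [swpOk, Bool.or_eq_true, Bool.and_eq_true, List.contains_iff_mem, decide_eq_true_eq] at h
  rcases h with h | ⟨h1, h2⟩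
  · exact parts_good c h
  · apply GoodM_swap
    have : swapC (codeOf c) = codeOf (swpN c) := by
      funext q a; exact (eqE_true (h2 q a)).symm
    rw [this]
    exact parts_good _ h1

theorem root_good : GoodM (codeOf rootC) := by
  obtain ⟨m, A, h1, h2⟩ := chunk_true (by simp) prefix_ok (by simp)
  refine h2 ?_ rootC (by simp)
  intro i hi
  obtain ⟨c, hc, e⟩ := isCodes_true h1 i hi
  rw [e]
  exact firsts_good c hc

end BB4

namespace BB4

/-! ### Elimination of stationary moves, completed -/

theorem ones_K {c : Cf} (h : (Kset c).Finite) :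
    {j | c.tape j = true}.ncard = (Kset c).ncard - (bif (ent c).2 then 0 else 1) := by
  have e : Kset c = insert c.head {j | c.tape j = true} := by
    ext j; simp [Kset, or_comm]
  rcases hc : (ent c).2 with _ | _
  · have hc' : c.tape c.head = false := hc
    rw [e, Set.ncard_insert_of_notMem (by simp [hc']) (h.subset (by rw [e]; exact Set.subset_insert _ _))]
    simp
  · have hc' : c.head ∈ {j | c.tape j = true} := hc
    rw [e, Set.insert_eq_of_mem hc']
    simp

theorem stayElim2 {f : TM} (h : HaltsK f 0) :
    ∃ G, NoStay G ∧ OneNone G ∧ HaltsK G 0 ∧ (Function.Injective G → f = G) ∧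
      ∃ r t, f (ent (run f r (initCfg 0))) = none ∧ G (ent (run G t (initCfg 0))) = none ∧
        ((∀ e, G e = G (0, false) → e = (0, false)) →
          {j | (run f r (initCfg 0)).tape j = true}.ncard = {j | (run G t (initCfg 0)).tape j = true}.ncard) := by
  classical
  obtain ⟨r, h1, h2⟩ := h
  obtain ⟨t, h3, h4⟩ := chase_sim f (r + 1) r (initCfg 0) (by omega) h1
  set g := chase f (r + 1) with hg
  set d := run g t (initCfg 0) with hd
  have hA : ∃ x0, g (0, false) = some x0 := by
    rcases hx : g (0, false) with _ | x0
    · have : run g t (initCfg 0) = initCfg 0 := run_none hx t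
      rw [← h4, hd, this, Kset_init] at h2
      omega
    · exact ⟨x0, rfl⟩
  obtain ⟨x0, hx0⟩ := hA
  let G : TM := fun e => if e = ent d then none else some ((g e).getD x0)
  have hGd : G (ent d) = none := by simp [G]
  have hGg : ∀ e x, g e = some x → G e = some x := by
    intro e x he
    have : e ≠ ent d := by rintro rfl; rw [h3] at he; cases he
    simp [G, this, he]
  have hnone : ∀ e, G e = none ↔ e = ent d := by intro e; simp [G]
  have hrun : run G t (initCfg 0) = d := run_agree hGd hGg t _ hd.symm h3
  refine ⟨G, ?_, ⟨ent d, hnone⟩, ⟨t, by rw [hrun]; exact hGd, by rw [hrun, h4]; exact h2⟩, ?_,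
    r, t, h1, by rw [hrun]; exact hGd, ?_⟩
  · intro e q w he
    by_cases hed : e = ent d
    · simp [G, hed] at he
    · simp only [G, hed, if_false, Option.some.injEq] at he
      rcases hge : g e with _ | x
      · rw [hge] at he
        exact chase_noStay f _ _ q w (hx0.trans (congrArg some he))
      · rw [hge] at he
        exact chase_noStay f _ _ q w (hge.trans (congrArg some he))
  · intro hinj
    have hgG : ∀ e, g e = G e := by
      intro e
      rcases hge : g e with _ | x
      · by_cases hed : e = ent d
        · rw [hed, hGd]
        · have h5 : G e = some x0 := by simp [G, hed, hge]
          have h6 : e = (0, false) := hinj (h5.trans (hGg _ _ hx0).symm)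
          rw [h6, hx0] at hge; cases hge
      · exact (hGg _ _ hge).symm
    have hchain : ∀ e, f e = none → g e = none := by
      intro e he; simp [hg, chase, he]
    funext e
    rcases hfe : f e with _ | ⟨q, w, dd⟩
    · rw [← hgG]; exact (hchain _ hfe).symm
    · have key : g e = G e := hgG e
      rcases dd
      · rw [← key]; simp [hg, chase, hfe]
      · exfalso
        have hend := hchain _ h1
        rw [hgG, hnone] at hend
        by_cases hed : e = ent d
        · rw [← hend] at hed; rw [hed, h1] at hfe; cases hfe
        · have hge : g e ≠ none := by rw [key]; rw [Ne, hnone]; exact hed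
          obtain ⟨x, hx⟩ := Option.ne_none_iff_exists'.1 hge
          have hc : chase f r (q, w) = some x := by
            have := hx; rw [hg, chase] at this; simpa [hfe] using this
          have hc' := chase_mono _ _ _ _ hc
          have : e = (q, w) := hinj (by rw [← hgG, ← hgG, hx]; exact hc'.symm)
          subst this
          have := chase_loop f q w hfe r
          rw [this] at hc; cases hc
      · rw [← key]; simp [hg, chase, hfe]
  · intro hcond
    have hge : g (ent (run f r (initCfg 0))) = none := by rw [hg, chase, h1]
    have he : ent (run f r (initCfg 0)) = ent d := by
      by_contra hne
      have h5 : G (ent (run f r (initCfg 0))) = some x0 := by simp [G, hne, hge]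
      rw [hcond _ (h5.trans (hGg _ _ hx0).symm), hx0] at hge
      cases hge
    have hfin : (Kset (run f r (initCfg 0))).Finite := Set.finite_of_ncard_ne_zero (by omega)
    rw [hrun, ones_K hfin, ones_K (by rw [h4]; exact hfin), h4, he]

/-! ## Words on the tape -/

theorem count_range (w : List Bool) :
    ((Finset.range w.length).filter (fun k => w.getD k false = true)).card = w.count true := by
  induction w with
  | nil => rfl
  | cons a w ih =>
    rw [Finset.card_filter] at ih ⊢
    rw [List.length_cons, Finset.sum_range_succ', List.count_cons, ← ih]
    cases a <;> simp

theorem word_count {tape : ℤ → Bool} {w : List Bool} (h : TapeWord tape w) :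
    {j | tape j = true}.ncard = w.count true ∧ {j | tape j = true}.Finite := by
  obtain ⟨i, h1, h2, -⟩ := h
  have key : {j | tape j = true} =
      (fun k : ℕ => i + (k : ℤ)) '' ((Finset.range w.length).filter (fun k => w.getD k false = true) : Finset ℕ) := by
    ext j
    constructor
    · intro hj
      obtain ⟨a, b⟩ := h2 j hj
      refine ⟨(j - i).toNat, ?_, ?_⟩
      · have e : i + ((j - i).toNat : ℤ) = j := by omega
        have l : (j - i).toNat < w.length := by omega
        simp only [Finset.coe_filter, Finset.mem_range, Set.mem_ofPred_eq]
        refine ⟨l, ?_⟩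
        rw [h1 _ l, e]; exact hj
      · show i + ((j - i).toNat : ℤ) = j
        omega
    · rintro ⟨k, hk, rfl⟩
      simp only [Finset.coe_filter, Finset.mem_range, Set.mem_ofPred_eq] at hk
      show tape (i + k) = true
      rw [← h1 k hk.1]; exact hk.2
  constructor
  · rw [key, Set.ncard_image_of_injective _ (fun a b h => by simpa using h), Set.ncard_coe_finset, count_range]
  · rw [key]; exact (Finset.finite_toSet _).image _

theorem word_exists {tape : ℤ → Bool} (hf : {j | tape j = true}.Finite) (hn : {j | tape j = true}.Nonempty) :
    ∃ w, TapeWord tape w := by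
  obtain ⟨a, ha, ha'⟩ := Set.exists_min_image _ id hf hn
  obtain ⟨b, hb, hb'⟩ := Set.exists_max_image _ id hf hn
  simp only [Set.mem_ofPred_eq, id] at ha ha' hb hb'
  have hab : a ≤ b := hb' a ha
  have hl : ∀ k : ℕ, k < (b - a).toNat + 1 →
      ((List.range ((b - a).toNat + 1)).map (fun k : ℕ => tape (a + k))).getD k false = tape (a + k) := by
    intro k hk
    rw [List.getD_eq_getElem _ _ (by simpa using hk)]
    simp
  refine ⟨(List.range ((b - a).toNat + 1)).map (fun k : ℕ => tape (a + k)), a, ?_, ?_, ?_⟩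
  · intro k hk
    exact hl k (by simpa using hk)
  · intro j hj
    have := ha' j hj
    have := hb' j hj
    simp; omega
  · intro _
    refine ⟨?_, ?_⟩
    · rw [hl 0 (by omega)]; simpa using ha
    · rw [List.range_succ, List.map_append, List.map_singleton]
      have e : a + ((b - a).toNat : ℤ) = b := by omega
      rw [List.getLastD_concat, e]; exact hb

/-! ## Simulating one machine -/

structure SC where
  q : Fin 4
  p : ℕ
  T : ℕ

def flipB (T p : ℕ) (w : Bool) : ℕ := bif T.testBit p == w then T else T ^^^ (1 <<< p)

theorem tb_flip (T p : ℕ) (w : Bool) (i : ℕ) :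
    (flipB T p w).testBit i = if i = p then w else T.testBit i := by
  have h1 : (1 <<< p).testBit i = decide (p = i) := by
    rw [Nat.one_shiftLeft, Nat.testBit_two_pow]
  unfold flipB
  by_cases hi : i = p
  · subst hi
    cases h : T.testBit i <;> cases w <;> simp [h, h1]
  · have hi' : ¬ p = i := fun h => hi h.symm
    cases h : (T.testBit p == w) <;> simp [h1, hi, hi']

/-- Run with fuel; the answer is tested in the halting configuration. -/
def sim (f : TM) (k : SC → Bool) : ℕ → SC → Bool
  | 0, _ => false
  | n + 1, s =>
    match f (s.q, s.T.testBit s.p) with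
    | none => k s
    | some (q, w, .left) => (match s.p with
      | 0 => false
      | p + 1 => sim f k n ⟨q, p, flipB s.T s.p w⟩)
    | some (q, w, .right) => sim f k n ⟨q, s.p + 1, flipB s.T s.p w⟩
    | some (_, _, .stay) => false

structure SRep (s : SC) (c : Cf) : Prop where
  st : c.state = s.q
  hd : c.head = s.p - 64
  tp : ∀ i : ℕ, c.tape (i - 64) = s.T.testBit i
  lo : ∀ j : ℤ, j < -64 → c.tape j = false

theorem SRep.ent {s c} (h : SRep s c) : ent c = (s.q, s.T.testBit s.p) := by
  simp [BB4.ent, h.st, h.hd, h.tp]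

theorem SRep.app {s c q w d} {p' : ℕ} (h : SRep s c) (hp : (p' : ℤ) = s.p + Dir.move d) :
    SRep ⟨q, p', flipB s.T s.p w⟩ (app (q, w, d) c) := by
  constructor
  · rfl
  · simp only [BB4.app, h.hd, hp]; ring
  · intro i
    simp only [BB4.app, Function.update_apply, h.hd, tb_flip, h.tp]
    by_cases hi : i = s.p
    · simp [hi]
    · have : ¬ ((i : ℤ) - 64 = s.p - 64) := by omega
      simp [hi]
  · intro j hj
    have : ¬ (j = (s.p : ℤ) - 64) := by omega
    simp only [BB4.app, Function.update_apply, h.hd, this, if_false]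
    exact h.lo j hj

theorem sim_true {f : TM} {k : SC → Bool} : ∀ n s c, SRep s c → sim f k n s = true →
    ∃ t s', f (ent (run f t c)) = none ∧ SRep s' (run f t c) ∧ k s' = true := by
  intro n
  induction n with
  | zero => intro s c _ h; simp [sim] at h
  | succ n ih =>
    intro s c hr h
    unfold sim at h
    rcases hf : f (s.q, s.T.testBit s.p) with _ | ⟨q, w, d⟩
    · rw [hf] at h
      exact ⟨0, s, by rw [run_zero, hr.ent]; exact hf, hr, h⟩
    · have hs : stepT f c = app (q, w, d) c := stepT_some (by rw [hr.ent]; exact hf)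
      have go : ∀ s', SRep s' (app (q, w, d) c) → sim f k n s' = true →
          ∃ t s', f (ent (run f t c)) = none ∧ SRep s' (run f t c) ∧ k s' = true := by
        intro s' h1 h2
        obtain ⟨t, s'', h3⟩ := ih s' _ h1 h2
        refine ⟨t + 1, s'', ?_⟩
        rw [run_succ, hs]; exact h3
      rw [hf] at h
      rcases d with _ | _ | _
      · rcases hp : s.p with _ | p
        · simp [hp] at h
        · simp only [hp] at h
          rw [← hp] at h
          exact go ⟨q, p, _⟩ (hr.app (by rw [hp]; simp [Dir.move])) h
      · cases h
      · exact go ⟨q, s.p + 1, _⟩ (hr.app (by simp [Dir.move])) h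

theorem SRep_init : SRep ⟨0, 64, 0⟩ (initCfg 0) := by
  constructor <;> simp [initCfg]

def ones (T : ℕ) : ℕ := ((List.range 128).filter (fun i => T.testBit i)).length

theorem ones_ncard {s c} (h : SRep s c) (hT : s.T < 2 ^ 128) :
    {j | c.tape j = true}.ncard = ones s.T ∧ {j | c.tape j = true}.Finite := by
  have key : {j | c.tape j = true} =
      (fun k : ℕ => (k : ℤ) - 64) '' ((Finset.range 128).filter (fun k => s.T.testBit k = true) : Finset ℕ) := by
    ext j
    constructor
    · intro hj
      have hj' : c.tape j = true := hj
      have h0 : -64 ≤ j := by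
        by_contra hc
        rw [h.lo j (by omega)] at hj'; cases hj'
      have e : (((j + 64).toNat : ℕ) : ℤ) - 64 = j := by omega
      rw [← e, h.tp] at hj'
      refine ⟨(j + 64).toNat, ?_, e⟩
      simp only [Finset.coe_filter, Finset.mem_range, Set.mem_ofPred_eq]
      refine ⟨?_, hj'⟩
      by_contra hc
      rw [Nat.testBit_lt_two_pow (lt_of_lt_of_le hT (Nat.pow_le_pow_right (by norm_num) (by omega)))] at hj'
      cases hj'
    · rintro ⟨k, hk, rfl⟩
      simp only [Finset.coe_filter, Finset.mem_range, Set.mem_ofPred_eq] at hk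
      show c.tape _ = true
      rw [h.tp]; exact hk.2
  constructor
  · rw [key, Set.ncard_image_of_injective _ (fun a b h => by simpa using h), Set.ncard_coe_finset]
    simp only [Finset.card_def, Finset.filter_val, Finset.range_val, Multiset.range, ones,
      Multiset.filter_coe, Multiset.coe_card, Bool.decide_eq_true]
  · rw [key]; exact (Finset.finite_toSet _).image _

/-! ## The exceptional machines -/

instance decDir : DecidableEq Dir
  | .left, .left => isTrue rfl
  | .left, .stay => isFalse (fun h => by cases h)
  | .left, .right => isFalse (fun h => by cases h)
  | .stay, .left => isFalse (fun h => by cases h)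
  | .stay, .stay => isTrue rfl
  | .stay, .right => isFalse (fun h => by cases h)
  | .right, .left => isFalse (fun h => by cases h)
  | .right, .stay => isFalse (fun h => by cases h)
  | .right, .right => isTrue rfl

abbrev mac (c : ℕ) : TM := dec (codeOf c)

def onesF (c : ℕ) : ℕ := bif c == 344281569965 || c == 344315156845 || c == 275403946509 then 11 else 12

theorem sim_fins : ∀ c ∈ fins, sim (mac c)
    (fun s => decide (s.T < 2 ^ 128) && ones s.T == onesF c) 200 ⟨0, 64, 0⟩ = true := by
  decide +kernel

theorem inj_fins : ∀ c ∈ fins, c ≠ 275403946509 → ∀ e e', mac c e = mac c e' → e = e' := by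
  decide +kernel

theorem inj0_fins : ∀ c ∈ fins, ∀ e, mac c e = mac c (0, false) → e = (0, false) := by
  decide +kernel

theorem none_fins : ∀ c ∈ fins, ∀ e e', mac c e = none → mac c e' = none → e = e' := by
  decide +kernel

theorem write_fins : ∀ c ∈ fins, ∀ q, ((mac c (q, false)).all fun x => x.2.1) = true := by
  decide +kernel

theorem last_fins : mac 756198003373 = rel swp false (mac 291756397229) := by
  decide +kernel

theorem halt_fins {c : ℕ} (hc : c ∈ fins) : ∃ t, mac c (ent (run (mac c) t (initCfg 0))) = none ∧
    {j | (run (mac c) t (initCfg 0)).tape j = true}.ncard = onesF c ∧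
    {j | (run (mac c) t (initCfg 0)).tape j = true}.Finite := by
  obtain ⟨t, s, h1, h2, h3⟩ := sim_true _ _ _ SRep_init (sim_fins c hc)
  simp only [Bool.and_eq_true, decide_eq_true_eq, beq_iff_eq] at h3
  obtain ⟨h4, h5⟩ := ones_ncard h2 h3.1
  exact ⟨t, h1, h4.trans h3.2, h5⟩

theorem match_fins {c : ℕ} (hc : c ∈ fins) {H : TM} (h : Match (codeOf c) H) (h1 : OneNone H) : H = mac c := by
  obtain ⟨t, h2, -⟩ := halt_fins hc
  set e1 := ent (run (mac c) t (initCfg 0)) with he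
  have hd : ∀ e, e ≠ e1 → H e = mac c e := by
    intro e hne
    rcases hx : mac c e with _ | x
    · exact absurd (none_fins c hc e e1 hx h2) hne
    · exact Match_dec h e x hx
  have hne : ∀ e, e ≠ e1 → H e ≠ none := by
    intro e hne h0
    rw [hd e hne] at h0
    exact hne (none_fins c hc e e1 h0 h2)
  obtain ⟨e0, h0⟩ := h1
  have : e0 = e1 := by
    by_contra hx
    exact hne e0 hx ((h0 e0).2 rfl)
  funext e
  by_cases hx : e = e1
  · rw [hx, h2, ← this]; exact (h0 e0).2 rfl
  · exact hd e hx

theorem rel_comp (σ τ : Equiv.Perm (Fin 4)) (m : Bool) (f : TM) : rel τ false (rel σ m f) = rel (τ * σ) m f := by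
  funext e
  simp only [rel, Option.map_map]
  have : ∀ x, (relX τ false ∘ relX σ m) x = relX (τ * σ) m x := by
    rintro ⟨q, w, d⟩
    cases m <;> cases d <;> rfl
  exact congrArg₂ Option.map (funext this) rfl

theorem rel_comp' (σ τ : Equiv.Perm (Fin 4)) (m : Bool) (f : TM) : rel τ m (rel σ false f) = rel (τ * σ) m f := by
  funext e
  simp only [rel, Option.map_map]
  have : ∀ x, (relX τ m ∘ relX σ false) x = relX (τ * σ) m x := by
    rintro ⟨q, w, d⟩
    cases m <;> cases d <;> rfl
  exact congrArg₂ Option.map (funext this) rfl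

/-- The final tape of a symmetric copy of an exceptional machine. -/
theorem halt_rel {c : ℕ} (hc : c ∈ fins) {σ : Equiv.Perm (Fin 4)} (h0 : σ 0 = 0) (m : Bool) :
    ∃ t, rel σ m (mac c) (ent (run (rel σ m (mac c)) t (initCfg 0))) = none ∧
    {j | (run (rel σ m (mac c)) t (initCfg 0)).tape j = true}.ncard = onesF c ∧
    {j | (run (rel σ m (mac c)) t (initCfg 0)).tape j = true}.Finite := by
  obtain ⟨t, h1, h2, h3⟩ := halt_fins hc
  have e : run (rel σ m (mac c)) t (initCfg 0) = relC σ m 0 (run (mac c) t (initCfg 0)) := by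
    rw [← run_relC, init_relC, h0]
  refine ⟨t, ?_, ?_, ?_⟩
  · rw [e, rel_ent, h1]; rfl
  · rw [e, ← h2]
    exact ncard_relC (fun j => (run (mac c) t (initCfg 0)).tape j = true) m 0
  · rw [e]
    have := image_relC (fun j => (run (mac c) t (initCfg 0)).tape j = true) m 0
    exact (congrArg Set.Finite this).mpr (h3.image _)

/-- Every good machine is an exceptional one up to symmetry. -/
theorem classify {f : TM} (h : HaltsK f 0) : ∃ c ∈ fins, ∃ σ m, σ 0 = 0 ∧
    (c ≠ 275403946509 → f = rel σ m (mac c)) ∧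
    ∃ r, f (ent (run f r (initCfg 0))) = none ∧ {j | (run f r (initCfg 0)).tape j = true}.ncard = onesF c := by
  obtain ⟨G, g1, g2, g3, g4, r, t, g5, g6, g7⟩ := stayElim2 h
  obtain ⟨σ, m, n1, n2, n3⟩ := normalise g1 g3
  have hF := root_good _ n1 (OneNone_rel g2) (NoStay_rel g1) n2
  obtain ⟨c, hc, hF⟩ := hF
  have key : ∃ τ : Equiv.Perm (Fin 4), rel τ m G = mac c ∧
      (τ 0 = 0 ∨ ∃ q d, rel τ m G (τ 0, false) = some (q, false, d)) := by
    rcases hF with hF | hF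
    · exact ⟨σ, match_fins hc hF (OneNone_rel g2), n3⟩
    · refine ⟨swp * σ, ?_, ?_⟩
      · rw [← rel_comp]; exact match_fins hc hF (OneNone_rel (OneNone_rel g2))
      · rcases n3 with n3 | ⟨q, d, n3⟩
        · left; rw [Equiv.Perm.mul_apply, n3]; rfl
        · right
          refine ⟨swp q, d, ?_⟩
          rw [← rel_comp, Equiv.Perm.mul_apply]
          have : swp.symm (swp (σ 0)) = σ 0 := Equiv.symm_apply_apply _ _
          rw [rel, this, n3]; simp [relX]
          cases d <;> rfl
  obtain ⟨τ, k1, k2⟩ := key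
  have h0 : τ 0 = 0 := by
    rcases k2 with k2 | ⟨q, d, k2⟩
    · exact k2
    · exfalso
      have := write_fins c hc (τ 0)
      rw [← k1, k2] at this
      simp at this
  have h0' : τ⁻¹ 0 = 0 := by rw [Equiv.Perm.inv_eq_iff_eq, h0]
  have hG : G = rel τ⁻¹ m (mac c) := by rw [← k1, rel_rel]
  refine ⟨c, hc, τ⁻¹, m, h0', ?_, r, g5, ?_⟩
  · intro hne
    rw [← hG]
    exact g4 (rel_injective (σ := τ) (m := m) (by rw [k1]; exact fun e e' => inj_fins c hc hne e e'))
  · rw [g7 ?_]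
    · obtain ⟨t', a1, a2, -⟩ := halt_rel hc h0' m
      rw [← hG] at a1 a2
      rw [run_halt_unique g6 a1, a2]
    · intro e he
      have : (τ e.1, e.2) = (0, false) := by
        apply inj0_fins c hc
        rw [← k1]
        simp only [rel, Equiv.symm_apply_apply]
        rw [show τ.symm 0 = 0 from h0', he]
      obtain ⟨b1, b2⟩ := Prod.mk.inj this
      exact Prod.ext (τ.injective (b1.trans h0.symm)) b2

theorem haltsK_of {f : TM} {w : List Bool} {t : ℕ} (h : Computes f 0 w t) (hw : w.count true = 12) :
    HaltsK f 0 ∧ f (ent (run f t (initCfg 0))) = none ∧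
    {j | (run f t (initCfg 0)).tape j = true}.ncard = 12 := by
  obtain ⟨c, h1, h2, h3⟩ := h
  have e := steps_run h1
  obtain ⟨h4, h5⟩ := word_count h3
  have hh : f (ent (run f t (initCfg 0))) = none := by rw [e]; exact h2
  have hn : {j | (run f t (initCfg 0)).tape j = true}.ncard = 12 := by rw [e, h4, hw]
  refine ⟨⟨t, hh, ?_⟩, hh, hn⟩
  rw [← hn, e]
  apply Set.ncard_le_ncard
  · intro j hj; exact Or.inl hj
  · have : Kset c = {j | c.tape j = true} ∪ {c.head} := by ext j; simp [Kset, or_comm]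
    rw [this]; exact h5.union (Set.finite_singleton _)

/-- The list of busy beavers. -/
def beavers : Finset TM :=
  (((Finset.univ.filter (fun σ : Equiv.Perm (Fin 4) => σ 0 = 0)) ×ˢ (Finset.univ : Finset Bool)) ×ˢ
    ({291756397229, 609315344717} : Finset ℕ)).image (fun x => rel x.1.1 x.1.2 (mac x.2))

theorem card_beavers : beavers.card = 24 := by decide +kernel

theorem mem_beavers {f : TM} : f ∈ beavers ↔
    ∃ (w : List Bool) (t : ℕ), Computes f 0 w t ∧ w.count true = 12 := by
  constructor
  · intro h
    simp only [beavers, Finset.mem_image, Finset.mem_product, Finset.mem_filter, Finset.mem_univ, true_and,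
      and_true, Finset.mem_insert, Finset.mem_singleton] at h
    obtain ⟨⟨⟨σ, m⟩, c⟩, ⟨h0, hc⟩, rfl⟩ := h
    simp only at h0 hc ⊢
    have hF : c ∈ fins ∧ onesF c = 12 := by
      rcases hc with rfl | rfl <;> decide
    obtain ⟨t, h1, h2, h3⟩ := halt_rel hF.1 h0 m
    rw [hF.2] at h2
    obtain ⟨w, hw⟩ := word_exists h3 (Set.nonempty_of_ncard_ne_zero (by rw [h2]; norm_num))
    obtain ⟨t', ht⟩ := run_steps (f := rel σ m (mac c)) (t := t) (c := initCfg 0)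
    exact ⟨w, t', ⟨_, ht, h1, hw⟩, by rw [← (word_count hw).1, h2]⟩
  · rintro ⟨w, t, h, hw⟩
    obtain ⟨hK, hh, hn⟩ := haltsK_of h hw
    obtain ⟨c, hc, σ, m, h0, hf, r, hr1, hr2⟩ := classify hK
    have hc12 : onesF c = 12 := by
      rw [run_halt_unique hr1 hh, hn] at hr2
      exact hr2.symm
    have hcc : c = 291756397229 ∨ c = 609315344717 ∨ c = 756198003373 := by
      simp only [fins, List.mem_cons, List.not_mem_nil, or_false] at hc
      rcases hc with rfl | rfl | rfl | rfl | rfl | rfl <;> simp [onesF] at hc12 ⊢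
    have hf := hf (by rintro rfl; simp at hcc)
    simp only [beavers, Finset.mem_image, Finset.mem_product, Finset.mem_filter, Finset.mem_univ, true_and,
      and_true, Finset.mem_insert, Finset.mem_singleton]
    rcases hcc with rfl | rfl | rfl
    · exact ⟨⟨⟨σ, m⟩, _⟩, ⟨h0, Or.inl rfl⟩, hf.symm⟩
    · exact ⟨⟨⟨σ, m⟩, _⟩, ⟨h0, Or.inr rfl⟩, hf.symm⟩
    · refine ⟨⟨⟨σ * swp, m⟩, _⟩, ⟨?_, Or.inl rfl⟩, ?_⟩
      · rw [Equiv.Perm.mul_apply]; exact h0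
      · simp only
        rw [hf, last_fins, rel_comp']

end BB4

/-- Card(M_BB(4)) = 24: there are exactly 24 Turing machines
with at most 4 states (identified with their transition functions on the
state set Fin 4) that halt on the all-zero tape with a computed word
containing exactly BB(4) = 12 ones. -/
theorem card_busy_beaver_machines_4 :
    {f : Fin 4 × Bool → Option (Fin 4 × Bool × Dir) |
        ∃ (w : List Bool) (t : ℕ), Computes f 0 w t ∧ w.count true = 12}.ncard
      = 24 := by
  have h : {f : Fin 4 × Bool → Option (Fin 4 × Bool × Dir) |
      ∃ (w : List Bool) (t : ℕ), Computes f 0 w t ∧ w.count true = 12} = (BB4.beavers : Set BB4.TM) := by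
    ext f
    exact BB4.mem_beavers.symm
  rw [h, Set.ncard_coe_finset, BB4.card_beavers]
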